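/- arXiv:math/0511553 — 2 statements merged into one kernel-verified Lean document; each statement's English description precedes it below -/
import Mathlib

section
/- (Theorem 4.6) For every contact Lie algebra 𝒦=𝒦(ℓ⃗,σ,Γ,𝒥) in normalized form, the second cohomology group with trivial coefficients vanishes: H²(𝒦,F)=0; that is, every 2-cocycle ψ on 𝒦 is of the form ψ(u,v)=f([u,v]) for some linear function f:𝒦→F. -/
noncomputable section

/-- `ι_i = ℓ₁ + ⋯ + ℓ_i`. -/
def iot (ℓ : ℕ → ℕ) (i : ℕ) : ℕ := ∑ k ∈ Finset.Icc 1 i, ℓ k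

/-- `I_{i,j} = {ι_{i-1}+1, …, ι_j}`. -/
def iSet (ℓ : ℕ → ℕ) (i j : ℕ) : Finset ℕ := Finset.Icc (iot ℓ (i - 1) + 1) (iot ℓ j)

/-- The index-shift map `p ↦ p̄` (shift by `ι₆`). -/
def bar (ℓ : ℕ → ℕ) (p : ℕ) : ℕ := if p ≤ iot ℓ 6 then p + iot ℓ 6 else p - iot ℓ 6

/-- `K̄ = {p̄ : p ∈ K}`. -/
def barSet (ℓ : ℕ → ℕ) (K : Finset ℕ) : Finset ℕ := K.image (bar ℓ)

/-- `J_{i,j} = I_{i,j} ∪ Ī_{i,j}`. -/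
def jSet (ℓ : ℕ → ℕ) (i j : ℕ) : Finset ℕ := iSet ℓ i j ∪ barSet ℓ (iSet ℓ i j)

/-- The semigroup `𝒥 = 𝒥₀ × 𝒥₁`, encoded as functions `ℕ → ℕ`; `j0 = true`
means `𝒥₀ = ℕ` and `j0 = false` means `𝒥₀ = {0}`. -/
def jIdx (ℓ : ℕ → ℕ) (j0 : Bool) : Set (ℕ → ℕ) :=
  {i | (j0 = false → i 0 = 0) ∧
    ∀ p, 1 ≤ p →
      (p ∈ iSet ℓ 1 2 ∪ iSet ℓ 4 4 ∪ barSet ℓ (iSet ℓ 1 1) ∨ 2 * iot ℓ 6 < p) → i p = 0}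

/-- `σ_p` (with `σ_p = σ_{p̄}`). -/
def sgm (F : Type*) [Field F] (ℓ : ℕ → ℕ) (p : ℕ) : ℕ → F :=
  let q := if p ≤ iot ℓ 6 then p else p - iot ℓ 6
  if q ∈ iSet ℓ 1 3 then -Pi.single q (1 : F) - Pi.single (q + iot ℓ 6) (1 : F)
  else if q ∈ iSet ℓ 4 5 then -Pi.single q (1 : F)
  else 0

/-- The underlying space `𝒜`: the free `F`-module with basis `Γ × 𝒥`. -/
abbrev CA (F : Type*) [Field F] (ℓ : ℕ → ℕ) (Γ : AddSubgroup (ℕ → F)) (j0 : Bool) : Type _ :=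
  (↥Γ × ↥(jIdx ℓ j0)) →₀ F

/-- The basis monomial `x^{α,i⃗}`, with the convention that it is `0` if `(α,i⃗) ∉ Γ × 𝒥`. -/
def X (F : Type*) [Field F] (ℓ : ℕ → ℕ) (Γ : AddSubgroup (ℕ → F)) (j0 : Bool)
    (α : ℕ → F) (i : ℕ → ℕ) : CA F ℓ Γ j0 :=
  @dite _ (α ∈ Γ ∧ i ∈ jIdx ℓ j0) (Classical.dec _)
    (fun h => Finsupp.single (⟨α, h.1⟩, ⟨i, h.2⟩) 1) (fun _ => 0)

variable (F : Type*) [Field F] (ℓ : ℕ → ℕ) (Γ : AddSubgroup (ℕ → F)) (j0 : Bool)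

/-- The commutative associative product on `𝒜`. -/
def mulA (u v : CA F ℓ Γ j0) : CA F ℓ Γ j0 :=
  u.sum fun a ca => v.sum fun b cb =>
    (ca * cb) • X F ℓ Γ j0 (a.1.1 + b.1.1) (a.2.1 + b.2.1)

/-- The grading operator `∂*_p`. -/
def pstar (p : ℕ) (u : CA F ℓ Γ j0) : CA F ℓ Γ j0 :=
  u.sum fun a ca => (ca * a.1.1 p) • Finsupp.single a 1

/-- The down-grading operator `∂_{t_p}`. -/
def pt (p : ℕ) (u : CA F ℓ Γ j0) : CA F ℓ Γ j0 :=
  u.sum fun a ca => (ca * (a.2.1 p : F)) • X F ℓ Γ j0 a.1.1 (a.2.1 - Pi.single p 1)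

/-- `∂_p = ∂*_p + ∂_{t_p}`. -/
def dd (p : ℕ) (u : CA F ℓ Γ j0) : CA F ℓ Γ j0 := pstar F ℓ Γ j0 p u + pt F ℓ Γ j0 p u

/-- `∂ = Σ_{p∈J_{1,3}∪I_{4,5}} ∂*_p + Σ_{p∈I₆∪Ī_{4,6}} t_p ∂_{t_p}`. -/
def Dop (u : CA F ℓ Γ j0) : CA F ℓ Γ j0 :=
  (∑ p ∈ jSet ℓ 1 3 ∪ iSet ℓ 4 5, pstar F ℓ Γ j0 p u) +
    ∑ p ∈ iSet ℓ 6 6 ∪ barSet ℓ (iSet ℓ 4 6),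
      mulA F ℓ Γ j0 (X F ℓ Γ j0 0 (Pi.single p 1)) (pt F ℓ Γ j0 p u)

/-- The contact bracket (2.18):
`[u,v] = Σ_{p∈I} x^{σ_p}(∂_p u·∂_{p̄} v − ∂_{p̄} u·∂_p v) + (2−∂)(u)·∂₀(v) − ∂₀(u)·(2−∂)(v)`. -/
def brk (u v : CA F ℓ Γ j0) : CA F ℓ Γ j0 :=
  (∑ p ∈ iSet ℓ 1 6,
      mulA F ℓ Γ j0 (X F ℓ Γ j0 (sgm F ℓ p) 0)
        (mulA F ℓ Γ j0 (dd F ℓ Γ j0 p u) (dd F ℓ Γ j0 (bar ℓ p) v) -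
          mulA F ℓ Γ j0 (dd F ℓ Γ j0 (bar ℓ p) u) (dd F ℓ Γ j0 p v))) +
    mulA F ℓ Γ j0 ((2 : F) • u - Dop F ℓ Γ j0 u) (dd F ℓ Γ j0 0 v) -
    mulA F ℓ Γ j0 (dd F ℓ Γ j0 0 u) ((2 : F) • v - Dop F ℓ Γ j0 v)


set_option linter.all false
namespace CT

/-- Abstract data of a contact algebra: a commutative algebra with a multiplicative basis. -/
structure CSetup (K R : Type*) [Field K] [CommRing R] [Algebra K R] where
  n : ℕ
  G : ℕ → Prop
  T : ℕ → Prop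
  Gm : AddSubgroup (ℕ → K)
  b : Module.Basis (Gm × {i : ℕ → ℕ // ∀ p, ¬ T p → i p = 0}) K R
  b_one : b (0, ⟨0, fun _ _ => rfl⟩) = 1
  b_mul : ∀ x y, b x * b y = b (x.1 + y.1, ⟨x.2.1 + y.2.1, fun p hp => by
    simp [x.2.2 p hp, y.2.2 p hp]⟩)
  hn : 0 < n
  G_le : ∀ p, G p → 1 ≤ p ∧ p ≤ 2 * n
  T_le : ∀ p, T p → p ≤ 2 * n
  G_mem : ∀ p, G p → Pi.single p 1 ∈ Gm
  G_zero : ∀ α ∈ Gm, ∀ p, p ≠ 0 → ¬ G p → α p = 0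
  h0 : T 0 ∨ Pi.single 0 1 ∈ Gm
  ty : ∀ p, 1 ≤ p → p ≤ n →
    (G p ∧ G (p + n) ∧ ¬ T p ∧ ¬ T (p + n)) ∨
    (G p ∧ G (p + n) ∧ ¬ T p ∧ T (p + n)) ∨
    (G p ∧ G (p + n) ∧ T p ∧ T (p + n)) ∨
    (G p ∧ ¬ G (p + n) ∧ T (p + n)) ∨
    (¬ G p ∧ ¬ G (p + n) ∧ T p ∧ T (p + n))

variable {K R : Type*} [Field K] [CommRing R] [Algebra K R]

namespace CSetup
variable (S : CSetup K R)

/-- membership of exponents -/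
def M (α : ℕ → K) (i : ℕ → ℕ) : Prop := α ∈ S.Gm ∧ ∀ p, ¬ S.T p → i p = 0

open Classical in
/-- monomial, `0` if not a member -/
def mon (α : ℕ → K) (i : ℕ → ℕ) : R :=
  if h : S.M α i then S.b (⟨α, h.1⟩, ⟨i, h.2⟩) else 0

variable {S}

theorem mon_eq {α : ℕ → K} {i : ℕ → ℕ} (h : S.M α i) :
    S.mon α i = S.b (⟨α, h.1⟩, ⟨i, h.2⟩) := dif_pos h

theorem M_x (x : S.Gm × {i : ℕ → ℕ // ∀ p, ¬ S.T p → i p = 0}) : S.M x.1.1 x.2.1 :=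
  ⟨x.1.2, x.2.2⟩

theorem b_eq (x : S.Gm × {i : ℕ → ℕ // ∀ p, ¬ S.T p → i p = 0}) :
    S.b x = S.mon x.1.1 x.2.1 := (mon_eq (M_x x)).symm

theorem M.add {α β : ℕ → K} {i j : ℕ → ℕ} (h : S.M α i) (h' : S.M β j) :
    S.M (α + β) (i + j) :=
  ⟨add_mem h.1 h'.1, fun p hp => by simp [h.2 p hp, h'.2 p hp]⟩

theorem M.addG {α : ℕ → K} {i : ℕ → ℕ} {p : ℕ} (h : S.M α i) (hp : S.G p) :
    S.M (α + Pi.single p 1) i := ⟨add_mem h.1 (S.G_mem p hp), h.2⟩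

theorem M.subG {α : ℕ → K} {i : ℕ → ℕ} {p : ℕ} (h : S.M α i) (hp : S.G p) :
    S.M (α - Pi.single p 1) i := ⟨sub_mem h.1 (S.G_mem p hp), h.2⟩

theorem M.addT {α : ℕ → K} {i : ℕ → ℕ} {p : ℕ} (h : S.M α i) (hp : S.T p) :
    S.M α (i + Pi.single p 1) := ⟨h.1, fun q hq => by
      have : q ≠ p := fun e => hq (e ▸ hp)
      simp [h.2 q hq, this]⟩

theorem M.sub {α : ℕ → K} {i : ℕ → ℕ} (h : S.M α i) (j : ℕ → ℕ) :
    S.M α (i - j) := ⟨h.1, fun q hq => by simp [h.2 q hq]⟩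

theorem M_one : S.M 0 0 := ⟨zero_mem _, fun _ _ => rfl⟩

theorem M.z0 {α : ℕ → K} {i : ℕ → ℕ} (h : S.M α i) {p : ℕ} (hp : p ≠ 0) (hG : ¬ S.G p) :
    α p = 0 := S.G_zero α h.1 p hp hG

theorem mon_one : S.mon 0 0 = 1 := by
  rw [mon_eq M_one]; exact S.b_one

theorem mon_mul {α β : ℕ → K} {i j : ℕ → ℕ} (h : S.M α i) (h' : S.M β j) :
    S.mon α i * S.mon β j = S.mon (α + β) (i + j) := by
  rw [mon_eq h, mon_eq h', mon_eq (h.add h'), S.b_mul]; rfl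

/-- Extensionality on monomials. -/
theorem lin_ext {V : Type*} [AddCommGroup V] [Module K V] {f g : R →ₗ[K] V}
    (h : ∀ α i, S.M α i → f (S.mon α i) = g (S.mon α i)) : f = g :=
  S.b.ext fun x => by rw [b_eq]; exact h _ _ (M_x x)

theorem der_ext {f g : Derivation K R R}
    (h : ∀ α i, S.M α i → f (S.mon α i) = g (S.mon α i)) : f = g := by
  have := lin_ext (S := S) (f := f.toLinearMap) (g := g.toLinearMap) h
  ext u; exact LinearMap.congr_fun this u

/-- Induction on monomials. -/
@[elab_as_elim]
theorem mon_ind (S : CSetup K R) {P : R → Prop} (u : R) (hm : ∀ α i, S.M α i → P (S.mon α i))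
    (h0 : P 0) (ha : ∀ u v, P u → P v → P (u + v)) (hs : ∀ (c : K) u, P u → P (c • u)) : P u := by
  have : u ∈ Submodule.span K (Set.range S.b) := by rw [S.b.span_eq]; trivial
  induction this using Submodule.span_induction with
  | mem x hx => obtain ⟨y, rfl⟩ := hx; rw [b_eq]; exact hm _ _ (M_x y)
  | zero => exact h0
  | add x y _ _ hx hy => exact ha _ _ hx hy
  | smul c x _ hx => exact hs _ _ hx

theorem leib_of (D : R →ₗ[K] R) (h : ∀ α i β j, S.M α i → S.M β j →
    D (S.mon α i * S.mon β j) = S.mon α i * D (S.mon β j) + S.mon β j * D (S.mon α i)) (u v : R) :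
    D (u * v) = u • D v + v • D u := by
  simp only [smul_eq_mul]
  refine S.mon_ind u (fun α i hi => ?_) ?_ ?_ ?_
  · refine S.mon_ind v (fun β j hj => h _ _ _ _ hi hj) ?_ ?_ ?_
    · simp
    · intro v w hv hw; simp only [mul_add, map_add, hv, hw]; ring
    · intro c v hv; simp only [mul_smul_comm, map_smul, hv, smul_mul_assoc, smul_add]
  · simp
  · intro v w hv hw; simp only [add_mul, map_add, hv, hw]; ring
  · intro c v hv; simp only [mul_smul_comm, map_smul, hv, smul_mul_assoc, smul_add]

variable (S)
def stL (p : ℕ) : R →ₗ[K] R := S.b.constr K fun x => x.1.1 p • S.b x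
def dtL (p : ℕ) : R →ₗ[K] R :=
  S.b.constr K fun x => (x.2.1 p : K) • S.mon x.1.1 (x.2.1 - Pi.single p 1)
variable {S}

theorem stL_mon {α : ℕ → K} {i : ℕ → ℕ} (p : ℕ) (h : S.M α i) :
    S.stL p (S.mon α i) = α p • S.mon α i := by
  rw [mon_eq h, stL, Module.Basis.constr_basis]

theorem dtL_mon {α : ℕ → K} {i : ℕ → ℕ} (p : ℕ) (h : S.M α i) :
    S.dtL p (S.mon α i) = (i p : K) • S.mon α (i - Pi.single p 1) := by
  rw [mon_eq h, dtL, Module.Basis.constr_basis]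

theorem lower_add {i j : ℕ → ℕ} {p : ℕ} (h : i p ≠ 0) :
    i + j - Pi.single p 1 = (i - Pi.single p 1) + j := by
  funext q
  by_cases hq : q = p
  · subst hq; simp; omega
  · simp [hq]

theorem lower_add' {i j : ℕ → ℕ} {p : ℕ} (h : j p ≠ 0) :
    i + j - Pi.single p 1 = i + (j - Pi.single p 1) := by
  rw [add_comm, lower_add h, add_comm]

variable (S)
/-- grading derivation -/
def st (p : ℕ) : Derivation K R R := Derivation.mk' (S.stL p) (leib_of (S := S) _ (by
  intro α i β j h h'
  rw [mon_mul h h', stL_mon p (h.add h'), stL_mon p h, stL_mon p h', mul_smul_comm, mul_smul_comm,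
    mon_mul h h', mon_mul h' h, Pi.add_apply, add_smul, add_comm i j, add_comm α β, add_comm]))

/-- lowering derivation -/
def dt (p : ℕ) : Derivation K R R := Derivation.mk' (S.dtL p) (leib_of (S := S) _ (by
  intro α i β j h h'
  rw [mon_mul h h', dtL_mon p (h.add h'), dtL_mon p h, dtL_mon p h', mul_smul_comm, mul_smul_comm,
    mon_mul h (h'.sub _), mon_mul h' (h.sub _), Pi.add_apply, Nat.cast_add, add_smul, add_comm]
  congr 1
  · by_cases hj : j p = 0
    · simp [hj]
    · rw [lower_add' hj]
  · by_cases hj : i p = 0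
    · simp [hj]
    · rw [lower_add hj, add_comm β α, add_comm j]))
variable {S}

theorem st_mon {α : ℕ → K} {i : ℕ → ℕ} (p : ℕ) (h : S.M α i) :
    S.st p (S.mon α i) = α p • S.mon α i := stL_mon p h

theorem dt_mon {α : ℕ → K} {i : ℕ → ℕ} (p : ℕ) (h : S.M α i) :
    S.dt p (S.mon α i) = (i p : K) • S.mon α (i - Pi.single p 1) := dtL_mon p h

variable (S)
def d (p : ℕ) : Derivation K R R := S.st p + S.dt p

open Classical in
/-- coordinate functions -/
def z (p : ℕ) : R := if S.G p then S.mon (Pi.single p 1) 0 else S.mon 0 (Pi.single p 1)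
open Classical in
def zi (p : ℕ) : R := if S.G p then S.mon (-Pi.single p 1) 0 else 1
/-- partial derivatives -/
def δ (p : ℕ) : Derivation K R R := S.zi p • S.d p
open Classical in
def E : Derivation K R R :=
  ∑ p ∈ Finset.Icc 1 (2 * S.n), if S.G p then S.st p else S.z p • S.dt p
open Classical in
def wt (α : ℕ → K) (i : ℕ → ℕ) : K :=
  ∑ p ∈ Finset.Icc 1 (2 * S.n), if S.G p then α p else (i p : K)
/-- Poisson part -/
def P (u v : R) : R := ∑ p ∈ Finset.Icc 1 S.n,
  (S.δ p u * S.δ (p + S.n) v - S.δ (p + S.n) u * S.δ p v)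
/-- contact bracket -/
def br (u v : R) : R :=
  S.P u v + (2 * u - S.E u) * S.d 0 v - S.d 0 u * (2 * v - S.E v)
variable {S}

theorem G_iff0 : ¬ S.G 0 := fun h => by have := S.G_le 0 h; omega

theorem z_G {p : ℕ} (h : S.G p) : S.z p = S.mon (Pi.single p 1) 0 := if_pos h
theorem z_nG {p : ℕ} (h : ¬ S.G p) : S.z p = S.mon 0 (Pi.single p 1) := if_neg h

theorem GT {p : ℕ} (h1 : 1 ≤ p) (h2 : p ≤ 2 * S.n) (hG : ¬ S.G p) : S.T p := by
  by_cases h : p ≤ S.n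
  · have := S.ty p h1 h; tauto
  · have := S.ty (p - S.n) (by omega) (by omega)
    rw [Nat.sub_add_cancel (by omega)] at this; tauto

theorem M_sG {p : ℕ} (h : S.G p) : S.M (Pi.single p 1) 0 := ⟨S.G_mem p h, fun _ _ => rfl⟩
theorem M_nG {p : ℕ} (h : S.G p) : S.M (-Pi.single p 1) 0 :=
  ⟨neg_mem (S.G_mem p h), fun _ _ => rfl⟩
theorem M_sT {p : ℕ} (h : S.T p) : S.M 0 (Pi.single p 1) := by simpa using M_one.addT h

theorem z_mul_G {α : ℕ → K} {i : ℕ → ℕ} {p : ℕ} (h : S.M α i) (hp : S.G p) :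
    S.z p * S.mon α i = S.mon (α + Pi.single p 1) i := by
  rw [z_G hp, mon_mul (M_sG hp) h, zero_add, add_comm]

theorem z_mul_nG {α : ℕ → K} {i : ℕ → ℕ} {p : ℕ} (h : S.M α i) (hp : ¬ S.G p) (hT : S.T p) :
    S.z p * S.mon α i = S.mon α (i + Pi.single p 1) := by
  rw [z_nG hp, mon_mul (M_sT hT) h, zero_add, add_comm]

theorem zi_mul_G {α : ℕ → K} {i : ℕ → ℕ} {p : ℕ} (h : S.M α i) (hp : S.G p) :
    S.zi p * S.mon α i = S.mon (α - Pi.single p 1) i := by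
  rw [zi, if_pos hp, mon_mul (M_nG hp) h, zero_add, sub_eq_add_neg,
    add_comm]

theorem zi_nG {p : ℕ} (hp : ¬ S.G p) : S.zi p = 1 := if_neg hp

theorem z_zi {p : ℕ} (hp : S.G p) : S.z p * S.zi p = 1 := by
  rw [mul_comm, z_G hp, zi_mul_G (M_sG hp) hp, sub_self, mon_one]

theorem d_apply (p : ℕ) (u : R) : S.d p u = S.st p u + S.dt p u := rfl
theorem δ_apply (p : ℕ) (u : R) : S.δ p u = S.zi p * S.d p u := rfl

theorem δ_mon_G {α : ℕ → K} {i : ℕ → ℕ} {p : ℕ} (h : S.M α i) (hp : S.G p) :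
    S.δ p (S.mon α i) = α p • S.mon (α - Pi.single p 1) i
      + (i p : K) • S.mon (α - Pi.single p 1) (i - Pi.single p 1) := by
  rw [δ_apply, d_apply, st_mon p h, dt_mon p h, mul_add, mul_smul_comm, mul_smul_comm,
    zi_mul_G h hp, zi_mul_G (h.sub _) hp]

theorem δ_mon_nG {α : ℕ → K} {i : ℕ → ℕ} {p : ℕ} (h : S.M α i) (hp0 : p ≠ 0) (hp : ¬ S.G p) :
    S.δ p (S.mon α i) = (i p : K) • S.mon α (i - Pi.single p 1) := by
  rw [δ_apply, d_apply, st_mon p h, dt_mon p h, zi_nG hp, h.z0 hp0 hp, one_mul, zero_smul, zero_add]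

theorem zδ_G {p : ℕ} (hp : S.G p) (u : R) : S.z p * S.δ p u = S.d p u := by
  rw [δ_apply, ← mul_assoc, z_zi hp, one_mul]

theorem δ_nG {p : ℕ} (hp0 : p ≠ 0) (hp : ¬ S.G p) (u : R) : S.δ p u = S.dt p u := by
  have : S.δ p = S.dt p := der_ext (S := S) fun α i h => by rw [δ_mon_nG h hp0 hp, dt_mon p h]
  rw [this]

/-! commutation -/

theorem st_st (p q : ℕ) (u : R) : S.st p (S.st q u) = S.st q (S.st p u) := by
  refine S.mon_ind u (fun α i h => ?_) ?_ ?_ ?_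
  · simp only [st_mon _ h, Derivation.map_smul, smul_smul, mul_comm]
  · simp
  · intro u v hu hv; simp only [map_add, hu, hv]
  · intro c u hu; simp only [Derivation.map_smul, hu]

theorem st_dt (p q : ℕ) (u : R) : S.st p (S.dt q u) = S.dt q (S.st p u) := by
  refine S.mon_ind u (fun α i h => ?_) ?_ ?_ ?_
  · simp only [st_mon _ h, dt_mon _ h, Derivation.map_smul, st_mon _ (h.sub _), smul_smul, mul_comm]
  · simp
  · intro u v hu hv; simp only [map_add, hu, hv]
  · intro c u hu; simp only [Derivation.map_smul, hu]

theorem dt_dt (p q : ℕ) (u : R) : S.dt p (S.dt q u) = S.dt q (S.dt p u) := by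
  refine S.mon_ind u (fun α i h => ?_) ?_ ?_ ?_
  · by_cases hpq : p = q
    · rw [hpq]
    · simp only [dt_mon _ h, Derivation.map_smul, dt_mon _ (h.sub _), smul_smul, Pi.sub_apply,
        Pi.single_apply, hpq, Ne.symm hpq, if_false, tsub_zero, tsub_right_comm, mul_comm]
  · simp
  · intro u v hu hv; simp only [map_add, hu, hv]
  · intro c u hu; simp only [Derivation.map_smul, hu]

theorem d_d (p q : ℕ) (u : R) : S.d p (S.d q u) = S.d q (S.d p u) := by
  simp only [d_apply, map_add, st_st p q, st_dt p q, dt_dt p q, st_dt q p]; abel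

theorem st_zi {p q : ℕ} (h : p ≠ q) : S.st p (S.zi q) = 0 := by
  unfold zi; split_ifs with hG
  · rw [st_mon _ (M_nG hG)]; simp [h]
  · simp

theorem dt_zi {p q : ℕ} : S.dt p (S.zi q) = 0 := by
  unfold zi; split_ifs with hG
  · rw [dt_mon _ (M_nG hG)]; simp
  · simp

theorem d_zi {p q : ℕ} (h : p ≠ q) : S.d p (S.zi q) = 0 := by
  rw [d_apply, st_zi h, dt_zi, add_zero]

theorem δ_δ (p q : ℕ) (u : R) : S.δ p (S.δ q u) = S.δ q (S.δ p u) := by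
  by_cases h : p = q
  · rw [h]
  · simp only [δ_apply, Derivation.leibniz, d_zi h, d_zi (Ne.symm h), d_d p q, smul_eq_mul]; ring

theorem d0_δ {p : ℕ} (hp : p ≠ 0) (u : R) : S.d 0 (S.δ p u) = S.δ p (S.d 0 u) := by
  simp only [δ_apply, Derivation.leibniz, d_zi hp.symm, d_d 0 p, smul_eq_mul]; ring

theorem st_z {p q : ℕ} (hq1 : 1 ≤ q) (hq2 : q ≤ 2 * S.n) :
    S.st p (S.z q) = 0 ∨ p = q := by
  by_cases h : p = q
  · exact Or.inr h
  left; by_cases hG : S.G q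
  · rw [z_G hG, st_mon _ (M_sG hG)]; simp [h]
  · rw [z_nG hG, st_mon _ (M_sT (GT hq1 hq2 hG))]; simp

theorem d_z {p q : ℕ} (hq1 : 1 ≤ q) (hq2 : q ≤ 2 * S.n) (h : p ≠ q) : S.d p (S.z q) = 0 := by
  by_cases hG : S.G q
  · rw [z_G hG, d_apply, st_mon _ (M_sG hG), dt_mon _ (M_sG hG)]; simp [h]
  · have := M_sT (GT hq1 hq2 hG)
    rw [z_nG hG, d_apply, st_mon _ this, dt_mon _ this]; simp [h]

theorem δ_z_ne {p q : ℕ} (hq1 : 1 ≤ q) (hq2 : q ≤ 2 * S.n) (h : p ≠ q) : S.δ p (S.z q) = 0 := by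
  rw [δ_apply, d_z hq1 hq2 h, mul_zero]

theorem δ_z_self {q : ℕ} (hq1 : 1 ≤ q) (hq2 : q ≤ 2 * S.n) : S.δ q (S.z q) = 1 := by
  by_cases hG : S.G q
  · rw [z_G hG, δ_mon_G (M_sG hG) hG]; simp [mon_one]
  · have := M_sT (GT hq1 hq2 hG)
    rw [z_nG hG, δ_mon_nG this (by omega) hG]
    simp [mon_one]

theorem E_mon {α : ℕ → K} {i : ℕ → ℕ} (h : S.M α i) :
    S.E (S.mon α i) = S.wt α i • S.mon α i := by
  classical
  rw [E, wt, Finset.sum_smul]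
  have : ∀ s : Finset ℕ, ∀ F : ℕ → Derivation K R R, ∀ u, (∑ p ∈ s, F p) u = ∑ p ∈ s, F p u := by
    intro s F u
    induction s using Finset.induction_on with
    | empty => simp
    | insert a s ha ih => simp [Finset.sum_insert ha, ih]
  rw [this]
  refine Finset.sum_congr rfl fun p hp => ?_
  rw [Finset.mem_Icc] at hp
  split_ifs with hG
  · rw [st_mon p h]
  · rw [Derivation.smul_apply, dt_mon p h, smul_eq_mul, mul_smul_comm]
    by_cases hi : i p = 0
    · simp [hi]
    rw [z_mul_nG (h.sub _) hG (GT hp.1 hp.2 hG)]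
    congr 2
    funext q
    by_cases hq : q = p
    · subst hq; simp; omega
    · simp [hq]

theorem wt_zero : S.wt 0 0 = 0 := by simp [wt]

theorem wt_add (α β : ℕ → K) (i j : ℕ → ℕ) : S.wt (α + β) (i + j) = S.wt α i + S.wt β j := by
  classical
  rw [wt, wt, wt, ← Finset.sum_add_distrib]
  refine Finset.sum_congr rfl fun p _ => ?_
  split_ifs <;> simp

theorem wt_sG {p : ℕ} (h : S.G p) : S.wt (Pi.single p 1) 0 = 1 := by
  classical
  have := S.G_le p h
  rw [wt, Finset.sum_eq_single p]
  · simp [h]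
  · intro q _ hq; simp [hq]
  · intro h'; simp at h'; omega

theorem wt_sT {p : ℕ} (h : S.G p) : S.wt 0 (Pi.single p 1) = 0 := by
  classical
  rw [wt, Finset.sum_eq_zero]
  intro q _
  split_ifs with hq
  · rfl
  · have : q ≠ p := fun e => hq (e ▸ h)
    simp [this]

theorem wt_sN {p : ℕ} (h1 : 1 ≤ p) (h2 : p ≤ 2 * S.n) (h : ¬ S.G p) :
    S.wt 0 (Pi.single p 1) = 1 := by
  classical
  rw [wt, Finset.sum_eq_single p]
  · simp [h]
  · intro q _ hq; simp [hq]
  · intro h'; simp at h'; omega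

theorem wt_s0 : S.wt (Pi.single 0 1) 0 = 0 := by
  classical
  rw [wt, Finset.sum_eq_zero]
  intro q hq
  rw [Finset.mem_Icc] at hq
  have : q ≠ 0 := by omega
  simp [this]

theorem wt_s0' : S.wt 0 (Pi.single 0 1) = 0 := by
  classical
  rw [wt, Finset.sum_eq_zero]
  intro q hq
  rw [Finset.mem_Icc] at hq
  have : q ≠ 0 := by omega
  simp [this]

theorem wt_subG {α : ℕ → K} {i : ℕ → ℕ} {p : ℕ} (h : S.G p) :
    S.wt (α - Pi.single p 1) i = S.wt α i - 1 := by
  have := S.wt_add (α - Pi.single p 1) (Pi.single p 1) i 0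
  rw [wt_sG h, sub_add_cancel, add_zero] at this
  rw [this]; ring

theorem raise_lower {i : ℕ → ℕ} {p : ℕ} (h : i p ≠ 0) :
    (i - Pi.single p 1) + Pi.single p 1 = i := by
  funext q
  by_cases hq : q = p
  · subst hq; simp; omega
  · simp [hq]

theorem wt_subT {α : ℕ → K} {i : ℕ → ℕ} {p : ℕ} (h : S.G p) (hi : i p ≠ 0) :
    S.wt α (i - Pi.single p 1) = S.wt α i := by
  have := S.wt_add α 0 (i - Pi.single p 1) (Pi.single p 1)
  rw [wt_sT h, add_zero, add_zero, raise_lower hi] at this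
  exact this.symm

theorem wt_subN {α : ℕ → K} {i : ℕ → ℕ} {p : ℕ} (h1 : 1 ≤ p) (h2 : p ≤ 2 * S.n) (h : ¬ S.G p)
    (hi : i p ≠ 0) :
    S.wt α (i - Pi.single p 1) = S.wt α i - 1 := by
  have := S.wt_add α 0 (i - Pi.single p 1) (Pi.single p 1)
  rw [wt_sN h1 h2 h, add_zero, raise_lower hi] at this
  rw [this]; ring

theorem E_z {q : ℕ} (hq1 : 1 ≤ q) (hq2 : q ≤ 2 * S.n) : S.E (S.z q) = S.z q := by
  by_cases hG : S.G q
  · rw [z_G hG, E_mon (M_sG hG), wt_sG hG, one_smul]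
  · rw [z_nG hG, E_mon (M_sT (GT hq1 hq2 hG)), wt_sN hq1 hq2 hG, one_smul]

theorem d0_z {q : ℕ} (hq1 : 1 ≤ q) (hq2 : q ≤ 2 * S.n) : S.d 0 (S.z q) = 0 :=
  d_z hq1 hq2 (by omega)

theorem E_δ {p : ℕ} (h1 : 1 ≤ p) (h2 : p ≤ 2 * S.n) (u : R) :
    S.E (S.δ p u) = S.δ p (S.E u) - S.δ p u := by
  refine S.mon_ind u (fun α i h => ?_) ?_ ?_ ?_
  · rw [E_mon h, Derivation.map_smul]
    by_cases hG : S.G p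
    · rw [δ_mon_G h hG, map_add, Derivation.map_smul, Derivation.map_smul, E_mon (h.subG hG), E_mon ((h.sub _).subG hG),
        wt_subG hG, wt_subG hG]
      by_cases hi : i p = 0
      · simp only [hi, Nat.cast_zero]; module
      · rw [wt_subT hG hi]; module
    · rw [δ_mon_nG h (by omega) hG, Derivation.map_smul, E_mon (h.sub _)]
      by_cases hi : i p = 0
      · simp [hi]
      · rw [wt_subN h1 h2 hG hi]; module
  · simp
  · intro u v hu hv; simp only [map_add, hu, hv]; abel
  · intro c u hu; simp only [Derivation.map_smul, hu, smul_sub]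

theorem E_d0 (u : R) : S.E (S.d 0 u) = S.d 0 (S.E u) := by
  refine S.mon_ind u (fun α i h => ?_) ?_ ?_ ?_
  · simp only [d_apply, E_mon h, map_add, Derivation.map_smul, st_mon _ h, dt_mon _ h, E_mon (h.sub _)]
    by_cases hi : i 0 = 0
    · simp [hi, smul_smul, mul_comm]
    · have := S.wt_add α 0 (i - Pi.single 0 1) (Pi.single 0 1)
      rw [wt_s0', add_zero, add_zero, raise_lower hi] at this
      rw [← this]; module
  · simp
  · intro u v hu hv; simp only [map_add, hu, hv]
  · intro c u hu; simp only [Derivation.map_smul, hu]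

end CSetup
end CT

set_option linter.all false
namespace CT
variable {K R : Type*} [Field K] [CommRing R] [Algebra K R]
namespace CSetup
variable {S : CSetup K R}

theorem P_skew (u v : R) : S.P u v = - S.P v u := by
  simp only [P, ← Finset.sum_neg_distrib]
  exact Finset.sum_congr rfl fun p _ => by ring

theorem P_add (u v w : R) : S.P u (v + w) = S.P u v + S.P u w := by
  simp only [P, ← Finset.sum_add_distrib]
  exact Finset.sum_congr rfl fun p _ => by simp only [map_add]; ring

theorem P_smul (c : K) (u v : R) : S.P u (c • v) = c • S.P u v := by
  simp only [P, Finset.smul_sum]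
  exact Finset.sum_congr rfl fun p _ => by
    simp only [Derivation.map_smul]; simp only [Algebra.smul_def]; ring

theorem P_mul (u v w : R) : S.P u (v * w) = S.P u v * w + v * S.P u w := by
  simp only [P, Finset.sum_mul, Finset.mul_sum, ← Finset.sum_add_distrib]
  exact Finset.sum_congr rfl fun p _ => by
    simp only [Derivation.leibniz, smul_eq_mul]; ring

theorem P_mul' (u v w : R) : S.P (v * w) u = S.P v u * w + v * S.P w u := by
  rw [P_skew, P_mul, P_skew u v, P_skew u w]; ring

theorem P_sub (u v w : R) : S.P u (v - w) = S.P u v - S.P u w := by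
  simp only [P, ← Finset.sum_sub_distrib]
  exact Finset.sum_congr rfl fun p _ => by simp only [map_sub]; ring

theorem P_add' (u v w : R) : S.P (v + w) u = S.P v u + S.P w u := by
  rw [P_skew, P_add, P_skew u v, P_skew u w]; ring
theorem P_sub' (u v w : R) : S.P (v - w) u = S.P v u - S.P w u := by
  rw [P_skew, P_sub, P_skew u v, P_skew u w]; ring

theorem P_two (u : R) : S.P u 2 = 0 := by
  have : S.P u 1 = 0 := by simp [P]
  rw [← one_add_one_eq_two, P_add, this, add_zero]
theorem P_two' (u : R) : S.P 2 u = 0 := by rw [P_skew, P_two, neg_zero]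

theorem d0_P (u v : R) : S.d 0 (S.P u v) = S.P (S.d 0 u) v + S.P u (S.d 0 v) := by
  simp only [P, map_sum, ← Finset.sum_add_distrib]
  refine Finset.sum_congr rfl fun p hp => ?_
  rw [Finset.mem_Icc] at hp
  simp only [map_sub, Derivation.leibniz, smul_eq_mul, d0_δ (show p ≠ 0 by omega),
    d0_δ (show p + S.n ≠ 0 by omega)]
  ring

theorem E_P (u v : R) : S.E (S.P u v) = S.P (S.E u) v + S.P u (S.E v) - 2 * S.P u v := by
  simp only [P, map_sum, Finset.mul_sum, ← Finset.sum_add_distrib, ← Finset.sum_sub_distrib]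
  refine Finset.sum_congr rfl fun p hp => ?_
  rw [Finset.mem_Icc] at hp
  simp only [map_sub, Derivation.leibniz, smul_eq_mul, E_δ (show 1 ≤ p by omega) (show p ≤ 2 * S.n by omega),
    E_δ (show 1 ≤ p + S.n by omega) (show p + S.n ≤ 2 * S.n by omega)]
  ring

/-- the `(p,q)` contribution to `{u,{v,w}}` -/
def PP (S : CSetup K R) (u v w : R) (p q : ℕ) : R :=
  S.δ p u * S.δ (p + S.n) (S.δ q v * S.δ (q + S.n) w - S.δ (q + S.n) v * S.δ q w)
  - S.δ (p + S.n) u * S.δ p (S.δ q v * S.δ (q + S.n) w - S.δ (q + S.n) v * S.δ q w)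

theorem P_P (u v w : R) : S.P u (S.P v w) =
    ∑ p ∈ Finset.Icc 1 S.n, ∑ q ∈ Finset.Icc 1 S.n, S.PP u v w p q := by
  rw [P]
  refine Finset.sum_congr rfl fun p hp => ?_
  simp only [PP, P, map_sum, Finset.mul_sum, ← Finset.sum_sub_distrib]

theorem P_jac [CharZero K] (u v w : R) :
    S.P u (S.P v w) + S.P v (S.P w u) + S.P w (S.P u v) = 0 := by
  have h2 : ∀ x : R, x + x = 0 → x = 0 := fun x hx => by
    have : (2 : K) • x = 0 := by rw [two_smul]; exact hx
    exact (smul_eq_zero_iff_right two_ne_zero).1 this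
  apply h2
  simp only [P_P, ← Finset.sum_add_distrib]
  have hc : ∀ f : ℕ → ℕ → R, (∑ p ∈ Finset.Icc 1 S.n, ∑ q ∈ Finset.Icc 1 S.n, (f p q + f p q)) =
      ∑ p ∈ Finset.Icc 1 S.n, ∑ q ∈ Finset.Icc 1 S.n, (f p q + f q p) := by
    intro f
    simp only [Finset.sum_add_distrib]
    congr 1
    exact Finset.sum_comm
  rw [hc fun p q => S.PP u v w p q + S.PP v w u p q + S.PP w u v p q]
  refine Finset.sum_eq_zero fun p _ => Finset.sum_eq_zero fun q _ => ?_
  simp only [PP, map_sub, Derivation.leibniz, smul_eq_mul, δ_δ q p, δ_δ (q + S.n) p,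
    δ_δ q (p + S.n), δ_δ (q + S.n) (p + S.n)]
  ring

theorem br_skew (u v : R) : S.br u v = - S.br v u := by
  rw [br, br, P_skew]; ring

theorem br_add (u v w : R) : S.br u (v + w) = S.br u v + S.br u w := by
  simp only [br, P_add, map_add]; ring
theorem br_smul (c : K) (u v : R) : S.br u (c • v) = c • S.br u v := by
  simp only [br, P_smul, Derivation.map_smul]; simp only [Algebra.smul_def]; ring

theorem br_jac [CharZero K] (u v w : R) :
    S.br (S.br u v) w + S.br (S.br v w) u + S.br (S.br w u) v = 0 := by
  have key : S.br u (S.br v w) + S.br v (S.br w u) + S.br w (S.br u v) = 0 := by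
    have h2 : S.d 0 (2 : R) = 0 := by
      have := (S.d 0).map_natCast 2
      simpa using this
    have h3 : S.E (2 : R) = 0 := by
      have := (S.E).map_natCast 2
      simpa using this
    simp only [br, P_add, P_sub, P_mul, map_add, map_sub, Derivation.leibniz, smul_eq_mul, d0_P, E_P,
      E_d0, h2, h3, P_two]
    rw [P_skew (S.d 0 v) w, P_skew (S.d 0 u) v, P_skew (S.d 0 w) u,
      P_skew (S.E v) w, P_skew (S.E u) v, P_skew (S.E w) u, P_skew v u, P_skew w v, P_skew w u]
    have := S.P_jac u v w
    rw [P_skew w u, ← sub_eq_zero] at this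
    have h : ∀ x y, S.P x (-y) = - S.P x y := fun x y => by
      have := S.P_smul (-1) x y; simpa using this
    rw [h] at this
    linear_combination this + h v (S.P u w)
  rw [br_skew (S.br u v), br_skew (S.br v w), br_skew (S.br w u)]
  linear_combination -key

variable (S) in
def brL : R →ₗ[K] R →ₗ[K] R := LinearMap.mk₂ K S.br
  (fun u v w => by rw [br_skew, br_add, br_skew u, br_skew v]; ring)
  (fun c u v => by rw [br_skew, br_smul, br_skew u, smul_neg])
  br_add (fun c u v => br_smul c u v)

@[simp] theorem brL_apply (u v : R) : S.brL u v = S.br u v := rfl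

theorem br_sub (u v w : R) : S.br u (v - w) = S.br u v - S.br u w := (S.brL u).map_sub v w
theorem br_zero (u : R) : S.br u 0 = 0 := (S.brL u).map_zero
theorem br_neg (u v : R) : S.br u (-v) = - S.br u v := (S.brL u).map_neg v
theorem br_smul' (c : K) (u v : R) : S.br (c • u) v = c • S.br u v := by
  rw [br_skew, br_smul, br_skew u, smul_neg]

theorem P_loc {p : ℕ} (h1 : 1 ≤ p) (h2 : p ≤ S.n) {a : R}
    (h : ∀ q, 1 ≤ q → q ≤ 2 * S.n → q ≠ p → q ≠ p + S.n → S.δ q a = 0) (u : R) :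
    S.P a u = S.δ p a * S.δ (p + S.n) u - S.δ (p + S.n) a * S.δ p u := by
  rw [P, Finset.sum_eq_single p]
  · intro q hq hqp
    rw [Finset.mem_Icc] at hq
    rw [h q (by omega) (by omega) hqp (by omega),
      h (q + S.n) (by omega) (by omega) (by omega) (by omega)]; ring
  · intro h'; simp at h'; omega

theorem br_loc {p : ℕ} (h1 : 1 ≤ p) (h2 : p ≤ S.n) {a : R} (h0 : S.d 0 a = 0)
    (h : ∀ q, 1 ≤ q → q ≤ 2 * S.n → q ≠ p → q ≠ p + S.n → S.δ q a = 0) (u : R) :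
    S.br a u = S.δ p a * S.δ (p + S.n) u - S.δ (p + S.n) a * S.δ p u
      + (2 * a - S.E a) * S.d 0 u := by
  rw [br, P_loc h1 h2 h, h0]; ring

theorem br_cst {a : R} (h : ∀ q, 1 ≤ q → q ≤ 2 * S.n → S.δ q a = 0) (hE : S.E a = 0) (u : R) :
    S.br a u = 2 * a * S.d 0 u - S.d 0 a * (2 * u - S.E u) := by
  rw [br, P_loc le_rfl S.hn (fun q h1 h2 _ _ => h q h1 h2),
    h _ le_rfl (by have := S.hn; omega), h (1 + S.n) (by omega) (by have := S.hn; omega), hE]; ring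

theorem br_one (u : R) : S.br 1 u = 2 * S.d 0 u := by
  rw [br_cst] <;> simp

section
variable {p : ℕ}

theorem br_z_lo (h1 : 1 ≤ p) (h2 : p ≤ S.n) (u : R) :
    S.br (S.z p) u = S.δ (p + S.n) u + S.z p * S.d 0 u := by
  rw [br_loc h1 h2 (d0_z h1 (by omega)) (fun q _ _ hq _ => δ_z_ne h1 (by omega) hq),
    δ_z_self h1 (by omega), δ_z_ne h1 (by omega) (by omega), E_z h1 (by omega)]; ring

theorem br_z_hi (h1 : 1 ≤ p) (h2 : p ≤ S.n) (u : R) :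
    S.br (S.z (p + S.n)) u = - S.δ p u + S.z (p + S.n) * S.d 0 u := by
  rw [br_loc h1 h2 (d0_z (by omega) (by omega))
    (fun q _ _ _ hq => δ_z_ne (by omega) (by omega) hq),
    δ_z_self (by omega) (by omega), δ_z_ne (by omega) (by omega) (by omega), E_z (by omega) (by omega)]
  ring

theorem br_zz (h1 : 1 ≤ p) (h2 : p ≤ S.n) (u : R) :
    S.br (S.z p * S.z p) u = 2 * (S.z p * S.δ (p + S.n) u) := by
  rw [br_loc h1 h2]
  · simp only [Derivation.leibniz, smul_eq_mul, δ_z_self h1 (show p ≤ 2 * S.n by omega),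
      δ_z_ne h1 (show p ≤ 2 * S.n by omega) (show p + S.n ≠ p by omega),
      E_z h1 (show p ≤ 2 * S.n by omega)]
    ring
  · simp [d0_z h1 (show p ≤ 2 * S.n by omega)]
  · intro q _ _ hq _; simp [δ_z_ne h1 (show p ≤ 2 * S.n by omega) hq]

theorem br_zz_hi (h1 : 1 ≤ p) (h2 : p ≤ S.n) (u : R) :
    S.br (S.z (p + S.n) * S.z (p + S.n)) u = - 2 * (S.z (p + S.n) * S.δ p u) := by
  rw [br_loc h1 h2]
  · simp only [Derivation.leibniz, smul_eq_mul,
      δ_z_self (show 1 ≤ p + S.n by omega) (show p + S.n ≤ 2 * S.n by omega),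
      δ_z_ne (show 1 ≤ p + S.n by omega) (show p + S.n ≤ 2 * S.n by omega) (show p ≠ p + S.n by omega),
      E_z (show 1 ≤ p + S.n by omega) (show p + S.n ≤ 2 * S.n by omega)]
    ring
  · simp [d0_z (show 1 ≤ p + S.n by omega) (show p + S.n ≤ 2 * S.n by omega)]
  · intro q _ _ _ hq
    simp [δ_z_ne (show 1 ≤ p + S.n by omega) (show p + S.n ≤ 2 * S.n by omega) hq]

theorem br_zzb (h1 : 1 ≤ p) (h2 : p ≤ S.n) (u : R) :
    S.br (S.z p * S.z (p + S.n)) u = S.z (p + S.n) * S.δ (p + S.n) u - S.z p * S.δ p u := by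
  have e1 := δ_z_self (S := S) (show 1 ≤ p + S.n by omega) (show p + S.n ≤ 2 * S.n by omega)
  have e2 := E_z (S := S) (show 1 ≤ p + S.n by omega) (show p + S.n ≤ 2 * S.n by omega)
  have e3 := E_z (S := S) h1 (show p ≤ 2 * S.n by omega)
  have e4 := δ_z_self (S := S) h1 (show p ≤ 2 * S.n by omega)
  have e5 := fun q => δ_z_ne (S := S) (p := q) h1 (show p ≤ 2 * S.n by omega)
  have e6 := fun q => δ_z_ne (S := S) (p := q) (show 1 ≤ p + S.n by omega) (show p + S.n ≤ 2 * S.n by omega)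
  rw [br_loc h1 h2]
  · simp only [Derivation.leibniz, smul_eq_mul, e1, e2, e3, e4, e5 (p + S.n) (by omega),
      e6 p (by omega)]
    ring
  · simp [d0_z h1 (show p ≤ 2 * S.n by omega),
      d0_z (S := S) (show 1 ≤ p + S.n by omega) (show p + S.n ≤ 2 * S.n by omega)]
  · intro q _ _ hq hq'
    simp [e5 q hq, e6 q hq']
end

/-- cocycles -/
structure Coc (S : CSetup K R) (ψ : R →ₗ[K] R →ₗ[K] K) : Prop where
  skew : ∀ u v, ψ u v = - ψ v u
  jac : ∀ u v w, ψ (S.br u v) w + ψ (S.br v w) u + ψ (S.br w u) v = 0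

variable {ψ : R →ₗ[K] R →ₗ[K] K}
theorem Coc.inv (h : Coc S ψ) (a u v : R) :
    ψ a (S.br u v) = ψ (S.br a u) v + ψ u (S.br a v) := by
  have := h.jac a u v
  rw [h.skew (S.br u v) a, br_skew v a, map_neg, LinearMap.neg_apply, h.skew (S.br a v) u] at this
  linear_combination -this

theorem Coc.self [CharZero K] (h : Coc S ψ) (u : R) : ψ u u = 0 := by
  have := h.skew u u
  have h2 : (2 : K) * ψ u u = 0 := by linear_combination this
  simpa using h2

theorem Coc.sub [CharZero K] (h : Coc S ψ) (f : R →ₗ[K] K) : Coc S (ψ - S.brL.compr₂ f) where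
  skew u v := by
    simp only [LinearMap.sub_apply, LinearMap.compr₂_apply, brL_apply]
    rw [h.skew, br_skew u v, map_neg]; ring
  jac u v w := by
    simp only [LinearMap.sub_apply, LinearMap.compr₂_apply, brL_apply]
    have := S.br_jac u v w
    have h3 := congrArg f this
    simp only [map_add, map_zero] at h3
    linear_combination h.jac u v w - h3

/-- coboundaries -/
def IsCob (S : CSetup K R) (ψ : R →ₗ[K] R →ₗ[K] K) : Prop := ∃ f : R →ₗ[K] K, ∀ u v, ψ u v = f (S.br u v)

end CSetup
end CT

set_option linter.all false
namespace CT
section lin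
variable {K V : Type*} [Field K] [AddCommGroup V] [Module K V]

/-- shifted operator -/
def sh (D : V →ₗ[K] V) (l : K) : V →ₗ[K] V := D - l • LinearMap.id
theorem sh_apply (D : V →ₗ[K] V) (l : K) (u : V) : sh D l u = D u - l • u := rfl

theorem comm_pow (N E : V →ₗ[K] V) (hc : ∀ u, N (E u) - E (N u) = u) (k : ℕ) (u : V) :
    N ((E ^ (k + 1)) u) = (E ^ (k + 1)) (N u) + ((k : K) + 1) • (E ^ k) u := by
  induction k generalizing u with
  | zero => simpa using (sub_eq_iff_eq_add'.1 (hc u))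
  | succ k ih =>
    have e : ∀ m u, (E ^ (m + 1)) u = (E ^ m) (E u) := fun m u => by
      rw [pow_succ, Module.End.mul_apply]
    rw [e (k + 1) u, ih, sub_eq_iff_eq_add'.1 (hc u), map_add, e (k + 1) (N u), ← e k u]
    push_cast
    module

theorem surj_zero [CharZero K] (N E : V →ₗ[K] V) (W : Submodule K V) (hN : ∀ u ∈ W, N u ∈ W)
    (hE : ∀ u ∈ W, E u ∈ W) (hc : ∀ u, N (E u) - E (N u) = u) (n : ℕ) :
    ∀ z ∈ W, (N ^ n) z = 0 → ∀ j, ∃ w ∈ W, N w = (E ^ j) z := by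
  have hEp : ∀ j, ∀ u ∈ W, (E ^ j) u ∈ W := by
    intro j; induction j with
    | zero => intro u hu; simpa using hu
    | succ j ih => intro u hu; rw [pow_succ, Module.End.mul_apply]; exact ih _ (hE u hu)
  induction n with
  | zero => intro z _ h j; exact ⟨0, W.zero_mem, by simp at h; simp [h]⟩
  | succ n ih =>
    intro z hz h j
    rw [pow_succ, Module.End.mul_apply] at h
    obtain ⟨w, hw, hw'⟩ := ih (N z) (hN z hz) h (j + 1)
    refine ⟨((j : K) + 1)⁻¹ • ((E ^ (j + 1)) z - w),
      W.smul_mem _ (W.sub_mem (hEp _ _ hz) hw), ?_⟩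
    rw [map_smul, map_sub, comm_pow N E hc, hw', add_sub_cancel_left, smul_smul,
      inv_mul_cancel₀ (Nat.cast_add_one_ne_zero j), one_smul]

theorem surj_lam (N : V →ₗ[K] V) (W : Submodule K V) (hN : ∀ u ∈ W, N u ∈ W)
    {l : K} (hl : l ≠ 0) (n : ℕ) : ∀ z ∈ W, (N ^ n) z = 0 → ∃ w ∈ W, l • w + N w = z := by
  induction n with
  | zero => intro z _ h; exact ⟨0, W.zero_mem, by simp at h; simp [h]⟩
  | succ n ih =>
    intro z hz h
    rw [pow_succ, Module.End.mul_apply] at h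
    obtain ⟨w, hw, hw'⟩ := ih (N z) (hN z hz) h
    refine ⟨l⁻¹ • (z - w), W.smul_mem _ (W.sub_mem hz hw), ?_⟩
    rw [smul_smul, mul_inv_cancel₀ hl, one_smul, map_smul, map_sub, ← hw', add_sub_cancel_right,
      smul_smul, inv_mul_cancel₀ hl, one_smul]; abel

/-- `λ + N` is surjective for locally nilpotent `N` in a Heisenberg pair. -/
theorem surj_any [CharZero K] (N E : V →ₗ[K] V) (W : Submodule K V) (hN : ∀ u ∈ W, N u ∈ W)
    (hE : ∀ u ∈ W, E u ∈ W) (hc : ∀ u, N (E u) - E (N u) = u) (hn : ∀ u ∈ W, ∃ n, (N ^ n) u = 0)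
    (l : K) (z : V) (hz : z ∈ W) : ∃ w ∈ W, l • w + N w = z := by
  obtain ⟨n, hn⟩ := hn z hz
  by_cases hl : l = 0
  · obtain ⟨w, hw, h⟩ := surj_zero N E W hN hE hc n z hz hn 0
    exact ⟨w, hw, by simpa [hl] using h⟩
  · exact surj_lam N W hN hl n z hz hn

theorem inj_lam (N : V →ₗ[K] V) {l : K} (hl : l ≠ 0) (n : ℕ) : ∀ z, (N ^ n) z = 0 →
    l • z + N z = 0 → z = 0 := by
  induction n with
  | zero => intro z h _; simpa using h
  | succ n ih =>
    intro z h h'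
    rw [pow_succ, Module.End.mul_apply] at h
    have : N z = 0 := ih _ h (by rw [← map_smul, ← map_add, h', map_zero])
    rw [this, add_zero] at h'
    exact (smul_eq_zero_iff_right hl).1 h'

theorem ln_submodule (N : V →ₗ[K] V) : ∃ W : Submodule K V, ∀ u, u ∈ W ↔ ∃ n, (N ^ n) u = 0 := by
  refine ⟨Submodule.mk (AddSubmonoid.mk (AddSubsemigroup.mk {u | ∃ n, (N ^ n) u = 0} ?_) ⟨0, by simp⟩) ?_,
    fun u => Iff.rfl⟩
  · rintro a b ⟨m, hm⟩ ⟨n, hn⟩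
    refine ⟨m + n, ?_⟩
    rw [map_add, pow_add, Module.End.mul_apply, Module.End.mul_apply, hn, map_zero, add_zero]
    rw [← Module.End.mul_apply, ← pow_add, add_comm, pow_add, Module.End.mul_apply, hm, map_zero]
  · rintro c a ⟨m, hm⟩
    exact ⟨m, by rw [map_smul, hm, smul_zero]⟩

variable {ι C : Type*} (b : Module.Basis ι K V) (κ : ι → C)

/-- class subspaces -/
def Wsp (k : C) : Submodule K V := Submodule.span K (b '' {x | κ x = k})

theorem b_mem_W (x : ι) : b x ∈ Wsp b κ (κ x) := Submodule.subset_span ⟨x, rfl, rfl⟩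

theorem W_ind {U : Submodule K V} {k : C} (h : ∀ x, κ x = k → b x ∈ U) : ∀ u ∈ Wsp b κ k, u ∈ U := by
  have : Wsp b κ k ≤ U := by
    rw [Wsp, Submodule.span_le]; rintro _ ⟨x, hx, rfl⟩; exact h x hx
  exact this

theorem W_stab {D : V →ₗ[K] V} (hD : ∀ x, D (b x) ∈ Wsp b κ (κ x)) {k : C} :
    ∀ u ∈ Wsp b κ k, D u ∈ Wsp b κ k :=
  W_ind b κ (U := (Wsp b κ k).comap D) fun x hx => by
    subst hx; exact hD x

theorem abs_ln {D : V →ₗ[K] V} {k : C} (hln : ∀ x, κ x = k → ∃ n, (D ^ n) (b x) = 0) :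
    ∀ u ∈ Wsp b κ k, ∃ n, (D ^ n) u = 0 := by
  obtain ⟨U, hU⟩ := ln_submodule D
  intro u hu
  exact (hU u).1 (W_ind b κ (fun x hx => (hU _).2 (hln x hx)) u hu)

variable [CharZero K] {D E : V →ₗ[K] V} {lam : C → K}

theorem abs_surjN (hD : ∀ x, D (b x) ∈ Wsp b κ (κ x)) (hE : ∀ x, E (b x) ∈ Wsp b κ (κ x))
    (hc : ∀ u, D (E u) - E (D u) = u)
    (hln : ∀ x, ∃ n, ((sh D (lam (κ x))) ^ n) (b x) = 0) (k : C) (l : K) (z : V)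
    (hz : z ∈ Wsp b κ k) : ∃ w ∈ Wsp b κ k, l • w + (sh D (lam k)) w = z := by
  refine surj_any (sh D (lam k)) E (Wsp b κ k) ?_ (W_stab b κ hE) ?_ ?_ l z hz
  · intro u hu
    simp only [sh_apply]
    exact Submodule.sub_mem _ (W_stab b κ hD u hu) (Submodule.smul_mem _ _ hu)
  · intro u
    simp only [sh_apply, map_sub, map_smul]
    rw [sub_sub_sub_cancel_right, hc]
  · exact abs_ln b κ fun x hx => by subst hx; exact hln x

theorem abs_f (hD : ∀ x, D (b x) ∈ Wsp b κ (κ x)) (hE : ∀ x, E (b x) ∈ Wsp b κ (κ x))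
    (hc : ∀ u, D (E u) - E (D u) = u)
    (hln : ∀ x, ∃ n, ((sh D (lam (κ x))) ^ n) (b x) = 0) (φ : V →ₗ[K] K)
    (hφ : ∀ k, ∀ c ∈ Wsp b κ k, D c = 0 → φ c = 0) : ∃ f : V →ₗ[K] K, ∀ u, f (D u) = φ u := by
  have hs : ∀ x, ∃ w ∈ Wsp b κ (κ x), D w = b x := fun x => by
    obtain ⟨w, hw, h⟩ := abs_surjN b κ hD hE hc hln (κ x) (lam (κ x)) (b x) (b_mem_W b κ x)
    refine ⟨w, hw, ?_⟩
    rw [← h, sh_apply]; abel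
  choose s hsW hsD using hs
  let s' : V →ₗ[K] V := b.constr K s
  have hs' : ∀ x, s' (b x) = s x := fun x => b.constr_basis K s x
  have hDs : ∀ u, D (s' u) = u := by
    have : D ∘ₗ s' = LinearMap.id := b.ext fun x => by simp [hs', hsD]
    exact fun u => LinearMap.congr_fun this u
  refine ⟨φ ∘ₗ s', ?_⟩
  have : (φ ∘ₗ s') ∘ₗ D = φ := by
    refine b.ext fun x => ?_
    have h1 : s' (D (b x)) - b x ∈ Wsp b κ (κ x) :=
      Submodule.sub_mem _ (W_stab b κ (D := s') (fun y => by rw [hs']; exact hsW y) _ (hD x))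
        (b_mem_W b κ x)
    have := hφ _ _ h1 (by rw [map_sub, hDs, sub_self])
    rw [map_sub, sub_eq_zero] at this
    exact this
  exact fun u => LinearMap.congr_fun this u

theorem abs_zero (hD : ∀ x, D (b x) ∈ Wsp b κ (κ x)) (hE : ∀ x, E (b x) ∈ Wsp b κ (κ x))
    (hc : ∀ u, D (E u) - E (D u) = u)
    (hln : ∀ x, ∃ n, ((sh D (lam (κ x))) ^ n) (b x) = 0) (ψ : V →ₗ[K] V →ₗ[K] K)
    (hψ : ∀ u v, ψ (D u) v + ψ u (D v) = 0) : ψ = 0 := by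
  have hsurj : ∀ k, ∀ u ∈ Wsp b κ k, ∃ w ∈ Wsp b κ k, (sh D (lam k)) w = u := fun k u hu => by
    obtain ⟨w, hw, h⟩ := abs_surjN b κ hD hE hc hln k 0 u hu
    exact ⟨w, hw, by simpa using h⟩
  have h1 : ∀ l m : K, l + m ≠ 0 → ∀ s i j u v, i + j ≤ s → ((sh D l) ^ i) u = 0 →
      ((sh D m) ^ j) v = 0 → ψ u v = 0 := by
    intro l m hlm s
    induction s with
    | zero =>
      intro i j u v hs hu hv
      obtain rfl : i = 0 := by omega
      simp at hu; simp [hu]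
    | succ s ih =>
      intro i j u v hs hu hv
      match i, j with
      | 0, _ => simp at hu; simp [hu]
      | _, 0 => simp at hv; simp [hv]
      | i + 1, j + 1 =>
        have e1 := ih i (j + 1) ((sh D l) u) v (by omega)
          (by rwa [pow_succ, Module.End.mul_apply] at hu) hv
        have e2 := ih (i + 1) j u ((sh D m) v) (by omega) hu
          (by rwa [pow_succ, Module.End.mul_apply] at hv)
        have e3 := hψ u v
        simp only [sh_apply, map_sub, map_smul,
          LinearMap.sub_apply, LinearMap.smul_apply, smul_eq_mul] at e1 e2
        have : (l + m) * ψ u v = 0 := by linear_combination e3 - e1 - e2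
        exact (mul_eq_zero.1 this).resolve_left hlm
  have h2 : ∀ k m, lam k + m = 0 → ∀ j, ∀ u ∈ Wsp b κ k, ∀ v, ((sh D m) ^ j) v = 0 →
      ψ u v = 0 := by
    intro k m hkm j
    induction j with
    | zero => intro u _ v hv; simp at hv; simp [hv]
    | succ j ih =>
      intro u hu v hv
      obtain ⟨w, hw, rfl⟩ := hsurj k u hu
      have e2 := ih w hw ((sh D m) v) (by rwa [pow_succ, Module.End.mul_apply] at hv)
      have e3 := hψ w v
      simp only [sh_apply, map_sub, map_smul,
        LinearMap.sub_apply, LinearMap.smul_apply, smul_eq_mul] at e2 ⊢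
      linear_combination e3 - e2 - (ψ w v) * hkm
  refine b.ext fun x => b.ext fun y => ?_
  obtain ⟨i, hi⟩ := hln x
  obtain ⟨j, hj⟩ := hln y
  by_cases h : lam (κ x) + lam (κ y) = 0
  · exact h2 _ _ h j _ (b_mem_W b κ x) _ hj
  · exact h1 _ _ h _ i j _ _ le_rfl hi hj

end lin

namespace CSetup
variable {K R : Type*} [Field K] [CommRing R] [Algebra K R] [CharZero K]
variable {S : CSetup K R} {ψ : R →ₗ[K] R →ₗ[K] K}

/-- Main reduction: a good element `h` trivialises the cocycle. -/
theorem cob_of {C : Type*} (hψ : Coc S ψ)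
    (κ : (S.Gm × {i : ℕ → ℕ // ∀ p, ¬ S.T p → i p = 0}) → C) (h : R) (E : R →ₗ[K] R) (lam : C → K)
    (hD : ∀ x, S.br h (S.b x) ∈ Wsp S.b κ (κ x)) (hE : ∀ x, E (S.b x) ∈ Wsp S.b κ (κ x))
    (hc : ∀ u, S.br h (E u) - E (S.br h u) = u)
    (hln : ∀ x, ∃ n, ((sh (S.brL h) (lam (κ x))) ^ n) (S.b x) = 0)
    (hker : ∀ k, ∀ c ∈ Wsp S.b κ k, S.br h c = 0 → ψ h c = 0) : IsCob S ψ := by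
  obtain ⟨f, hf⟩ := abs_f (D := S.brL h) S.b κ hD hE hc hln (ψ h) hker
  refine ⟨f, ?_⟩
  have h' := hψ.sub f
  have h0 : ∀ u, (ψ - S.brL.compr₂ f) h u = 0 := fun u => by
    simp only [LinearMap.sub_apply, LinearMap.compr₂_apply]
    rw [hf, sub_self]
  have := abs_zero (D := S.brL h) S.b κ hD hE hc hln _ (fun u v => by
    rw [brL_apply, brL_apply, ← h'.inv, h0])
  intro u v
  have := congrArg (fun g => g u v) this
  simp only [LinearMap.sub_apply, LinearMap.compr₂_apply, brL_apply, LinearMap.zero_apply] at this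
  exact sub_eq_zero.1 this

/-- kernel of `dt q` -/
theorem repr_dt (q : ℕ) (u : R) (x) (hx : x.2.1 q ≠ 0) (hu : S.dt q u = 0) : S.b.repr u x = 0 := by
  classical
  have key : ∀ u : R, S.b.repr (S.dt q u) (x.1, ⟨x.2.1 - Pi.single q 1, fun p hp => by
      simp [x.2.2 p hp]⟩) = (x.2.1 q : K) * S.b.repr u x := by
    intro u
    let y : S.Gm × {i : ℕ → ℕ // ∀ p, ¬ S.T p → i p = 0} := (x.1, ⟨x.2.1 - Pi.single q 1, fun p hp => by
      simp [x.2.2 p hp]⟩)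
    have : (Finsupp.lapply y ∘ₗ S.b.repr.toLinearMap) ∘ₗ (S.dt q).toLinearMap =
        (x.2.1 q : K) • (Finsupp.lapply x ∘ₗ S.b.repr.toLinearMap) := by
      refine S.b.ext fun w => ?_
      simp only [LinearMap.comp_apply, LinearMap.smul_apply, LinearEquiv.coe_coe, Finsupp.lapply_apply,
        Module.Basis.repr_self]
      change S.b.repr (S.dt q (S.b w)) y = _
      rw [b_eq, dt_mon q (M_x w), mon_eq ((M_x w).sub _), map_smul, Module.Basis.repr_self]
      simp only [Finsupp.smul_apply, smul_eq_mul, Finsupp.single_apply]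
      by_cases hw : w = x
      · subst hw; simp [y]
      · rw [if_neg hw]
        by_cases hw0 : w.2.1 q = 0
        · simp [hw0]
        · rw [if_neg]
          · simp
          · intro e
            apply hw
            simp only [y, Prod.mk.injEq, Subtype.mk.injEq, Subtype.ext_iff] at e
            refine Prod.ext (Subtype.ext e.1) (Subtype.ext ?_)
            rw [← raise_lower hw0, ← raise_lower hx, e.2]
    exact LinearMap.congr_fun this u
  have h := key u
  rw [hu, map_zero] at h
  have h' := h.symm
  simp only [Finsupp.coe_zero, Pi.zero_apply, mul_eq_zero, Nat.cast_eq_zero] at h'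
  exact h'.resolve_left hx

/-- A functional vanishing on suitable monomials vanishes on the kernel of `dt q`. -/
theorem ker_dt {C : Type*} (κ : (S.Gm × {i : ℕ → ℕ // ∀ p, ¬ S.T p → i p = 0}) → C) (q : ℕ)
    (φ : R →ₗ[K] K) {k : C} {u : R} (hk : u ∈ Wsp S.b κ k) (hu : S.dt q u = 0)
    (h : ∀ x, κ x = k → x.2.1 q = 0 → φ (S.b x) = 0) : φ u = 0 := by
  rw [← S.b.linearCombination_repr u, Finsupp.linearCombination_apply, Finsupp.sum, map_sum]
  refine Finset.sum_eq_zero fun x hx => ?_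
  rw [map_smul]
  have h1 : κ x = k := by
    have := S.b.mem_span_image.1 hk
    exact this hx
  by_cases h2 : x.2.1 q = 0
  · rw [h x h1 h2, smul_zero]
  · rw [repr_dt q u x h2 hu, zero_smul]

end CSetup
end CT

set_option linter.all false
namespace CT
namespace CSetup
variable {K R : Type*} [Field K] [CommRing R] [Algebra K R]
variable {S : CSetup K R} {ψ : R →ₗ[K] R →ₗ[K] K}

theorem wt_addG {α : ℕ → K} {i : ℕ → ℕ} {p : ℕ} (h : S.G p) :
    S.wt (α + Pi.single p 1) i = S.wt α i + 1 := by
  have := S.wt_add α (Pi.single p 1) i 0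
  rwa [wt_sG h, add_zero] at this

theorem wt_addT {α : ℕ → K} {i : ℕ → ℕ} {p : ℕ} (h : S.G p) :
    S.wt α (i + Pi.single p 1) = S.wt α i := by
  have := S.wt_add α 0 i (Pi.single p 1)
  rwa [wt_sT h, add_zero, add_zero] at this

theorem wt_addN {α : ℕ → K} {i : ℕ → ℕ} {p : ℕ} (h1 : 1 ≤ p) (h2 : p ≤ 2 * S.n) (h : ¬ S.G p) :
    S.wt α (i + Pi.single p 1) = S.wt α i + 1 := by
  have := S.wt_add α 0 i (Pi.single p 1)
  rwa [wt_sN h1 h2 h, add_zero] at this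

theorem zδ_mon_nG {α : ℕ → K} {i : ℕ → ℕ} {p : ℕ} (h1 : 1 ≤ p) (h2 : p ≤ 2 * S.n)
    (h : S.M α i) (hp : ¬ S.G p) :
    S.z p * S.δ p (S.mon α i) = (i p : K) • S.mon α i := by
  rw [δ_mon_nG h (by omega) hp, mul_smul_comm]
  by_cases hi : i p = 0
  · simp [hi]
  · rw [z_mul_nG (h.sub _) hp (GT h1 h2 hp), raise_lower hi]

theorem zδ_mon_G {α : ℕ → K} {i : ℕ → ℕ} {p : ℕ} (h : S.M α i) (hp : S.G p) :
    S.z p * S.δ p (S.mon α i) = α p • S.mon α i + (i p : K) • S.mon α (i - Pi.single p 1) := by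
  rw [zδ_G hp, d_apply, st_mon p h, dt_mon p h]

/-- exceptional monomials -/
def Exc (S : CSetup K R) (q : ℕ) (α : ℕ → K) (i : ℕ → ℕ) : Prop :=
  (S.G q ∧ S.G (q + S.n) ∧ ¬ S.T q ∧ ¬ S.T (q + S.n) ∧ α q = -1 ∧ α (q + S.n) = -1) ∨
  (¬ S.G q ∧ ¬ S.G (q + S.n) ∧ i q = 0 ∧ i (q + S.n) = 0)

variable [CharZero K]

theorem KL {q : ℕ} (h1 : 1 ≤ q) (h2 : q ≤ S.n) (h3 : ¬ (S.G q ∧ S.T q ∧ S.G (q + S.n)))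
    (φ : R →ₗ[K] K) (P : (ℕ → K) → (ℕ → ℕ) → Prop)
    (stab : ∀ α i β j, S.M α i → P α i → S.M β j →
      (∀ r, r ≠ q → r ≠ q + S.n → β r = α r ∧ j r = i r) → S.wt β j = S.wt α i → P β j)
    (ha : ∀ α i, S.M α i → P α i → φ (S.br (S.z q * S.z q) (S.mon α i)) = 0)
    (hb : ∀ α i, S.M α i → P α i → φ (S.br (S.z q * S.z (q + S.n)) (S.mon α i)) = 0)
    (α : ℕ → K) (i : ℕ → ℕ) (hM : S.M α i) (hP : P α i) (hx : ¬ Exc S q α i) :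
    φ (S.mon α i) = 0 := by
  have ha' : ∀ α i, S.M α i → P α i → φ (S.z q * S.δ (q + S.n) (S.mon α i)) = 0 := by
    intro α i h h'
    have := ha α i h h'
    rw [br_zz h1 h2, ← smul_eq_mul, ← Nat.cast_two (R := R), Nat.cast_smul_eq_nsmul, map_nsmul] at this
    simpa using this
  have hb' : ∀ α i, S.M α i → P α i →
      φ (S.z (q + S.n) * S.δ (q + S.n) (S.mon α i)) = φ (S.z q * S.δ q (S.mon α i)) := by
    intro α i h h'
    have := hb α i h h'
    rwa [br_zzb h1 h2, map_sub, sub_eq_zero] at this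
  have hne : q + S.n ≠ q := by have := S.hn; omega
  rcases S.ty q h1 h2 with ⟨g, gb, t, tb⟩ | ⟨g, gb, t, tb⟩ | ⟨g, gb, t, tb⟩ | ⟨g, gb, tb⟩ | ⟨g, gb, t, tb⟩
  · -- type 1
    have e1 := hb' α i hM hP
    rw [zδ_mon_G hM g, zδ_mon_G hM gb, hM.2 _ t, hM.2 _ tb] at e1
    simp only [Nat.cast_zero, zero_smul, add_zero, map_smul, smul_eq_mul] at e1
    have hM' := (hM.subG g).addG gb
    have e2 := ha' _ _ hM' (stab α i _ _ hM hP hM' (fun r hr hr' => by simp [hr, hr'])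
      (by rw [wt_addG gb, wt_subG g]; ring))
    rw [δ_mon_G hM' gb, hM.2 _ tb, add_sub_cancel_right] at e2
    simp only [Pi.add_apply, Pi.sub_apply, Pi.single_apply, hne, if_false, if_true, Nat.cast_zero,
      zero_smul, add_zero, sub_zero, mul_smul_comm, map_smul, smul_eq_mul] at e2
    rw [z_mul_G (hM.subG g) g, sub_add_cancel] at e2
    rcases mul_eq_zero.1 e2 with h | h
    · have hqb : α (q + S.n) = -1 := by linear_combination h
      rw [hqb] at e1
      have : (α q + 1) * φ (S.mon α i) = 0 := by linear_combination -e1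
      rcases mul_eq_zero.1 this with h' | h'
      · exact absurd (Or.inl ⟨g, gb, t, tb, by linear_combination h', hqb⟩) hx
      · exact h'
    · exact h
  · -- type 2
    clear hx
    induction hk : i (q + S.n) generalizing i with
    | zero =>
      have e1 := hb' α i hM hP
      rw [zδ_mon_G hM g, zδ_mon_G hM gb, hM.2 _ t, hk] at e1
      simp only [Nat.cast_zero, zero_smul, add_zero, map_smul, smul_eq_mul] at e1
      have hM' := hM.addT tb
      have e2 := hb' _ _ hM' (stab α i _ _ hM hP hM' (fun r hr hr' => by simp [hr, hr'])
        (by rw [wt_addT gb]))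
      rw [zδ_mon_G hM' g, zδ_mon_G hM' gb, hM'.2 _ t, add_tsub_cancel_right, map_add, map_add] at e2
      simp only [Pi.add_apply, Pi.single_apply, if_true, Nat.cast_zero, hk,
        zero_smul, add_zero, mul_smul_comm, map_smul, smul_eq_mul, zero_add, Nat.cast_one, one_mul,
        map_zero] at e2
      by_cases h : α (q + S.n) = α q
      · rw [h] at e2; linear_combination e2
      · have : (α (q + S.n) - α q) * φ (S.mon α i) = 0 := by linear_combination e1
        exact (mul_eq_zero.1 this).resolve_left (sub_ne_zero.2 h)
    | succ k ih =>
      have e1 := hb' α i hM hP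
      have hMl := hM.sub (Pi.single (q + S.n) 1)
      have e3 := ih _ hMl (stab α i _ _ hM hP hMl (fun r hr hr' => by simp [hr, hr'])
        (wt_subT gb (by omega))) (by simp [hk])
      rw [zδ_mon_G hM g, zδ_mon_G hM gb, hM.2 _ t, map_add, map_add, map_smul, map_smul, map_smul,
        map_smul, e3] at e1
      simp only [Nat.cast_zero, zero_smul, add_zero, smul_zero, smul_eq_mul] at e1
      have hM' := hM.addT tb
      have e2 := hb' _ _ hM' (stab α i _ _ hM hP hM' (fun r hr hr' => by simp [hr, hr'])
        (by rw [wt_addT gb]))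
      rw [zδ_mon_G hM' g, zδ_mon_G hM' gb, hM'.2 _ t, add_tsub_cancel_right, map_add, map_add] at e2
      simp only [Pi.add_apply, Pi.single_apply, if_true, Nat.cast_zero, hk,
        zero_smul, add_zero, mul_smul_comm, map_smul, smul_eq_mul, map_zero] at e2
      by_cases h : α (q + S.n) = α q
      · rw [h] at e2
        have : ((k + 1 + 1 : ℕ) : K) * φ (S.mon α i) = 0 := by linear_combination e2
        exact (mul_eq_zero.1 this).resolve_left (Nat.cast_ne_zero.2 (by omega))
      · have : (α (q + S.n) - α q) * φ (S.mon α i) = 0 := by linear_combination e1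
        exact (mul_eq_zero.1 this).resolve_left (sub_ne_zero.2 h)
  · exact absurd ⟨g, t, gb⟩ h3
  · -- types 4, 5
    have hM' := (hM.subG g).addT tb
    have e2 := ha' _ _ hM' (stab α i _ _ hM hP hM' (fun r hr hr' => by simp [hr, hr'])
      (by rw [wt_addN (by omega) (by omega) gb, wt_subG g]; ring))
    rw [δ_mon_nG hM' (by omega) gb, add_tsub_cancel_right, mul_smul_comm, z_mul_G (hM.subG g) g,
      sub_add_cancel, map_smul, smul_eq_mul] at e2
    refine (mul_eq_zero.1 e2).resolve_left (Nat.cast_ne_zero.2 ?_)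
    simp
  · -- type 6
    have e1 := hb' α i hM hP
    rw [zδ_mon_nG h1 (by omega) hM g, zδ_mon_nG (by omega) (by omega) hM gb, map_smul, map_smul,
      smul_eq_mul, smul_eq_mul] at e1
    by_cases hi : i q = 0
    · rw [hi] at e1
      simp only [Nat.cast_zero, zero_mul, mul_eq_zero, Nat.cast_eq_zero] at e1
      rcases e1 with h | h
      · exact absurd (Or.inr ⟨g, gb, hi, h⟩) hx
      · exact h
    · have hM' := (hM.sub (Pi.single q 1)).addT tb
      have e2 := ha' _ _ hM' (stab α i _ _ hM hP hM' (fun r hr hr' => by simp [hr, hr'])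
        (by rw [wt_addN (by omega) (by omega) gb, wt_subN h1 (by omega) g hi]; ring))
      rw [δ_mon_nG hM' (by omega) gb, add_tsub_cancel_right, mul_smul_comm,
        z_mul_nG (hM.sub _) g t, raise_lower hi, map_smul, smul_eq_mul] at e2
      refine (mul_eq_zero.1 e2).resolve_left (Nat.cast_ne_zero.2 ?_)
      simp

/-- weight coordinate -/
def aa (S : CSetup K R) (α : ℕ → K) (i : ℕ → ℕ) (p : ℕ) : K := by
  classical exact if S.G p then α p else (i p : K)

theorem wt_eq_aa (α : ℕ → K) (i : ℕ → ℕ) : S.wt α i = ∑ p ∈ Finset.Icc 1 S.n,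
    (S.aa α i p + S.aa α i (p + S.n)) := by
  classical
  have h1 : S.wt α i = ∑ p ∈ Finset.Icc 1 (2 * S.n), S.aa α i p := by
    rw [wt]; refine Finset.sum_congr rfl fun p _ => ?_
    unfold aa; split_ifs <;> rfl
  rw [h1, Finset.sum_add_distrib]
  have h2 : Finset.Icc 1 (2 * S.n) = Finset.Icc 1 S.n ∪ (Finset.Icc 1 S.n).image (· + S.n) := by
    ext x; simp only [Finset.mem_union, Finset.mem_Icc, Finset.mem_image]
    constructor
    · intro h
      by_cases hx : x ≤ S.n
      · exact Or.inl ⟨h.1, hx⟩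
      · exact Or.inr ⟨x - S.n, by omega, by omega⟩
    · rintro (h | ⟨y, hy, rfl⟩) <;> omega
  rw [h2, Finset.sum_union, Finset.sum_image]
  · intro a _ b _ h; simpa using h
  · rw [Finset.disjoint_left]
    intro x hx hx'
    simp only [Finset.mem_Icc, Finset.mem_image] at hx hx'
    obtain ⟨y, hy, rfl⟩ := hx'; omega

theorem aa_exc {q : ℕ} {α : ℕ → K} {i : ℕ → ℕ} (h : Exc S q α i) :
    ∃ N : ℕ, S.aa α i q + S.aa α i (q + S.n) = - (2 * (N : K)) := by
  rcases h with ⟨g, gb, _, _, h, h'⟩ | ⟨g, gb, h, h'⟩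
  · exact ⟨1, by simp [aa, g, gb, h, h']; ring⟩
  · exact ⟨0, by simp [aa, g, gb, h, h']⟩

theorem sum_exc (s : Finset ℕ) {α : ℕ → K} {i : ℕ → ℕ} (h : ∀ q ∈ s, Exc S q α i) :
    ∃ N : ℕ, ∑ q ∈ s, (S.aa α i q + S.aa α i (q + S.n)) = - (2 * (N : K)) := by
  classical
  induction s using Finset.induction_on with
  | empty => exact ⟨0, by simp⟩
  | insert a s ha ih =>
    obtain ⟨N, hN⟩ := ih fun q hq => h q (Finset.mem_insert_of_mem hq)
    obtain ⟨N', hN'⟩ := aa_exc (h a (Finset.mem_insert_self a s))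
    exact ⟨N + N', by rw [Finset.sum_insert ha, hN, hN']; push_cast; ring⟩

theorem wt_exc {α : ℕ → K} {i : ℕ → ℕ} (h : ∀ q, 1 ≤ q → q ≤ S.n → Exc S q α i) :
    ∃ N : ℕ, S.wt α i = - (2 * (N : K)) := by
  rw [wt_eq_aa]
  exact sum_exc _ fun q hq => by rw [Finset.mem_Icc] at hq; exact h q hq.1 hq.2

theorem wt_exc' {α : ℕ → K} {i : ℕ → ℕ} {p : ℕ} (h1 : 1 ≤ p) (h2 : p ≤ S.n)
    (h : ∀ q, 1 ≤ q → q ≤ S.n → q ≠ p → Exc S q α i) :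
    ∃ N : ℕ, S.wt α i = S.aa α i p + S.aa α i (p + S.n) - (2 * (N : K)) := by
  rw [wt_eq_aa, ← Finset.add_sum_erase _ _ (Finset.mem_Icc.2 ⟨h1, h2⟩)]
  obtain ⟨N, hN⟩ := sum_exc (S := S) ((Finset.Icc 1 S.n).erase p) (α := α) (i := i) fun q hq => by
    rw [Finset.mem_erase, Finset.mem_Icc] at hq; exact h q hq.2.1 hq.2.2 hq.1
  exact ⟨N, by rw [hN]; ring⟩

theorem wt_ne_four {α : ℕ → K} {i : ℕ → ℕ} (h : ∀ q, 1 ≤ q → q ≤ S.n → Exc S q α i) :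
    S.wt α i ≠ 4 := by
  obtain ⟨N, hN⟩ := wt_exc h
  rw [hN]; intro h'
  have : ((4 + 2 * N : ℕ) : K) = 0 := by push_cast; linear_combination -h'
  rw [Nat.cast_eq_zero] at this; omega

end CSetup
end CT

set_option linter.all false
namespace CT
namespace CSetup
variable {K R : Type*} [Field K] [CommRing R] [Algebra K R] [CharZero K]
variable {S : CSetup K R} {ψ : R →ₗ[K] R →ₗ[K] K}

/-- the class of a basis index: its group part -/
def kap (S : CSetup K R) : (S.Gm × {i : ℕ → ℕ // ∀ p, ¬ S.T p → i p = 0}) → (ℕ → K) := fun x => x.1.1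

theorem mon_mem_W {α : ℕ → K} {i : ℕ → ℕ} (h : S.M α i) : S.mon α i ∈ Wsp S.b S.kap α := by
  rw [mon_eq h]; exact b_mem_W S.b S.kap (⟨α, h.1⟩, ⟨i, h.2⟩)

theorem st_W {α : ℕ → K} (q : ℕ) {c : R} (hc : c ∈ Wsp S.b S.kap α) : S.st q c = α q • c := by
  have := W_ind S.b S.kap (k := α)
    (U := LinearMap.ker ((S.st q : R →ₗ[K] R) - α q • LinearMap.id)) (fun x hx => by
      have hx' : x.1.1 = α := hx
      rw [LinearMap.mem_ker, LinearMap.sub_apply, b_eq]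
      change S.st q _ - _ = 0
      rw [st_mon q (M_x x), hx', LinearMap.smul_apply, LinearMap.id_apply, sub_self]) c hc
  rw [LinearMap.mem_ker, LinearMap.sub_apply] at this
  exact sub_eq_zero.1 this

theorem dt_W {α : ℕ → K} (q : ℕ) {c : R} (hc : c ∈ Wsp S.b S.kap α) :
    S.dt q c ∈ Wsp S.b S.kap α := by
  refine W_stab S.b S.kap (D := (S.dt q : R →ₗ[K] R)) (fun x => ?_) c hc
  change S.dt q (S.b x) ∈ _
  rw [b_eq, dt_mon q (M_x x)]
  exact Submodule.smul_mem _ _ (mon_mem_W ((M_x x).sub _))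

theorem t_W {α : ℕ → K} {q : ℕ} (hq : S.T q) {c : R} (hc : c ∈ Wsp S.b S.kap α) :
    S.mon 0 (Pi.single q 1) * c ∈ Wsp S.b S.kap α := by
  refine W_stab S.b S.kap (D := LinearMap.mulLeft K (S.mon 0 (Pi.single q 1))) (fun x => ?_) c hc
  rw [LinearMap.mulLeft_apply, b_eq, mon_mul (M_sT hq) (M_x x), zero_add]
  exact mon_mem_W ⟨x.1.2, ((M_sT hq).add (M_x x)).2⟩

theorem ln_step {L V : Type*} [Field L] [AddCommGroup V] [Module L V] (N : V →ₗ[L] V) {u : V}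
    (h : ∃ n, (N ^ n) (N u) = 0) : ∃ n, (N ^ n) u = 0 := by
  obtain ⟨n, hn⟩ := h
  exact ⟨n + 1, by rwa [pow_succ, Module.End.mul_apply]⟩

theorem ln_zero {L V : Type*} [Field L] [AddCommGroup V] [Module L V] (N : V →ₗ[L] V) :
    ∃ n, (N ^ n) 0 = 0 := ⟨0, by simp⟩
theorem ln_smul {L V : Type*} [Field L] [AddCommGroup V] [Module L V] (N : V →ₗ[L] V) (c : L) {u : V}
    (h : ∃ n, (N ^ n) u = 0) : ∃ n, (N ^ n) (c • u) = 0 := by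
  obtain ⟨W, hW⟩ := ln_submodule N
  exact (hW _).1 (W.smul_mem c ((hW _).2 h))
theorem ln_sub {L V : Type*} [Field L] [AddCommGroup V] [Module L V] (N : V →ₗ[L] V) {u v : V}
    (h : ∃ n, (N ^ n) u = 0) (h' : ∃ n, (N ^ n) v = 0) : ∃ n, (N ^ n) (u - v) = 0 := by
  obtain ⟨W, hW⟩ := ln_submodule N
  exact (hW _).1 (W.sub_mem ((hW _).2 h) ((hW _).2 h'))

theorem dt_nil (q : ℕ) (u : R) : ∃ n, ((S.dt q : R →ₗ[K] R) ^ n) u = 0 := by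
  obtain ⟨W, hW⟩ := ln_submodule (S.dt q : R →ₗ[K] R)
  rw [← hW]
  refine S.mon_ind u (fun α i h => ?_) W.zero_mem (fun u v => W.add_mem) (fun c u => W.smul_mem c)
  induction hk : i q generalizing i with
  | zero =>
    rw [hW]; apply ln_step
    change ∃ n, ((S.dt q : R →ₗ[K] R) ^ n) (S.dt q (S.mon α i)) = 0
    rw [dt_mon q h, hk]; simp
  | succ k ih =>
    rw [hW]; apply ln_step
    change ∃ n, ((S.dt q : R →ₗ[K] R) ^ n) (S.dt q (S.mon α i)) = 0
    rw [dt_mon q h, ← hW]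
    exact W.smul_mem _ (ih _ (h.sub _) (by simp [hk]))

theorem d_t {p q : ℕ} (hq : S.T q) : S.d p (S.mon 0 (Pi.single q 1)) = if p = q then 1 else 0 := by
  rw [d_apply, st_mon _ (M_sT hq), dt_mon _ (M_sT hq)]
  split_ifs with h
  · subst h; simp [mon_one]
  · simp [h]

/-! powers of the exponential in coordinate zero -/

/-- `Y k` -/
def Y (S : CSetup K R) (k : ℤ) : R := S.mon (Pi.single 0 (k : K)) 0

theorem M_Y (h : ¬ S.T 0) (k : ℤ) : S.M (Pi.single 0 (k : K)) 0 := by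
  have h' := S.h0.resolve_left h
  refine ⟨?_, fun _ _ => rfl⟩
  have : Pi.single 0 (k : K) = k • (Pi.single 0 1 : ℕ → K) := by
    funext q
    by_cases hq : q = 0
    · subst hq; simp
    · simp [hq]
  rw [this]; exact zsmul_mem h' k

theorem wt_Y (k : ℤ) : S.wt (Pi.single 0 (k : K)) 0 = 0 := by
  classical
  rw [wt, Finset.sum_eq_zero]
  intro q hq
  rw [Finset.mem_Icc] at hq
  have : q ≠ 0 := by omega
  simp [this]

theorem Y_mul (h : ¬ S.T 0) (k : ℤ) {α : ℕ → K} {i : ℕ → ℕ} (hM : S.M α i) :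
    S.Y k * S.mon α i = S.mon (α + Pi.single 0 (k : K)) i := by
  rw [Y, mon_mul (M_Y h k) hM, zero_add, add_comm]

theorem Y_zero : S.Y 0 = 1 := by simp [Y, mon_one]

theorem Y_add (h : ¬ S.T 0) (k l : ℤ) : S.Y k * S.Y l = S.Y (k + l) := by
  rw [Y, Y, Y, mon_mul (M_Y h k) (M_Y h l), zero_add]; congr 1
  rw [Int.cast_add, Pi.single_add]

theorem δ_Y (h : ¬ S.T 0) (k : ℤ) {q : ℕ} (hq : q ≠ 0) : S.δ q (S.Y k) = 0 := by
  rw [δ_apply, d_apply, Y, st_mon _ (M_Y h k), dt_mon _ (M_Y h k)]; simp [hq]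

theorem E_Y (h : ¬ S.T 0) (k : ℤ) : S.E (S.Y k) = 0 := by
  rw [Y, E_mon (M_Y h k), wt_Y, zero_smul]

theorem d0_Y (h : ¬ S.T 0) (k : ℤ) : S.d 0 (S.Y k) = (k : K) • S.Y k := by
  rw [Y, d_apply, st_mon _ (M_Y h k), dt_mon _ (M_Y h k)]; simp

theorem P_Y (h : ¬ S.T 0) (k : ℤ) (u : R) : S.P u (S.Y k) = 0 := by
  rw [P, Finset.sum_eq_zero]
  intro q hq
  rw [Finset.mem_Icc] at hq
  rw [δ_Y h k (by omega), δ_Y h k (by omega)]; ring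

theorem br_Y (h : ¬ S.T 0) (k : ℤ) (u : R) :
    S.br (S.Y k) u = S.Y k * ((2:K) • S.d 0 u - (k : K) • ((2:K) • u - S.E u)) := by
  rw [br_cst (fun q h1 _ => δ_Y h k (by omega)) (E_Y h k), d0_Y h]
  simp only [Algebra.smul_def, map_ofNat]; ring

theorem d0_mon (h : ¬ S.T 0) {α : ℕ → K} {i : ℕ → ℕ} (hM : S.M α i) :
    S.d 0 (S.mon α i) = α 0 • S.mon α i := by
  rw [d_apply, st_mon _ hM, dt_mon _ hM, hM.2 0 h]; simp

theorem br_quad {h : R} (h0 : S.d 0 h = 0) (h2 : S.E h = 2 * h) (u : R) : S.br h u = S.P h u := by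
  rw [br, h0, h2]; ring

/-- generic kernel step -/
theorem ker_gen (hT : ¬ S.T 0) (hψ : Coc S ψ) {h : R} (h0 : S.d 0 h = 0) (h2 : S.E h = 2 * h)
    {α : ℕ → K} {i : ℕ → ℕ} (hM : S.M α i) (hc : S.br h (S.mon α i) = 0)
    (hne : ψ h (S.mon α i) ≠ 0) : α 0 = 0 ∧ S.wt α i = 4 := by
  have a0 : α 0 = 0 := by
    by_contra ha
    have e := hψ.inv h 1 (S.mon α i)
    rw [hc, map_zero, br_skew h 1, br_one, br_one, h0, d0_mon hT hM, mul_smul_comm, map_smul] at e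
    rw [← smul_eq_mul, ← Nat.cast_two (R := R), Nat.cast_smul_eq_nsmul, map_nsmul] at e
    simp at e
    exact (e.resolve_left ha) |> hne
  refine ⟨a0, ?_⟩
  by_contra hw
  have hM' : S.M (α + Pi.single 0 ((-1 : ℤ) : K)) i := by
    have := hM.add (M_Y hT (-1)); rwa [add_zero] at this
  have e := hψ.inv h (S.Y 1) (S.Y (-1) * S.mon α i)
  have e1 : S.br h (S.Y (-1) * S.mon α i) = 0 := by
    rw [br_quad h0 h2] at hc ⊢
    rw [P_mul, P_Y hT, hc]; ring
  have e2 : S.br h (S.Y 1) = 0 := by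
    rw [br_quad h0 h2, P_Y hT]
  have e3 : S.br (S.Y 1) (S.Y (-1) * S.mon α i) = (S.wt α i - 4) • S.mon α i := by
    rw [br_Y hT, Y_mul hT _ hM, d0_mon hT hM', E_mon hM', ← Y_mul hT _ hM]
    have : S.Y 1 * S.Y (-1) = 1 := by rw [Y_add hT]; exact Y_zero
    have hw : S.wt (α + Pi.single 0 ((-1 : ℤ) : K)) i = S.wt α i := by
      have := S.wt_add α (Pi.single 0 ((-1 : ℤ) : K)) i 0
      rwa [wt_Y, add_zero, add_zero] at this
    rw [hw]
    simp only [Pi.add_apply, a0, Pi.single_eq_same]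
    have e4 : S.Y 1 * (S.Y (-1) * S.mon α i) = S.mon α i := by rw [← mul_assoc, this, one_mul]
    simp only [mul_sub, mul_smul_comm, e4]
    push_cast
    module
  rw [e1, e2, e3, map_zero, map_zero, LinearMap.zero_apply, add_zero, map_smul, smul_eq_mul] at e
  exact ((mul_eq_zero.1 e).resolve_left (sub_ne_zero.2 hw)) |> hne

/-- KL for the functional `ψ h`. -/
theorem KLh (hψ : Coc S ψ) {h : R} {q : ℕ} (h1 : 1 ≤ q) (h2 : q ≤ S.n)
    (h3 : ¬ (S.G q ∧ S.T q ∧ S.G (q + S.n))) (hz : S.br h (S.z q * S.z q) = 0)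
    (hzb : S.br h (S.z q * S.z (q + S.n)) = 0)
    (P : (ℕ → K) → (ℕ → ℕ) → Prop)
    (stab : ∀ α i β j, S.M α i → P α i → S.M β j →
      (∀ r, r ≠ q → r ≠ q + S.n → β r = α r ∧ j r = i r) → S.wt β j = S.wt α i → P β j)
    (hP : ∀ α i, S.M α i → P α i → S.br h (S.mon α i) = 0)
    (α : ℕ → K) (i : ℕ → ℕ) (hM : S.M α i) (hp : P α i) (hne : ψ h (S.mon α i) ≠ 0) :
    Exc S q α i := by
  by_contra hx
  refine hne (KL h1 h2 h3 (ψ h) P stab (fun β j hj hj' => ?_) (fun β j hj hj' => ?_) α i hM hp hx)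
  · rw [hψ.inv, hz, hP _ _ hj hj']; simp
  · rw [hψ.inv, hzb, hP _ _ hj hj']; simp

theorem br_one_mon {α : ℕ → K} {i : ℕ → ℕ} (hM : S.M α i) (ha : α 0 = 0) (hi : i 0 = 0) :
    S.br 1 (S.mon α i) = 0 := by
  rw [br_one, d_apply, st_mon _ hM, dt_mon _ hM, ha, hi]; simp

theorem br_one_z2 {p q : ℕ} (h1 : 1 ≤ p) (h2 : p ≤ 2 * S.n) (h3 : 1 ≤ q) (h4 : q ≤ 2 * S.n) :
    S.br 1 (S.z p * S.z q) = 0 := by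
  rw [br_one, Derivation.leibniz, d0_z h1 h2, d0_z h3 h4]; simp

theorem case_T0 (hT : S.T 0) (hn3 : ∀ p, 1 ≤ p → p ≤ S.n → ¬ (S.G p ∧ S.T p ∧ S.G (p + S.n)))
    (hψ : Coc S ψ) : IsCob S ψ := by
  have two : ∀ u : R, 2 * u = (2 : K) • u := fun u => by rw [Algebra.smul_def, map_ofNat]
  have dW : ∀ α : ℕ → K, ∀ c ∈ Wsp S.b S.kap α, S.br 1 c = (2:K) • (α 0 • c + S.dt 0 c) := by
    intro α c hc
    rw [br_one, d_apply, st_W 0 hc, two]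
  refine cob_of hψ S.kap 1 ((2:K)⁻¹ • LinearMap.mulLeft K (S.mon 0 (Pi.single 0 1)))
    (fun α => 2 * α 0) ?_ ?_ ?_ ?_ ?_
  · intro x
    have := b_mem_W S.b S.kap x
    rw [dW _ _ this]
    exact Submodule.smul_mem _ _ (Submodule.add_mem _ (Submodule.smul_mem _ _ this) (dt_W 0 this))
  · intro x
    exact Submodule.smul_mem _ _ (t_W hT (b_mem_W S.b S.kap x))
  · intro u
    simp only [LinearMap.smul_apply, LinearMap.mulLeft_apply, br_smul, br_one, Derivation.leibniz,
      d_t hT, if_true, two, smul_eq_mul, mul_one, mul_smul_comm, smul_add, smul_smul]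
    rw [inv_mul_cancel₀ two_ne_zero]; module
  · intro x
    rw [b_eq]
    have : ∀ k, ∀ i, S.M x.1.1 i → i 0 = k →
        ∃ n, ((sh (S.brL 1) (2 * x.1.1 0)) ^ n) (S.mon x.1.1 i) = 0 := by
      intro k
      induction k with
      | zero =>
        intro i hi hk
        apply ln_step
        rw [sh_apply, brL_apply, dW _ _ (mon_mem_W hi), dt_mon _ hi, hk]
        convert ln_zero _ using 4
        simp only [Nat.cast_zero]; module
      | succ k ih =>
        intro i hi hk
        apply ln_step
        rw [sh_apply, brL_apply, dW _ _ (mon_mem_W hi), dt_mon _ hi, hk]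
        convert ln_smul _ (2 * ((k+1 : ℕ) : K)) (ih (i - Pi.single 0 1) (hi.sub _) (by simp [hk])) using 4
        module
    exact this _ _ (M_x x) rfl
  · intro α c hc h
    rw [dW _ _ hc] at h
    have h := (smul_eq_zero_iff_right (two_ne_zero (α := K))).1 h
    by_cases ha : α 0 = 0
    · rw [ha, zero_smul, zero_add] at h
      refine ker_dt S.kap 0 (ψ 1) hc h fun x hx hi => ?_
      have hx' : x.1.1 = α := hx
      rw [b_eq]
      have hM := M_x x
      have ha : x.1.1 0 = 0 := by rw [hx', ha]
      generalize x.1.1 = β at *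
      generalize x.2.1 = i at *
      clear hx hx' hc h
      by_contra hne
      have hw : S.wt β i = 4 := by
        have e := hψ.inv 1 (S.mon 0 (Pi.single 0 1)) (S.mon β i)
        rw [br_one_mon hM ha hi, map_zero, add_zero, br_one, d_t hT, if_pos rfl] at e
        have e3 : S.br (S.mon 0 (Pi.single 0 1)) (S.mon β i) = (S.wt β i - 2) • S.mon β i := by
          rw [br_cst, d_t hT, d_apply, st_mon _ hM, dt_mon _ hM, E_mon hM, ha, hi, two]
          · simp only [if_true, Nat.cast_zero, zero_smul, add_zero, mul_zero]; rw [one_mul, sub_smul, two]; abel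
          · intro q hq _
            rw [δ_apply, d_t hT, if_neg (by omega), mul_zero]
          · rw [E_mon (M_sT hT), wt_s0', zero_smul]
        rw [e3, two, map_smul, map_smul, LinearMap.smul_apply, smul_eq_mul, smul_eq_mul] at e
        have : (S.wt β i - 4) * ψ 1 (S.mon β i) = 0 := by linear_combination e
        exact sub_eq_zero.1 ((mul_eq_zero.1 this).resolve_right hne)
      refine wt_ne_four (fun q h1 h2 => ?_) hw
      refine KLh hψ h1 h2 (hn3 q h1 h2) (br_one_z2 h1 (by omega) h1 (by omega))
        (br_one_z2 h1 (by omega) (by omega) (by omega)) (fun α i => α 0 = 0 ∧ i 0 = 0) ?_ ?_ β i hM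
        ⟨ha, hi⟩ hne
      · intro α i β j _ h _ h' _
        have := h' 0 (by omega) (by omega)
        rw [this.1, this.2]; exact h
      · intro α i hM h; exact br_one_mon hM h.1 h.2
    · obtain ⟨n, hn⟩ := dt_nil (S := S) 0 c
      rw [inj_lam (S.dt 0 : R →ₗ[K] R) ha n c hn h, map_zero]

/-- Casimir type identity -/
theorem casimir {p : ℕ} (h1 : 1 ≤ p) (h2 : p ≤ S.n) (hψ : Coc S ψ) {c : R}
    (hc : S.br (S.z p * S.z (p + S.n)) c = 0) :
    ψ (S.z p * S.z (p + S.n)) (S.z p * S.δ p c + S.z p * S.δ p (S.z p * S.δ p c)) = 0 := by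
  have b1 := δ_z_self (S := S) h1 (show p ≤ 2 * S.n by omega)
  have b2 := δ_z_self (S := S) (show 1 ≤ p + S.n by omega) (show p + S.n ≤ 2 * S.n by omega)
  have b3 := δ_z_ne (S := S) h1 (show p ≤ 2 * S.n by omega) (show p + S.n ≠ p by have := S.hn; omega)
  have b4 := δ_z_ne (S := S) (show 1 ≤ p + S.n by omega) (show p + S.n ≤ 2 * S.n by omega)
    (show p ≠ p + S.n by have := S.hn; omega)
  rw [br_zzb h1 h2] at hc
  have hd := congrArg (S.δ p) hc
  simp only [map_sub, map_zero, Derivation.leibniz, smul_eq_mul, b1, b4, δ_δ p (p + S.n)] at hd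
  set b : R := S.z (p + S.n) * S.δ p c with hb
  have e1 : S.br (S.z p * S.z (p + S.n)) b = (2 : K) • b := by
    rw [br_zzb h1 h2, hb]
    simp only [Derivation.leibniz, smul_eq_mul, b1, b2, b3, b4, Algebra.smul_def, map_ofNat]
    linear_combination (S.z (p + S.n)) * hd
  have e2 : S.br (S.z p * S.z (p + S.n)) (S.z p * S.z p) = (-2 : K) • (S.z p * S.z p) := by
    rw [br_zzb h1 h2]
    simp only [Derivation.leibniz, smul_eq_mul, b1, b2, b3, b4, Algebra.smul_def, map_neg, map_ofNat]
    ring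
  have e3 : S.br (S.z p * S.z p) b =
      (2 : K) • (S.z p * S.δ p c + S.z p * S.δ p (S.z p * S.δ p c)) := by
    rw [br_zz h1 h2, hb]
    simp only [Derivation.leibniz, smul_eq_mul, b1, b2, b3, b4, Algebra.smul_def, map_ofNat]
    linear_combination 2 * (S.z p) * hd
  have e := hψ.inv (S.z p * S.z (p + S.n)) (S.z p * S.z p) b
  rw [e1, e2, e3] at e
  simp only [map_smul, LinearMap.smul_apply, smul_eq_mul] at e
  have : (2:K) * ψ (S.z p * S.z (p + S.n)) (S.z p * S.δ p c + S.z p * S.δ p (S.z p * S.δ p c)) = 0 := by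
    rw [e]; ring
  simpa using this

end CSetup
end CT

set_option linter.all false
namespace CT
namespace CSetup
variable {K R : Type*} [Field K] [CommRing R] [Algebra K R] [CharZero K]
variable {S : CSetup K R} {ψ : R →ₗ[K] R →ₗ[K] K}

theorem br_zzb_W {p : ℕ} (h1 : 1 ≤ p) (h2 : p ≤ S.n) (g : S.G p) (gb : S.G (p + S.n))
    {α : ℕ → K} {c : R} (hc : c ∈ Wsp S.b S.kap α) : S.br (S.z p * S.z (p + S.n)) c =
      (α (p + S.n) - α p) • c + (S.dt (p + S.n) c - S.dt p c) := by
  rw [br_zzb h1 h2, zδ_G g, zδ_G gb, d_apply, d_apply, st_W _ hc, st_W _ hc]; module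

theorem case_23 {p : ℕ} (h1 : 1 ≤ p) (h2 : p ≤ S.n) (g : S.G p) (gb : S.G (p + S.n))
    (tb : S.T (p + S.n)) (hψ : Coc S ψ)
    (hker : ∀ k, ∀ c ∈ Wsp S.b S.kap k, S.br (S.z p * S.z (p + S.n)) c = 0 →
      ψ (S.z p * S.z (p + S.n)) c = 0) : IsCob S ψ := by
  have hne : p ≠ p + S.n := by have := S.hn; omega
  refine cob_of hψ S.kap (S.z p * S.z (p + S.n)) (LinearMap.mulLeft K (S.mon 0 (Pi.single (p + S.n) 1)))
    (fun α => α (p + S.n) - α p) ?_ ?_ ?_ ?_ hker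
  · intro x
    have := b_mem_W S.b S.kap x
    rw [br_zzb_W h1 h2 g gb this]
    exact Submodule.add_mem _ (Submodule.smul_mem _ _ this) (Submodule.sub_mem _ (dt_W _ this) (dt_W _ this))
  · intro x
    exact t_W tb (b_mem_W S.b S.kap x)
  · intro u
    simp only [LinearMap.mulLeft_apply, br_zzb h1 h2, zδ_G g, zδ_G gb]
    simp only [Derivation.leibniz, d_t tb, if_true, if_neg hne, smul_eq_mul]
    ring
  · intro x
    rw [b_eq]
    have : ∀ k, ∀ i, S.M x.1.1 i → i p + i (p + S.n) = k →
        ∃ n, ((sh (S.brL (S.z p * S.z (p + S.n))) (x.1.1 (p + S.n) - x.1.1 p)) ^ n)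
          (S.mon x.1.1 i) = 0 := by
      intro k
      induction k with
      | zero =>
        intro i hi hk
        apply ln_step
        rw [sh_apply, brL_apply, br_zzb_W h1 h2 g gb (mon_mem_W hi), dt_mon _ hi, dt_mon _ hi,
          show i p = 0 by omega, show i (p + S.n) = 0 by omega]
        convert ln_zero _ using 4
        simp only [Nat.cast_zero]; module
      | succ k ih =>
        intro i hi hk
        apply ln_step
        rw [sh_apply, brL_apply, br_zzb_W h1 h2 g gb (mon_mem_W hi), dt_mon _ hi, dt_mon _ hi,
          add_sub_cancel_left]
        apply ln_sub
        · by_cases h0 : i (p + S.n) = 0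
          · rw [h0, Nat.cast_zero, zero_smul]; exact ln_zero _
          · exact ln_smul _ _ (ih _ (hi.sub _) (by
            have e : (Pi.single (p + S.n) 1 : ℕ → ℕ) p = 0 := Pi.single_eq_of_ne hne 1
            simp only [Pi.sub_apply, e, Pi.single_eq_same]; omega))
        · by_cases h0 : i p = 0
          · rw [h0, Nat.cast_zero, zero_smul]; exact ln_zero _
          · exact ln_smul _ _ (ih _ (hi.sub _) (by
            have e : (Pi.single p 1 : ℕ → ℕ) (p + S.n) = 0 := Pi.single_eq_of_ne hne.symm 1
            simp only [Pi.sub_apply, e, Pi.single_eq_same]; omega))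
    exact this _ _ (M_x x) rfl

theorem case_3 {p : ℕ} (h1 : 1 ≤ p) (h2 : p ≤ S.n) (g : S.G p) (gb : S.G (p + S.n))
    (t : S.T p) (tb : S.T (p + S.n)) (hψ : Coc S ψ) : IsCob S ψ := by
  have hne : p ≠ p + S.n := by have := S.hn; omega
  refine case_23 h1 h2 g gb tb hψ fun α c hc hD => ?_
  let W : Submodule K R := Wsp S.b S.kap α ⊓ LinearMap.ker (S.brL (S.z p * S.z (p + S.n)))
  have hW : ∀ u, u ∈ W ↔ u ∈ Wsp S.b S.kap α ∧
      (α (p + S.n) - α p) • u + (S.dt (p + S.n) u - S.dt p u) = 0 := by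
    intro u
    constructor
    · rintro ⟨ha, hb⟩
      exact ⟨ha, by rw [← br_zzb_W h1 h2 g gb ha]; exact hb⟩
    · rintro ⟨ha, hb⟩
      exact ⟨ha, by rw [← br_zzb_W h1 h2 g gb ha] at hb; exact hb⟩
  have key : ∀ l : K, ∀ u ∈ W, ∃ w ∈ W, l • w + S.dt p w = u := by
    intro l u hu
    refine surj_any (S.dt p : R →ₗ[K] R) (LinearMap.mulLeft K
      (S.mon 0 (Pi.single p 1) + S.mon 0 (Pi.single (p + S.n) 1))) W ?_ ?_ ?_ ?_ l u hu
    · intro u hu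
      rw [hW] at hu ⊢
      refine ⟨dt_W p hu.1, ?_⟩
      have := congrArg (S.dt p) hu.2
      rw [map_add, Derivation.map_smul, map_sub, map_zero, dt_dt] at this
      exact this
    · intro u hu
      rw [hW] at hu ⊢
      rw [LinearMap.mulLeft_apply, add_mul]
      refine ⟨Submodule.add_mem _ (t_W t hu.1) (t_W tb hu.1), ?_⟩
      have e : ∀ r q, S.T q → S.dt r (S.mon 0 (Pi.single q 1)) = if r = q then 1 else 0 := by
        intro r q hq
        have := d_t (S := S) (p := r) hq
        rwa [d_apply, st_mon _ (M_sT hq), Pi.zero_apply, zero_smul, zero_add] at this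
      simp only [map_add, Derivation.leibniz, e _ _ t, e _ _ tb, if_true, if_neg hne, if_neg hne.symm,
        smul_eq_mul]
      have := hu.2
      simp only [Algebra.smul_def] at this ⊢
      linear_combination (S.mon 0 (Pi.single p 1) + S.mon 0 (Pi.single (p + S.n) 1)) * this
    · intro u
      change S.dt p (_ * u) - _ * S.dt p u = u
      have e : ∀ q, S.T q → S.dt p (S.mon 0 (Pi.single q 1)) = if p = q then 1 else 0 := by
        intro q hq
        have := d_t (S := S) (p := p) hq
        rwa [d_apply, st_mon _ (M_sT hq), Pi.zero_apply, zero_smul, zero_add] at this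
      simp only [map_add, Derivation.leibniz, e _ t, e _ tb, if_true, if_neg hne, smul_eq_mul]
      ring
    · intro u _; exact dt_nil p u
  obtain ⟨w1, hw1, e1⟩ := key (α p + 1) c ⟨hc, hD⟩
  obtain ⟨w, hw, e2⟩ := key (α p) w1 hw1
  have hd : ∀ v ∈ W, S.z p * S.δ p v = α p • v + S.dt p v := fun v hv => by
    rw [zδ_G g, d_apply, st_W p hv.1]
  have := casimir h1 h2 hψ (c := w) hw.2
  rw [hd w hw, e2, hd w1 hw1] at this
  rw [← e1, ← this]
  congr 1; module

section

theorem quad_br {p q : ℕ} (h1 : 1 ≤ p) (h2 : p ≤ S.n) (hpq : q ≠ p) (hq1 : 1 ≤ q)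
    (hq2 : q ≤ S.n) {h : R} (hh : S.δ q h = 0) (hh' : S.δ (q + S.n) h = 0) :
    S.br h (S.z q * S.z q) = 0 ∧ S.br h (S.z q * S.z (q + S.n)) = 0 := by
  rw [br_skew, br_zz hq1 hq2, br_skew, br_zzb hq1 hq2, hh, hh']; simp

theorem case_2 (hT : ¬ S.T 0) (hn3 : ∀ p, 1 ≤ p → p ≤ S.n → ¬ (S.G p ∧ S.T p ∧ S.G (p + S.n)))
    {p : ℕ} (h1 : 1 ≤ p) (h2 : p ≤ S.n) (g : S.G p) (gb : S.G (p + S.n))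
    (t : ¬ S.T p) (tb : S.T (p + S.n)) (hψ : Coc S ψ) : IsCob S ψ := by
  refine case_23 h1 h2 g gb tb hψ fun α c hc hD => ?_
  have hdt : S.dt p c = 0 := by
    have : S.dt p = 0 := der_ext (S := S) fun β i hM => by
      rw [dt_mon _ hM, hM.2 _ t]; simp
    rw [this]; rfl
  rw [br_zzb_W h1 h2 g gb hc, hdt, sub_zero] at hD
  by_cases hl : α (p + S.n) - α p = 0
  · rw [hl, zero_smul, zero_add] at hD
    refine ker_dt S.kap (p + S.n) _ hc hD fun x hx hi => ?_
    have hx' : x.1.1 = α := hx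
    rw [b_eq]
    have hM := M_x x
    have ha : x.1.1 (p + S.n) = x.1.1 p := by rw [hx']; exact sub_eq_zero.1 hl
    generalize x.1.1 = β at *
    generalize x.2.1 = i at *
    clear hx hx' hc hD
    by_contra hne
    have hbr : ∀ (β : ℕ → K) i, S.M β i → β (p + S.n) = β p ∧ i (p + S.n) = 0 →
        S.br (S.z p * S.z (p + S.n)) (S.mon β i) = 0 := by
      rintro β i hM ⟨ha, hi⟩
      rw [br_zzb_W h1 h2 g gb (mon_mem_W hM), dt_mon _ hM, dt_mon _ hM, hi, hM.2 _ t, ha]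
      simp
    have h0 : S.d 0 (S.z p * S.z (p + S.n)) = 0 := by
      rw [Derivation.leibniz, d0_z h1 (by omega), d0_z (by omega) (by omega)]; simp
    have hE : S.E (S.z p * S.z (p + S.n)) = 2 * (S.z p * S.z (p + S.n)) := by
      rw [Derivation.leibniz, E_z h1 (by omega), E_z (by omega) (by omega)]; simp; ring
    obtain ⟨a0, hw⟩ := ker_gen hT hψ h0 hE hM (hbr _ _ hM ⟨ha, hi⟩) hne
    have hexc : ∀ q, 1 ≤ q → q ≤ S.n → q ≠ p → Exc S q β i := by
      intro q hq1 hq2 hq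
      have hδ : ∀ r, r ≠ p → r ≠ p + S.n → S.δ r (S.z p * S.z (p + S.n)) = 0 := by
        intro r hr hr'
        rw [Derivation.leibniz, δ_z_ne h1 (by omega) hr, δ_z_ne (by omega) (by omega) hr']; simp
      have := quad_br h1 h2 hq hq1 hq2 (hδ q hq (by omega)) (hδ (q + S.n) (by omega) (by omega))
      refine KLh hψ hq1 hq2 (hn3 q hq1 hq2) this.1 this.2
        (fun β i => β (p + S.n) = β p ∧ i (p + S.n) = 0) ?_ hbr β i hM ⟨ha, hi⟩ hne
      intro α i β j _ h _ h' _
      have a := h' p (by omega) (by omega)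
      have b := h' (p + S.n) (by omega) (by omega)
      rw [a.1, b.1, b.2]; exact h
    obtain ⟨N, hN⟩ := wt_exc' h1 h2 hexc
    simp only [aa, if_pos g, if_pos gb, hw, ha] at hN
    have hs : β p = N + 2 := by
      have : (2:K) * (β p - (N + 2)) = 0 := by linear_combination -hN
      simpa [sub_eq_zero] using this
    have hd : S.z p * S.δ p (S.mon β i) = β p • S.mon β i := by
      rw [zδ_mon_G hM g, hM.2 _ t]; simp
    have e := casimir h1 h2 hψ (hbr _ _ hM ⟨ha, hi⟩)
    rw [hd, Derivation.map_smul, mul_smul_comm, hd] at e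
    simp only [map_add, map_smul, smul_eq_mul] at e
    have e' : (((N + 2) * (N + 3) : ℕ) : K) * ψ (S.z p * S.z (p + S.n)) (S.mon β i) = 0 := by
      push_cast
      rw [hs] at e
      linear_combination e
    rcases mul_eq_zero.1 e' with h | h
    · rw [Nat.cast_eq_zero] at h; simp at h
    · exact hne h
  · obtain ⟨n, hn⟩ := dt_nil (S := S) (p + S.n) c
    rw [inj_lam (S.dt (p + S.n) : R →ₗ[K] R) hl n c hn hD, map_zero]

theorem case_45 (hT : ¬ S.T 0) (hn3 : ∀ p, 1 ≤ p → p ≤ S.n → ¬ (S.G p ∧ S.T p ∧ S.G (p + S.n)))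
    {p : ℕ} (h1 : 1 ≤ p) (h2 : p ≤ S.n) (g : S.G p) (gb : ¬ S.G (p + S.n))
    (tb : S.T (p + S.n)) (hψ : Coc S ψ) : IsCob S ψ := by
  have two : ∀ u : R, 2 * u = (2 : K) • u := fun u => by rw [Algebra.smul_def, map_ofNat]
  have hne : p + S.n ≠ p := by have := S.hn; omega
  have hbr : ∀ u, S.br (S.z p * S.z p) u = (2 : K) • (S.z p * S.dt (p + S.n) u) := fun u => by
    rw [br_zz h1 h2, δ_nG (by omega) gb, two]
  have h0 : S.d 0 (S.z p * S.z p) = 0 := by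
    rw [Derivation.leibniz, d0_z h1 (by omega)]; simp
  have hE : S.E (S.z p * S.z p) = 2 * (S.z p * S.z p) := by
    rw [Derivation.leibniz, E_z h1 (by omega)]; simp; ring
  have hdtz : ∀ v, S.dt (p + S.n) (S.zi p * (S.mon 0 (Pi.single (p + S.n) 1) * v)) =
      S.zi p * v + S.zi p * (S.mon 0 (Pi.single (p + S.n) 1) * S.dt (p + S.n) v) := by
    intro v
    have := d_t (S := S) (p := p + S.n) tb
    rw [d_apply, st_mon _ (M_sT tb), Pi.zero_apply, zero_smul, zero_add, if_pos rfl] at this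
    simp only [Derivation.leibniz, smul_eq_mul, dt_zi, this]; ring
  refine cob_of hψ (fun _ => ()) (S.z p * S.z p) ((2:K)⁻¹ • LinearMap.mulLeft K
    (S.zi p * S.mon 0 (Pi.single (p + S.n) 1))) (fun _ => 0) ?_ ?_ ?_ ?_ ?_
  · intro x
    have : Wsp S.b (fun _ => ()) () = ⊤ := by simp [Wsp]
    rw [this]; trivial
  · intro x
    have : Wsp S.b (fun _ => ()) () = ⊤ := by simp [Wsp]
    rw [this]; trivial
  · intro u
    have hz := z_zi (S := S) g
    simp only [LinearMap.smul_apply, LinearMap.mulLeft_apply, hbr, Derivation.map_smul, mul_assoc, hdtz,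
      mul_smul_comm, smul_smul, mul_add, mul_inv_cancel₀ (two_ne_zero (α := K)),
      inv_mul_cancel₀ (two_ne_zero (α := K)), one_smul]
    linear_combination u * hz
  · intro x
    rw [b_eq]
    have : ∀ k, ∀ α i, S.M α i → i (p + S.n) = k →
        ∃ n, ((sh (S.brL (S.z p * S.z p)) 0) ^ n) (S.mon α i) = 0 := by
      intro k
      induction k with
      | zero =>
        intro α i hi hk
        apply ln_step
        rw [sh_apply, brL_apply, hbr, dt_mon _ hi, hk]
        convert ln_zero _ using 4
        simp
      | succ k ih =>
        intro α i hi hk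
        apply ln_step
        rw [sh_apply, brL_apply, hbr, dt_mon _ hi, mul_smul_comm, z_mul_G (hi.sub _) g, zero_smul,
          sub_zero, smul_smul]
        exact ln_smul _ _ (ih _ _ ((hi.sub _).addG g) (by simp [hk]))
    exact this _ _ _ (M_x x) rfl
  · intro u c hc hD
    have hD : S.dt (p + S.n) c = 0 := by
      rw [hbr] at hD
      have := (smul_eq_zero_iff_right (two_ne_zero (α := K))).1 hD
      have h3 := congrArg (fun v => S.zi p * v) this
      simp only [mul_zero] at h3
      rwa [← mul_assoc, mul_comm (S.zi p), z_zi g, one_mul] at h3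
    refine ker_dt (fun _ => ()) (p + S.n) _ hc hD fun x hx hi => ?_
    rw [b_eq]
    have hM := M_x x
    generalize x.1.1 = α at *
    generalize x.2.1 = i at *
    clear hx hc hD
    have hbrm : ∀ (β : ℕ → K) i, S.M β i → i (p + S.n) = 0 →
        S.br (S.z p * S.z p) (S.mon β i) = 0 := by
      intro β i hM hi
      rw [hbr, dt_mon _ hM, hi]; simp
    induction hk : i p using Nat.strong_induction_on generalizing i with
    | _ k ih =>
    by_contra hne'
    obtain ⟨a0, hw⟩ := ker_gen hT hψ h0 hE hM (hbrm _ _ hM hi) hne'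
    have hexc : ∀ q, 1 ≤ q → q ≤ S.n → q ≠ p → Exc S q α i := by
      intro q hq1 hq2 hq
      have hδ : ∀ r, r ≠ p → S.δ r (S.z p * S.z p) = 0 := by
        intro r hr
        rw [Derivation.leibniz, δ_z_ne h1 (by omega) hr]; simp
      have := quad_br h1 h2 hq hq1 hq2 (hδ q hq) (hδ (q + S.n) (by omega))
      refine KLh hψ hq1 hq2 (hn3 q hq1 hq2) this.1 this.2
        (fun β i => i (p + S.n) = 0) ?_ hbrm α i hM hi hne'
      intro α i β j _ h _ h' _
      rw [(h' (p + S.n) (by omega) (by omega)).2]; exact h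
    obtain ⟨N, hN⟩ := wt_exc' h1 h2 hexc
    simp only [aa, if_pos g, if_neg gb, hw, hi, Nat.cast_zero, add_zero] at hN
    have e := hψ.inv (S.z p * S.z p) (S.z p * S.z (p + S.n)) (S.mon α i)
    have e1 : S.br (S.z p * S.z p) (S.z p * S.z (p + S.n)) = (2:K) • (S.z p * S.z p) := by
      rw [br_zz h1 h2, Derivation.leibniz, δ_z_self (by omega) (by omega),
        δ_z_ne h1 (by omega) hne, two]; simp
    rw [hbrm _ _ hM hi, e1, br_zzb h1 h2, zδ_mon_G hM g, zδ_mon_nG (by omega) (by omega) hM gb, hi] at e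
    have e2 : (i p : K) * ψ (S.z p * S.z p) (S.mon α (i - Pi.single p 1)) = 0 := by
      by_cases hip : i p = 0
      · simp [hip]
      · rw [ih (k - 1) (by omega) (i - Pi.single p 1) (by simp [hi]) (hM.sub _) (by simp [hk]), mul_zero]
    simp only [map_sub, map_add, map_smul, LinearMap.smul_apply, smul_eq_mul, Nat.cast_zero, zero_mul,
      e2, map_zero, add_zero] at e
    have e' : ((2 * N + 6 : ℕ) : K) * ψ (S.z p * S.z p) (S.mon α i) = 0 := by
      push_cast
      have : α p = 2 * N + 4 := by linear_combination -hN
      rw [this] at e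
      linear_combination -e
    rcases mul_eq_zero.1 e' with h | h
    · rw [Nat.cast_eq_zero] at h; simp at h
    · exact hne' h
end

end CSetup
end CT

set_option linter.all false
namespace CT
namespace CSetup
variable {K R : Type*} [Field K] [CommRing R] [Algebra K R] [CharZero K]
variable {S : CSetup K R} {ψ : R →ₗ[K] R →ₗ[K] K}

/-- the remaining case -/
structure Flow (S : CSetup K R) : Prop where
  hT : ¬ S.T 0
  ty : ∀ p, 1 ≤ p → p ≤ S.n → (S.G p ∧ S.G (p + S.n) ∧ ¬ S.T p ∧ ¬ S.T (p + S.n)) ∨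
    (¬ S.G p ∧ ¬ S.G (p + S.n))

theorem Flow.nT (hF : Flow S) {q : ℕ} (h1 : 1 ≤ q) (h2 : q ≤ 2 * S.n) (g : S.G q) : ¬ S.T q := by
  by_cases h : q ≤ S.n
  · have := hF.ty q h1 h; tauto
  · have := hF.ty (q - S.n) (by omega) (by omega)
    rw [Nat.sub_add_cancel (by omega)] at this; tauto

theorem Flow.zδ (hF : Flow S) {q : ℕ} (h1 : 1 ≤ q) (h2 : q ≤ 2 * S.n) {α : ℕ → K} {i : ℕ → ℕ}
    (hM : S.M α i) : S.z q * S.δ q (S.mon α i) = S.aa α i q • S.mon α i := by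
  unfold aa
  split_ifs with g
  · rw [zδ_mon_G hM g, hM.2 _ (hF.nT h1 h2 g)]; simp
  · rw [zδ_mon_nG h1 h2 hM g]

theorem Flow.δz (hF : Flow S) {q : ℕ} (h1 : 1 ≤ q) (h2 : q ≤ 2 * S.n) {α : ℕ → K} {i : ℕ → ℕ}
    (hM : S.M α i) : S.δ q (S.z q * S.mon α i) = (S.aa α i q + 1) • S.mon α i := by
  rw [Derivation.leibniz, δ_z_self h1 h2, smul_eq_mul, hF.zδ h1 h2 hM]; simp [add_smul]

/-- bigraded pieces -/
def kap2 (S : CSetup K R) (x : S.Gm × {i : ℕ → ℕ // ∀ p, ¬ S.T p → i p = 0}) : K × K :=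
  (x.1.1 0, S.wt x.1.1 x.2.1)
def H (S : CSetup K R) (γ m : K) : Submodule K R := Wsp S.b S.kap2 (γ, m)

theorem mon_H {α : ℕ → K} {i : ℕ → ℕ} (h : S.M α i) : S.mon α i ∈ S.H (α 0) (S.wt α i) := by
  rw [mon_eq h]; exact b_mem_W S.b S.kap2 (⟨α, h.1⟩, ⟨i, h.2⟩)

theorem H_sub {γ m : K} {U : Submodule K R}
    (h : ∀ α i, S.M α i → α 0 = γ → S.wt α i = m → S.mon α i ∈ U) : ∀ u ∈ S.H γ m, u ∈ U :=
  W_ind S.b S.kap2 fun x hx => by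
    rw [b_eq]
    simp only [kap2, Prod.mk.injEq] at hx
    exact h _ _ (M_x x) hx.1 hx.2

theorem H_ind {γ m : K} (φ : R →ₗ[K] K)
    (h : ∀ α i, S.M α i → α 0 = γ → S.wt α i = m → φ (S.mon α i) = 0) : ∀ u ∈ S.H γ m, φ u = 0 :=
  H_sub (U := LinearMap.ker φ) h

theorem H_c {γ m γ' m' : K} {u : R} (h : u ∈ S.H γ m) (e : γ = γ') (e' : m = m') : u ∈ S.H γ' m' := by
  subst e e'; exact h

theorem H_mul {γ m γ' m' : K} {u v : R} (hu : u ∈ S.H γ m) (hv : v ∈ S.H γ' m') :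
    u * v ∈ S.H (γ + γ') (m + m') := by
  refine H_sub (U := (S.H (γ + γ') (m + m')).comap (LinearMap.mulRight K v)) (fun α i hM h1 h2 => ?_) u hu
  refine H_sub (U := (S.H (γ + γ') (m + m')).comap (LinearMap.mulLeft K (S.mon α i)))
    (fun β j hM' h1' h2' => ?_) v hv
  rw [Submodule.mem_comap, LinearMap.mulLeft_apply, mon_mul hM hM']
  refine H_c (mon_H (hM.add hM')) ?_ ?_
  · rw [Pi.add_apply, h1, h1']
  · rw [wt_add, h2, h2']

theorem H_E {γ m : K} {u : R} (hu : u ∈ S.H γ m) : S.E u = m • u := by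
  have := H_sub (U := LinearMap.ker ((S.E : R →ₗ[K] R) - m • LinearMap.id)) (fun α i hM h1 h2 => by
    rw [LinearMap.mem_ker]
    change S.E (S.mon α i) - m • S.mon α i = 0
    rw [E_mon hM, h2, sub_self]) u hu
  exact sub_eq_zero.1 (LinearMap.mem_ker.1 this)

theorem H_d0 (hT : ¬ S.T 0) {γ m : K} {u : R} (hu : u ∈ S.H γ m) : S.d 0 u = γ • u := by
  have := H_sub (U := LinearMap.ker ((S.d 0 : R →ₗ[K] R) - γ • LinearMap.id)) (fun α i hM h1 h2 => by
    rw [LinearMap.mem_ker]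
    change S.d 0 (S.mon α i) - γ • S.mon α i = 0
    rw [d0_mon hT hM, h1, sub_self]) u hu
  exact sub_eq_zero.1 (LinearMap.mem_ker.1 this)

theorem H_δ {γ m : K} {u : R} (hu : u ∈ S.H γ m) {q : ℕ} (h1 : 1 ≤ q) (h2 : q ≤ 2 * S.n) :
    S.δ q u ∈ S.H γ (m - 1) := by
  refine H_sub (U := (S.H γ (m - 1)).comap (S.δ q : R →ₗ[K] R)) (fun α i hM e1 e2 => ?_) u hu
  rw [Submodule.mem_comap]
  change S.δ q (S.mon α i) ∈ _
  by_cases g : S.G q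
  · rw [δ_mon_G hM g]
    have e0 : (α - Pi.single q 1 : ℕ → K) 0 = γ := by
      rw [Pi.sub_apply, Pi.single_eq_of_ne (by omega), e1, sub_zero]
    refine Submodule.add_mem _ (Submodule.smul_mem _ _ (H_c (mon_H (hM.subG g)) e0 ?_)) ?_
    · rw [wt_subG g, e2]
    · by_cases hi : i q = 0
      · rw [hi]; simp
      · refine (Submodule.smul_mem _ _ (H_c (mon_H ((hM.sub _).subG g)) e0 ?_))
        rw [wt_subG g, wt_subT g hi, e2]
  · rw [δ_mon_nG hM (by omega) g]
    by_cases hi : i q = 0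
    · rw [hi]; simp
    · refine (Submodule.smul_mem _ _ (H_c (mon_H (hM.sub _)) e1 ?_))
      rw [wt_subN h1 h2 g hi, e2]

theorem H_P {γ m γ' m' : K} {u v : R} (hu : u ∈ S.H γ m) (hv : v ∈ S.H γ' m') :
    S.P u v ∈ S.H (γ + γ') (m + m' - 2) := by
  rw [P]
  refine Submodule.sum_mem _ fun p hp => ?_
  rw [Finset.mem_Icc] at hp
  refine Submodule.sub_mem _ (H_c (H_mul (H_δ hu (by omega) (by omega)) (H_δ hv (by omega) (by omega)))
    rfl (by ring)) (H_c (H_mul (H_δ hu (by omega) (by omega)) (H_δ hv (by omega) (by omega)))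
    rfl (by ring))

theorem H_one : (1 : R) ∈ S.H 0 0 := by
  have := mon_H (S := S) M_one
  rwa [mon_one, wt_zero] at this

theorem H_Y (hT : ¬ S.T 0) (k : ℤ) : S.Y k ∈ S.H (k : K) 0 :=
  H_c (mon_H (M_Y hT k)) (by simp) (wt_Y k)

theorem H_z {q : ℕ} (h1 : 1 ≤ q) (h2 : q ≤ 2 * S.n) : S.z q ∈ S.H 0 1 := by
  by_cases g : S.G q
  · rw [z_G g]; refine H_c (mon_H (M_sG g)) ?_ (wt_sG g)
    rw [Pi.single_eq_of_ne (by omega)]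
  · rw [z_nG g]; exact H_c (mon_H (M_sT (GT h1 h2 g))) rfl (wt_sN h1 h2 g)

theorem H_br (hT : ¬ S.T 0) {γ m γ' m' : K} {u v : R} (hu : u ∈ S.H γ m) (hv : v ∈ S.H γ' m') :
    S.br u v = S.P u v + ((2 - m) * γ' - γ * (2 - m')) • (u * v) := by
  rw [br, H_d0 hT hu, H_d0 hT hv, H_E hu, H_E hv]
  simp only [Algebra.smul_def, map_sub, map_mul, map_ofNat]; ring

theorem H_brY (hT : ¬ S.T 0) (k : ℤ) {γ m : K} {u : R} (hu : u ∈ S.H γ m) :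
    S.br (S.Y k) u = (2 * γ + k * (m - 2)) • (S.Y k * u) := by
  rw [br_Y hT, H_d0 hT hu, H_E hu, ← mul_smul_comm]; congr 1; module

theorem Y_cancel (hT : ¬ S.T 0) (k l : ℤ) (h : k + l = 0) (u : R) : S.Y k * (S.Y l * u) = u := by
  rw [← mul_assoc, Y_add hT, h, Y_zero, one_mul]

theorem Y_Y (hT : ¬ S.T 0) (k l m : ℤ) (h : k + l = m) (u : R) :
    S.Y k * (S.Y l * u) = S.Y m * u := by
  rw [← mul_assoc, Y_add hT, h]

/-- bar -/
def bp (S : CSetup K R) (p : ℕ) : ℕ := if p ≤ S.n then p + S.n else p - S.n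
/-- sign -/
def sg (S : CSetup K R) (p : ℕ) : K := if p ≤ S.n then 1 else -1

theorem sg_ne (p : ℕ) : S.sg p ≠ 0 := by unfold sg; split_ifs <;> simp
theorem bp_r {p : ℕ} (h1 : 1 ≤ p) (h2 : p ≤ 2 * S.n) : 1 ≤ S.bp p ∧ S.bp p ≤ 2 * S.n ∧ S.bp p ≠ p := by
  unfold bp; have := S.hn; split_ifs <;> omega
theorem bp_bp {p : ℕ} (h1 : 1 ≤ p) (h2 : p ≤ 2 * S.n) : S.bp (S.bp p) = p := by
  unfold bp; have := S.hn; split_ifs <;> omega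
theorem bp_inj {p q : ℕ} (h1 : 1 ≤ p) (h2 : p ≤ 2 * S.n) (h3 : 1 ≤ q) (h4 : q ≤ 2 * S.n)
    (h : S.bp p = S.bp q) : p = q := by
  rw [← bp_bp h1 h2, h, bp_bp h3 h4]

theorem br_z {p : ℕ} (h1 : 1 ≤ p) (h2 : p ≤ 2 * S.n) (u : R) :
    S.br (S.z p) u = S.sg p • S.δ (S.bp p) u + S.z p * S.d 0 u := by
  unfold sg bp
  split_ifs with h
  · rw [br_z_lo h1 h, one_smul]
  · have := br_z_hi (S := S) (p := p - S.n) (by omega) (by omega) u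
    rw [Nat.sub_add_cancel (by omega)] at this
    rw [this]; simp

theorem H_brz (hT : ¬ S.T 0) {p : ℕ} (h1 : 1 ≤ p) (h2 : p ≤ 2 * S.n) {γ m : K} {u : R}
    (hu : u ∈ S.H γ m) :
    S.br (S.z p) u = S.sg p • S.δ (S.bp p) u + γ • (S.z p * u) := by
  rw [br_z h1 h2, H_d0 hT hu, mul_smul_comm]

theorem H_br1 (hT : ¬ S.T 0) {γ m : K} {u : R} (hu : u ∈ S.H γ m) :
    S.br 1 u = (2 * γ) • u := by
  rw [br_one, H_d0 hT hu]; simp only [Algebra.smul_def, map_mul, map_ofNat]; ring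

/-- radical -/
def Rad (ψ : R →ₗ[K] R →ₗ[K] K) (x : R) : Prop := ∀ v, ψ x v = 0

theorem Rad.inv (hψ : Coc S ψ) {x : R} (hx : Rad ψ x) (u v : R) :
    ψ (S.br x u) v + ψ u (S.br x v) = 0 := by
  rw [← hψ.inv, hx]

theorem Rad.invY (hψ : Coc S ψ) (hT : ¬ S.T 0) {k : ℤ} (hx : Rad ψ (S.Y k)) {γ m δ n : K} {u v : R}
    (hu : u ∈ S.H γ m) (hv : v ∈ S.H δ n) :
    (2 * γ + k * (m - 2)) * ψ (S.Y k * u) v + (2 * δ + k * (n - 2)) * ψ u (S.Y k * v) = 0 := by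
  have := hx.inv hψ u v
  rw [H_brY hT k hu, H_brY hT k hv] at this
  simpa using this

theorem Rad.ort (hψ : Coc S ψ) (hT : ¬ S.T 0) (hx : Rad ψ 1) {γ m δ n : K} {u v : R}
    (hu : u ∈ S.H γ m) (hv : v ∈ S.H δ n) (h : γ + δ ≠ 0) : ψ u v = 0 := by
  have := hx.inv hψ u v
  rw [H_br1 hT hu, H_br1 hT hv] at this
  simp only [map_smul, LinearMap.smul_apply, smul_eq_mul] at this
  have h' : 2 * (γ + δ) * ψ u v = 0 := by linear_combination this
  exact (mul_eq_zero.1 h').resolve_left (mul_ne_zero two_ne_zero h)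

theorem aa_ex {w : K} (hw : ∀ N : ℕ, w ≠ -(2 * (N : K))) (f : ℕ → K)
    (hf : ∑ p ∈ Finset.Icc 1 (2 * S.n), f p = w) : ∃ p, 1 ≤ p ∧ p ≤ 2 * S.n ∧ f p + 1 ≠ 0 := by
  by_contra hx
  push Not at hx
  apply hw S.n
  rw [← hf, Finset.sum_congr rfl (g := fun _ => (-1 : K)) fun p hp => by
    rw [Finset.mem_Icc] at hp; linear_combination hx p hp.1 hp.2]
  simp

theorem wt_aa (α : ℕ → K) (i : ℕ → ℕ) :
    ∑ p ∈ Finset.Icc 1 (2 * S.n), S.aa α i p = S.wt α i := by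
  rw [wt]; refine Finset.sum_congr rfl fun p _ => ?_
  unfold aa; split_ifs <;> rfl

theorem nat_ne (k : ℕ) (hk : 0 < k) (N : ℕ) : (k : K) ≠ -(2 * (N : K)) := by
  intro h
  have : ((k + 2 * N : ℕ) : K) = 0 := by push_cast; rw [h]; ring
  rw [Nat.cast_eq_zero] at this; omega

/-- every monomial of positive integral weight is a derivative -/
theorem mon_ex (k : ℕ) (hk : 0 < k) {α : ℕ → K} {i : ℕ → ℕ} (hw : S.wt α i = k) :
    ∃ p, 1 ≤ p ∧ p ≤ 2 * S.n ∧ S.aa α i p + 1 ≠ 0 :=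
  aa_ex (S := S) (nat_ne k hk) _ ((wt_aa α i).trans hw)

end CSetup
end CT

set_option linter.all false
namespace CT
namespace CSetup
variable {K R : Type*} [Field K] [CommRing R] [Algebra K R] [CharZero K]
variable {S : CSetup K R} {ψ : R →ₗ[K] R →ₗ[K] K}

/-- normalized cocycles -/
structure Nrm (S : CSetup K R) (ψ : R →ₗ[K] R →ₗ[K] K) : Prop where
  coc : Coc S ψ
  f1 : ∀ α i, S.M α i → α 0 ≠ 0 → ψ 1 (S.mon α i) = 0
  f2 : ∀ α i, S.M α i → α 0 = 0 → S.wt α i ≠ 4 → ψ (S.Y 1) (S.Y (-1) * S.mon α i) = 0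
  f3 : ∀ α i, S.M α i → α 0 = 0 → S.wt α i = 4 → ∃ p, 1 ≤ p ∧ p ≤ 2 * S.n ∧
    S.aa α i (S.bp p) + 1 ≠ 0 ∧ ψ (S.z p) (S.z (S.bp p) * S.mon α i) = 0

/-- the bracket giving a monomial back -/
theorem Flow.brzz (hF : Flow S) {p : ℕ} (h1 : 1 ≤ p) (h2 : p ≤ 2 * S.n) {α : ℕ → K} {i : ℕ → ℕ}
    (hM : S.M α i) (a0 : α 0 = 0) :
    S.br (S.z p) (S.z (S.bp p) * S.mon α i) = (S.sg p * (S.aa α i (S.bp p) + 1)) • S.mon α i := by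
  have hb := bp_r (S := S) h1 h2
  rw [H_brz hF.hT h1 h2 (H_mul (H_z hb.1 hb.2.1) (mon_H hM)), hF.δz hb.1 hb.2.1 hM, a0]
  simp [smul_smul]

theorem H_brYY (hT : ¬ S.T 0) (k : ℤ) {m : K} {c : R} (hc : c ∈ S.H 0 m) :
    S.br (S.Y k) (S.Y (-k) * c) = (k * (m - 4)) • c := by
  rw [H_brY hT k (H_mul (H_Y hT (-k)) hc), Y_cancel hT k (-k) (by ring)]
  congr 1; push_cast; ring

theorem Flow.ex4 (hF : Flow S) {α : ℕ → K} {i : ℕ → ℕ} (hw : S.wt α i = 4) :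
    ∃ p, 1 ≤ p ∧ p ≤ 2 * S.n ∧ S.aa α i (S.bp p) + 1 ≠ 0 := by
  obtain ⟨r, h1, h2, h⟩ := mon_ex (S := S) 4 (by norm_num) (by rw [hw]; norm_num)
  have hb := bp_r (S := S) h1 h2
  exact ⟨S.bp r, hb.1, hb.2.1, by rwa [bp_bp h1 h2]⟩

theorem Flow.normalize (hF : Flow S) (hψ : Coc S ψ) :
    ∃ f : R →ₗ[K] K, Nrm S (ψ - S.brL.compr₂ f) := by
  classical
  set g : (ℕ → K) → (ℕ → ℕ) → K := fun α i =>
    if α 0 ≠ 0 then ψ 1 (S.mon α i) / (2 * α 0)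
    else if S.wt α i ≠ 4 then ψ (S.Y 1) (S.Y (-1) * S.mon α i) / (S.wt α i - 4)
    else if h : ∃ p, 1 ≤ p ∧ p ≤ 2 * S.n ∧ S.aa α i (S.bp p) + 1 ≠ 0 then
      ψ (S.z h.choose) (S.z (S.bp h.choose) * S.mon α i) /
        (S.sg h.choose * (S.aa α i (S.bp h.choose) + 1)) else 0 with hg
  set f : R →ₗ[K] K := S.b.constr K fun x => g x.1.1 x.2.1 with hf
  have fm : ∀ α i, S.M α i → f (S.mon α i) = g α i := by
    intro α i hM
    rw [mon_eq hM, hf, Module.Basis.constr_basis]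
  refine ⟨f, hψ.sub f, ?_, ?_, ?_⟩
  · intro α i hM a0
    rw [LinearMap.sub_apply, LinearMap.sub_apply, LinearMap.compr₂_apply, brL_apply,
      H_br1 hF.hT (mon_H hM), map_smul, fm _ _ hM, hg]
    simp only [if_pos a0, smul_eq_mul]
    field_simp; ring
  · intro α i hM a0 hw
    rw [LinearMap.sub_apply, LinearMap.sub_apply, LinearMap.compr₂_apply, brL_apply,
      H_brYY hF.hT 1 (H_c (mon_H hM) a0 rfl), map_smul, fm _ _ hM, hg]
    simp only [a0, ne_eq, not_true_eq_false, if_false, hw, not_false_eq_true, if_true, smul_eq_mul]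
    have := sub_ne_zero.2 hw
    field_simp; push_cast; ring
  · intro α i hM a0 hw
    have h := hF.ex4 hw
    refine ⟨h.choose, h.choose_spec.1, h.choose_spec.2.1, h.choose_spec.2.2, ?_⟩
    rw [LinearMap.sub_apply, LinearMap.sub_apply, LinearMap.compr₂_apply, brL_apply,
      hF.brzz h.choose_spec.1 h.choose_spec.2.1 hM a0, map_smul, fm _ _ hM, hg]
    simp only [a0, ne_eq, not_true_eq_false, if_false, hw, dif_pos h, smul_eq_mul]
    have h1 := h.choose_spec.2.2
    have h2 := sg_ne (S := S) h.choose
    field_simp; ring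

theorem rad_of {x : R} (h : ∀ α i, S.M α i → ψ x (S.mon α i) = 0) : Rad ψ x := fun v => by
  have : ψ x = 0 := lin_ext (S := S) (by simpa using h)
  rw [this]; rfl

/-- step 1 -/
theorem Nrm.rad1 (hF : Flow S) (h : Nrm S ψ) : Rad ψ 1 := by
  refine rad_of (S := S) fun α i hM => ?_
  by_cases a0 : α 0 = 0
  swap
  · exact h.f1 _ _ hM a0
  have hT := hF.hT
  by_cases hw : S.wt α i = 4
  · obtain ⟨p, h1, h2, hp, -⟩ := h.f3 _ _ hM a0 hw
    have hb := bp_r (S := S) h1 h2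
    have e := h.coc.inv 1 (S.z p) (S.z (S.bp p) * S.mon α i)
    rw [hF.brzz h1 h2 hM a0, H_br1 hT (H_z h1 h2), H_br1 hT (H_mul (H_z hb.1 hb.2.1) (mon_H hM)),
      a0] at e
    simp only [map_smul, smul_eq_mul, mul_zero, zero_smul, map_zero, add_zero,
      LinearMap.zero_apply] at e
    exact (mul_eq_zero.1 e).resolve_left (mul_ne_zero (sg_ne p) hp)
  · have hH := H_c (mon_H hM) a0 rfl
    have e := h.coc.inv 1 (S.Y 1) (S.Y (-1) * S.mon α i)
    rw [H_brYY hT 1 hH, H_br1 hT (H_Y hT 1), H_br1 hT (H_mul (H_Y hT (-1)) hH)] at e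
    simp only [map_smul, smul_eq_mul, LinearMap.smul_apply, h.f2 _ _ hM a0 hw] at e
    have e' : (S.wt α i - 4) * ψ 1 (S.mon α i) = 0 := by push_cast at e; linear_combination e
    exact (mul_eq_zero.1 e').resolve_left (sub_ne_zero.2 hw)

theorem H_br_quad (hT : ¬ S.T 0) {a : R} (ha : a ∈ S.H 0 2) (u : R) : S.br a u = S.P a u := by
  refine br_quad ?_ ?_ u
  · rw [H_d0 hT ha, zero_smul]
  · rw [H_E ha, Algebra.smul_def, map_ofNat]

theorem phi_quad (hT : ¬ S.T 0) (h : Coc S ψ) (k : ℤ) {a c : R} {m : K} (ha : a ∈ S.H 0 2)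
    (hc : c ∈ S.H 0 m) :
    ψ (S.Y k) (S.Y (-k) * S.br a c) = k * (m - 4) * ψ a c := by
  have e := h.inv (S.Y k) a (S.Y (-k) * c)
  rw [H_brYY hT k hc, H_brY hT k ha, H_br_quad hT ha, P_mul, P_Y hT, zero_mul, zero_add,
    ← H_br_quad hT ha] at e
  rw [e]; simp

theorem H_zz {p q : ℕ} (h1 : 1 ≤ p) (h2 : p ≤ 2 * S.n) (h3 : 1 ≤ q) (h4 : q ≤ 2 * S.n) :
    S.z p * S.z q ∈ S.H 0 2 := H_c (H_mul (H_z h1 h2) (H_z h3 h4)) (by ring) (by norm_num)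

theorem Flow.n3 (hF : Flow S) (q : ℕ) (h1 : 1 ≤ q) (h2 : q ≤ S.n) :
    ¬ (S.G q ∧ S.T q ∧ S.G (q + S.n)) := by
  have := hF.ty q h1 h2; tauto

/-- exceptional or zero -/
theorem phi_exc (hF : Flow S) (h : Coc S ψ) (k : ℤ) {α : ℕ → K} {i : ℕ → ℕ} (hM : S.M α i)
    (a0 : α 0 = 0) (hz : ∀ a ∈ S.H 0 2, ∀ c ∈ S.H 0 (S.wt α i), (S.wt α i - 4) * ψ a c = 0)
    (hne : ψ (S.Y k) (S.Y (-k) * S.mon α i) ≠ 0) :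
    ∀ q, 1 ≤ q → q ≤ S.n → Exc S q α i := by
  intro q h1 h2
  by_contra hx
  refine hne (KL h1 h2 (hF.n3 q h1 h2) (ψ (S.Y k) ∘ₗ LinearMap.mulLeft K (S.Y (-k)))
    (fun β j => β 0 = 0 ∧ S.wt β j = S.wt α i) ?_ ?_ ?_ α i hM ⟨a0, rfl⟩ hx)
  · intro β j β' j' _ hP _ hr hw
    exact ⟨by rw [(hr 0 (by omega) (by omega)).1, hP.1], by rw [hw, hP.2]⟩
  · intro β j hM' hP
    have ha := H_zz (S := S) h1 (show q ≤ 2 * S.n by omega) h1 (show q ≤ 2 * S.n by omega)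
    have hc := H_c (mon_H hM') hP.1 hP.2
    rw [LinearMap.comp_apply, LinearMap.mulLeft_apply, phi_quad hF.hT h k ha hc, mul_assoc,
      hz _ ha _ hc, mul_zero]
  · intro β j hM' hP
    have ha := H_zz (S := S) h1 (show q ≤ 2 * S.n by omega) (show 1 ≤ q + S.n by omega)
      (show q + S.n ≤ 2 * S.n by omega)
    have hc := H_c (mon_H hM') hP.1 hP.2
    rw [LinearMap.comp_apply, LinearMap.mulLeft_apply, phi_quad hF.hT h k ha hc, mul_assoc,
      hz _ ha _ hc, mul_zero]

/-- reduction of radical property of `Y k` to the charge zero part -/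
theorem radY_of (hF : Flow S) (h : Nrm S ψ) (k : ℤ)
    (h' : ∀ α i, S.M α i → α 0 = 0 → ψ (S.Y k) (S.Y (-k) * S.mon α i) = 0) : Rad ψ (S.Y k) := by
  have hT := hF.hT
  refine rad_of (S := S) fun α i hM => ?_
  by_cases a0 : (k : K) + α 0 = 0
  · have hM' : S.M (α + Pi.single 0 (k : K)) i := by
      have := hM.add (M_Y hT k); rwa [add_zero] at this
    have := h' _ _ hM' (by simp; linear_combination a0)
    rwa [← Y_mul hT k hM, Y_cancel hT _ _ (by ring)] at this
  · exact (h.rad1 hF).ort h.coc hT (H_Y hT k) (mon_H hM) a0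

theorem Nrm.radY1 (hF : Flow S) (h : Nrm S ψ) : Rad ψ (S.Y 1) := by
  refine radY_of hF h 1 fun α i hM a0 => ?_
  by_cases hw : S.wt α i = 4
  · by_contra hne
    refine wt_ne_four (phi_exc hF h.coc 1 hM a0 (fun a _ c _ => ?_) hne) hw
    rw [hw, sub_self, zero_mul]
  · exact h.f2 _ _ hM a0 hw

theorem Nrm.quad (hF : Flow S) (h : Nrm S ψ) {a c : R} {m : K} (ha : a ∈ S.H 0 2)
    (hc : c ∈ S.H 0 m) : (m - 4) * ψ a c = 0 := by
  have := phi_quad hF.hT h.coc 1 ha hc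
  rw [h.radY1 hF] at this
  push_cast at this; linear_combination -this

/-- exceptional or zero -/
theorem Nrm.phi (hF : Flow S) (h : Nrm S ψ) (k : ℤ) {α : ℕ → K} {i : ℕ → ℕ} (hM : S.M α i)
    (a0 : α 0 = 0) (hne : ψ (S.Y k) (S.Y (-k) * S.mon α i) ≠ 0) :
    ∀ q, 1 ≤ q → q ≤ S.n → Exc S q α i :=
  phi_exc hF h.coc k hM a0 (fun a ha c hc => h.quad hF ha hc) hne

theorem Nrm.radYm (hF : Flow S) (h : Nrm S ψ) : Rad ψ (S.Y (-1)) := by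
  refine radY_of hF h (-1) fun α i hM a0 => ?_
  by_contra hne
  obtain ⟨N, hN⟩ := wt_exc (h.phi hF (-1) hM a0 hne)
  have e := (h.radY1 hF).invY h.coc hF.hT (H_Y hF.hT (-1)) (mon_H hM)
  rw [Y_add hF.hT, show (1 : ℤ) + -1 = 0 by norm_num, Y_zero, h.rad1 hF, a0, mul_zero, zero_add] at e
  rw [neg_neg] at hne
  have := (mul_eq_zero.1 e).resolve_right hne
  rw [hN] at this
  have h2 : ((2 + 2 * N : ℕ) : K) = 0 := by push_cast at this ⊢; linear_combination -this
  rw [Nat.cast_eq_zero] at h2; omega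

/-- Casimir relation from `Y 1`, `Y (-1)`. -/
theorem Nrm.CR (hF : Flow S) (h : Nrm S ψ) {γ γ' m n : K} {u w : R} (hu : u ∈ S.H γ m)
    (hw : w ∈ S.H γ' n) (e : γ + γ' = 0) : (m - n) * (6 - m - n) * ψ u w = 0 := by
  have hT := hF.hT
  obtain rfl : γ' = -γ := by linear_combination e
  have a := (h.radY1 hF).invY h.coc hT (H_mul (H_Y hT (-1)) hu) hw
  have b := (h.radYm hF).invY h.coc hT hu (H_mul (H_Y hT 1) hw)
  rw [Y_cancel hT 1 (-1) (by norm_num)] at a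
  rw [Y_cancel hT (-1) 1 (by norm_num)] at b
  push_cast at a b
  linear_combination (2 * γ - (m-2)) * a - (-2*γ + n - 2) * b
end CSetup
end CT

set_option linter.all false
namespace CT
namespace CSetup
variable {K R : Type*} [Field K] [CommRing R] [Algebra K R] [CharZero K]
variable {S : CSetup K R} {ψ : R →ₗ[K] R →ₗ[K] K}

theorem δzz (hF : Flow S) {p q : ℕ} (h1 : 1 ≤ p) (h2 : p ≤ 2 * S.n) (h3 : 1 ≤ q) (h4 : q ≤ 2 * S.n)
    (hpq : p ≠ q) {α : ℕ → K} {i : ℕ → ℕ} (hM : S.M α i) :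
    S.δ p (S.z p * (S.z q * S.mon α i)) = (S.aa α i p + 1) • (S.z q * S.mon α i) := by
  rw [Derivation.leibniz, Derivation.leibniz, δ_z_self h1 h2, δ_z_ne h3 h4 hpq]
  simp only [smul_eq_mul, mul_zero, add_zero, mul_one]
  rw [mul_left_comm, hF.zδ h1 h2 hM, mul_smul_comm]; module

/-- step 5a -/
theorem Nrm.w4 (hF : Flow S) (h : Nrm S ψ) {α : ℕ → K} {i : ℕ → ℕ} (hM : S.M α i) (a0 : α 0 = 0)
    (hw : S.wt α i = 4) {p : ℕ} (h1 : 1 ≤ p) (h2 : p ≤ 2 * S.n) :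
    ψ (S.z p) (S.z (S.bp p) * S.mon α i) = 0 := by
  have hT := hF.hT
  obtain ⟨q, h3, h4, hq, hz⟩ := h.f3 _ _ hM a0 hw
  by_cases hpq : p = q
  · subst hpq; exact hz
  have hb := bp_r (S := S) h1 h2
  have hb' := bp_r (S := S) h3 h4
  have hne : S.bp p ≠ S.bp q := fun e => hpq (bp_inj h1 h2 h3 h4 e)
  have hH := H_mul (H_z (S := S) hb.1 hb.2.1) (H_mul (H_z (S := S) hb'.1 hb'.2.1) (H_c (mon_H hM) a0 rfl))
  have e := h.coc.inv (S.z q) (S.z p) (S.z (S.bp p) * (S.z (S.bp q) * S.mon α i))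
  have e1 : ψ (S.br (S.z q) (S.z p)) (S.z (S.bp p) * (S.z (S.bp q) * S.mon α i)) = 0 := by
    rw [H_brz hT h3 h4 (H_z h1 h2)]
    by_cases hx : S.bp q = p
    · rw [hx, δ_z_self h1 h2, zero_smul, add_zero, map_smul, LinearMap.smul_apply, h.rad1 hF, smul_zero]
    · rw [δ_z_ne h1 h2 hx]; simp
  rw [e1, H_brz hT h1 h2 hH, H_brz hT h3 h4 hH, δzz hF hb.1 hb.2.1 hb'.1 hb'.2.1 hne hM,
    mul_left_comm (S.z (S.bp p)) (S.z (S.bp q)), δzz hF hb'.1 hb'.2.1 hb.1 hb.2.1 hne.symm hM] at e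
  simp only [zero_add, add_zero, zero_smul, map_smul, smul_eq_mul, hz, mul_zero] at e
  exact (mul_eq_zero.1 ((mul_eq_zero.1 e.symm).resolve_left (sg_ne q))).resolve_left hq

theorem br_h {p : ℕ} (h1 : 1 ≤ p) (h2 : p ≤ 2 * S.n) (u : R) :
    S.br (S.z p * S.z (S.bp p)) u =
      S.sg p • (S.z (S.bp p) * S.δ (S.bp p) u - S.z p * S.δ p u) := by
  unfold sg bp
  split_ifs with h
  · rw [br_zzb h1 h, one_smul]
  · have := br_zzb (S := S) (p := p - S.n) (by omega) (by omega) u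
    rw [Nat.sub_add_cancel (by omega)] at this
    rw [mul_comm, this]; simp

theorem Flow.nGb (hF : Flow S) {p : ℕ} (h1 : 1 ≤ p) (h2 : p ≤ 2 * S.n) (g : ¬ S.G (S.bp p)) :
    ¬ S.G p := by
  unfold bp at g
  split_ifs at g with h
  · have := hF.ty p h1 h; tauto
  · have := hF.ty (p - S.n) (by omega) (by omega)
    rw [Nat.sub_add_cancel (by omega)] at this; tauto

/-- step 5b -/
theorem Nrm.w5 (hF : Flow S) (h : Nrm S ψ) {b : R} (hb5 : b ∈ S.H 0 5) {p : ℕ} (h1 : 1 ≤ p)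
    (h2 : p ≤ 2 * S.n) : ψ (S.z p) b = 0 := by
  have hT := hF.hT
  have hb := bp_r (S := S) h1 h2
  refine H_ind (ψ (S.z p)) (fun α i hM a0 hw => ?_) b hb5
  by_cases g : S.G (S.bp p)
  · have := h.w4 hF (hM.subG g) (by rw [Pi.sub_apply, Pi.single_eq_of_ne (by omega), a0, sub_zero])
      (by rw [wt_subG g, hw]; norm_num) h1 h2
    rwa [z_mul_G (hM.subG g) g, sub_add_cancel] at this
  by_cases hi : i (S.bp p) = 0
  · have gp := hF.nGb h1 h2 g
    have e := h.coc.inv (S.z p * S.z (S.bp p)) (S.z p) (S.mon α i)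
    have e0 : S.δ (S.bp p) (S.mon α i) = 0 := by
      rw [δ_mon_nG hM (by omega) g, hi]; simp
    rw [br_h h1 h2, br_h h1 h2, H_brz hT h1 h2 (H_c (mon_H hM) a0 rfl), e0,
      hF.zδ h1 h2 hM, δ_z_self h1 h2, δ_z_ne h1 h2 hb.2.2] at e
    simp only [smul_zero, zero_smul, add_zero, map_zero, mul_zero, mul_one, zero_sub, map_smul, map_neg,
      LinearMap.smul_apply, LinearMap.neg_apply, smul_eq_mul] at e
    have ea : S.aa α i p = (i p : K) := by simp [aa, gp]
    rw [ea] at e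
    have e' : S.sg p * (((i p + 1 : ℕ) : K) * ψ (S.z p) (S.mon α i)) = 0 := by
      push_cast; linear_combination e
    exact (mul_eq_zero.1 ((mul_eq_zero.1 e').resolve_left (sg_ne p))).resolve_left
      (Nat.cast_ne_zero.2 (by omega))
  · have := h.w4 hF (hM.sub (Pi.single (S.bp p) 1)) a0
      (by rw [wt_subN hb.1 hb.2.1 g hi, hw]; norm_num) h1 h2
    rwa [z_mul_nG (hM.sub _) g (GT hb.1 hb.2.1 g), raise_lower hi] at this

theorem Nrm.z0 (hF : Flow S) (h : Nrm S ψ) {b : R} {m : K} (hb : b ∈ S.H 0 m) (hm : m ≠ 1) {p : ℕ}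
    (h1 : 1 ≤ p) (h2 : p ≤ 2 * S.n) : ψ (S.z p) b = 0 := by
  by_cases h5 : m = 5
  · subst h5; exact h.w5 hF hb h1 h2
  · have e := h.CR hF (H_z h1 h2) hb (by ring)
    refine (mul_eq_zero.1 e).resolve_left (mul_ne_zero (sub_ne_zero.2 hm.symm) ?_)
    intro h'; apply h5; linear_combination -h'

theorem Nrm.shift (hF : Flow S) (h : Nrm S ψ) {a b : R} {m n : K} (ha : a ∈ S.H 0 m)
    (hb : b ∈ S.H 0 n) :
    (m - 2) * ψ (S.Y 1 * a) (S.Y (-1) * b) + (n - 4) * ψ a b = 0 := by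
  have hT := hF.hT
  have e := (h.radY1 hF).invY h.coc hT ha (H_mul (H_Y hT (-1)) hb)
  rw [Y_cancel hT 1 (-1) (by norm_num)] at e
  push_cast at e; linear_combination e

theorem Nrm.shift' (hF : Flow S) (h : Nrm S ψ) {a b : R} {m n : K} (ha : a ∈ S.H 0 m)
    (hb : b ∈ S.H 0 n) :
    (m - 2) * ψ (S.Y (-1) * a) (S.Y 1 * b) + (n - 4) * ψ a b = 0 := by
  have hT := hF.hT
  have e := (h.radYm hF).invY h.coc hT ha (H_mul (H_Y hT 1) hb)
  rw [Y_cancel hT (-1) 1 (by norm_num)] at e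
  push_cast at e; linear_combination -e

/-- test monomials -/
def qq (S : CSetup K R) (k : ℤ) (a b : ℕ) : R := S.Y k * (S.z 1 ^ a * S.z (1 + S.n) ^ b)

theorem le1 : 1 ≤ S.n := S.hn
theorem lt2 : (1 : ℕ) ≤ 2 * S.n := by have := S.hn; omega
theorem lt2' : 1 + S.n ≤ 2 * S.n := by have := S.hn; omega

theorem H_pow {γ m : K} {u : R} (hu : u ∈ S.H 0 m) (a : ℕ) : u ^ a ∈ S.H 0 (a * m) := by
  induction a with
  | zero => simpa using H_one (S := S)
  | succ a ih => rw [pow_succ]; exact H_c (H_mul ih hu) (by ring) (by push_cast; ring)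

theorem H_qq (hT : ¬ S.T 0) (k : ℤ) (a b : ℕ) : S.qq k a b ∈ S.H (k : K) (a + b) :=
  H_c (H_mul (H_Y hT k) (H_mul (H_pow (γ := (0 : K)) (H_z (S := S) le_rfl lt2) a)
    (H_pow (γ := (0 : K)) (H_z (S := S) (by omega) lt2') b))) (by ring) (by ring)

theorem br_t (hT : ¬ S.T 0) (k : ℤ) (a b : ℕ) :
    S.br (S.z 1) (S.qq k a b) = (b : K) • S.qq k a (b - 1) + (k : K) • S.qq k (a + 1) b := by
  rw [br_z_lo le_rfl le1, H_d0 hT (H_qq hT k a b)]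
  have e1 := δ_Y hT k (q := 1 + S.n) (by omega)
  have e2 := δ_z_ne (S := S) le_rfl lt2 (p := 1 + S.n) (by have := S.hn; omega)
  have e3 := δ_z_self (S := S) (q := 1 + S.n) (by omega) lt2'
  unfold qq
  rw [Derivation.leibniz, Derivation.leibniz, Derivation.leibniz_pow, Derivation.leibniz_pow, e1, e2, e3]
  simp only [smul_zero, add_zero, smul_eq_mul, mul_one, nsmul_eq_mul]
  simp only [Algebra.smul_def, map_natCast, map_intCast, pow_succ]
  ring

theorem br_s (hT : ¬ S.T 0) (k : ℤ) (a b : ℕ) :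
    S.br (S.z (1 + S.n)) (S.qq k a b) =
      -((a : K) • S.qq k (a - 1) b) + (k : K) • S.qq k a (b + 1) := by
  rw [br_z_hi le_rfl le1, H_d0 hT (H_qq hT k a b)]
  have e1 := δ_Y hT k (q := 1) (by omega)
  have e2 := δ_z_ne (S := S) (q := 1 + S.n) (by omega) lt2' (p := 1) (by have := S.hn; omega)
  have e3 := δ_z_self (S := S) (q := 1) le_rfl lt2
  unfold qq
  rw [Derivation.leibniz, Derivation.leibniz, Derivation.leibniz_pow, Derivation.leibniz_pow, e1, e2, e3]
  simp only [smul_zero, add_zero, smul_eq_mul, mul_one, nsmul_eq_mul]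
  simp only [Algebra.smul_def, map_natCast, map_intCast, pow_succ]
  ring

theorem qq_t : S.qq 0 1 0 = S.z 1 := by simp [qq, Y_zero]
theorem qq_s : S.qq 0 0 1 = S.z (1 + S.n) := by simp [qq, Y_zero]
theorem qq_Y (hT : ¬ S.T 0) (k l j : ℤ) (a b : ℕ) (h : k + l = j) :
    S.Y k * S.qq l a b = S.qq j a b := by
  rw [qq, Y_Y hT k l j h]; rfl

/-- invariance under linear functions away from bad weights -/
theorem Nrm.zi0 (hF : Flow S) (h : Nrm S ψ) {u v : R} {γ γ' m n : K} (hu : u ∈ S.H γ m)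
    (hv : v ∈ S.H γ' n) (e : γ + γ' = 0) (h1 : m + n ≠ 1) (h3 : m + n ≠ 3) {p : ℕ} (hp1 : 1 ≤ p)
    (hp2 : p ≤ 2 * S.n) : ψ (S.br (S.z p) u) v + ψ u (S.br (S.z p) v) = 0 := by
  rw [← h.coc.inv, H_br hF.hT hu hv, map_add, map_smul,
    h.z0 hF (H_c (H_P hu hv) e rfl) (fun h' => h3 (by linear_combination h')) hp1 hp2,
    h.z0 hF (H_c (H_mul hu hv) e rfl) h1 hp1 hp2]
  simp

theorem Nrm.E2 (hF : Flow S) (h : Nrm S ψ) : ψ (S.Y 2) (S.Y (-2)) = 0 := by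
  have hT := hF.hT
  have HQ : ∀ (k : ℤ) (a b : ℕ), S.qq k a b ∈ S.H (k : K) (a + b) := fun k a b => H_qq hT k a b
  have HQ0 : ∀ (a b : ℕ), S.qq 0 a b ∈ S.H (0 : K) (a + b) := fun a b => H_c (H_qq hT 0 a b) (by simp) rfl
  have It := fun (k l : ℤ) (a b c d : ℕ) (e : k + l = 0) (e1 : a + b + c + d ≠ 1)
    (e3 : a + b + c + d ≠ 3) =>
    h.zi0 hF (HQ k a b) (HQ l c d) (by exact_mod_cast e)
    (fun h => e1 (by have : ((a + b + c + d : ℕ) : K) = ((1 : ℕ) : K) := by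
                      push_cast; linear_combination h
                     exact_mod_cast this))
    (fun h => e3 (by have : ((a + b + c + d : ℕ) : K) = ((3 : ℕ) : K) := by
                      push_cast; linear_combination h
                     exact_mod_cast this)) (le_refl 1) lt2
  have zs : ∀ m b, b ∈ S.H (0 : K) m → m ≠ 1 → ψ b (S.qq 0 0 1) = 0 := fun m b hb hm => by
    rw [h.coc.skew, qq_s, h.z0 hF hb hm (by omega) lt2', neg_zero]
  -- total weight 7
  have A1 : ψ (S.qq 0 3 1) (S.qq 0 0 2) = 0 := by
    have e := It 0 0 3 2 0 2 (by norm_num) (by norm_num) (by norm_num)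
    rw [br_t hT, br_t hT] at e
    norm_num at e
    rw [zs _ _ (HQ0 3 2) (by norm_num)] at e
    simpa using e
  have A2 : ψ (S.qq 0 2 2) (S.qq 0 1 1) = 0 := by
    have e := It 0 0 2 3 1 1 (by norm_num) (by norm_num) (by norm_num)
    rw [br_t hT, br_t hT] at e
    norm_num at e
    rw [h.coc.skew (S.qq 0 2 3), qq_t, h.z0 hF (HQ0 2 3) (by norm_num) le_rfl lt2] at e
    simpa using e
  have A3 : ψ (S.qq 0 2 1) (S.qq 0 1 2) = 0 := by
    have e := It 0 0 2 2 1 2 (by norm_num) (by norm_num) (by norm_num)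
    rw [br_t hT, br_t hT] at e
    norm_num at e
    rw [A2] at e
    simpa using e
  have B1 : ψ (S.qq 1 3 1) (S.qq (-1) 0 2) = 0 := by
    have e := h.shift hF (HQ0 3 1) (HQ0 0 2)
    rw [A1, qq_Y hT 1 0 1 3 1 (by norm_num), qq_Y hT (-1) 0 (-1) 0 2 (by norm_num)] at e
    norm_num at e; exact e
  have B3 : ψ (S.qq 1 2 1) (S.qq (-1) 1 2) = 0 := by
    have e := h.shift hF (HQ0 2 1) (HQ0 1 2)
    rw [A3, qq_Y hT 1 0 1 _ _ (by norm_num), qq_Y hT (-1) 0 (-1) _ _ (by norm_num)] at e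
    norm_num at e; exact e
  have C : ψ (S.qq 1 2 1) (S.qq (-1) 0 1) = 0 := by
    have e := h.CR hF (HQ 1 2 1) (HQ (-1) 0 1) (by norm_num)
    norm_num at e; exact e
  have Ω : ψ (S.qq 1 2 0) (S.qq (-1) 0 2) = 0 := by
    have e := It 1 (-1) 2 1 0 2 (by norm_num) (by norm_num) (by norm_num)
    rw [br_t hT, br_t hT] at e
    norm_num at e
    rw [B1, B3, C] at e
    simpa using e
  have P1 := h.shift hF (HQ0 1 0) (HQ0 0 1)
  have P2 := h.shift' hF (HQ0 1 0) (HQ0 0 1)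
  rw [qq_Y hT 1 0 1 _ _ (by norm_num), qq_Y hT (-1) 0 (-1) _ _ (by norm_num)] at P1
  rw [qq_Y hT 1 0 1 _ _ (by norm_num), qq_Y hT (-1) 0 (-1) _ _ (by norm_num)] at P2
  norm_num at P1 P2
  have brs : ∀ k a b, S.P (S.qq k a b) (S.z (1 + S.n)) = (a : K) • S.qq k (a - 1) b := by
    intro k a b
    have e := br_s hT k a b
    rw [H_br hT (H_z (by omega) lt2') (HQ k a b), P_skew] at e
    have e4 : S.z (1 + S.n) * S.qq k a b = S.qq k a (b + 1) := by
      unfold qq; rw [pow_succ]; ring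
    rw [e4] at e
    have e5 : ((2 - 1) * (k : K) - 0 * (2 - (a + b))) = k := by ring
    rw [e5] at e
    have := add_right_cancel e
    exact neg_injective this
  have Q : ∀ k l a b, S.P (S.qq k a b) (S.qq l 0 1) = (a : K) • (S.Y l * S.qq k (a - 1) b) := by
    intro k l a b
    have : S.qq l 0 1 = S.Y l * S.z (1 + S.n) := by simp [qq]
    rw [this, P_mul, P_Y hT, brs]; simp
  have F : ψ (S.qq 0 1 0) (S.qq 0 0 1) = 0 := by
    have e := h.coc.inv (S.z (1 + S.n)) (S.qq 1 2 0) (S.qq (-1) 0 1)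
    rw [br_s hT, br_s hT, H_br hT (HQ 1 2 0) (HQ (-1) 0 1), Q, qq_Y hT (-1) 1 0 _ _ (by norm_num)] at e
    have e4 : S.qq 1 2 0 * S.qq (-1) 0 1 = S.qq 0 2 1 := by
      have := Y_add hT 1 (-1)
      rw [show (1 : ℤ) + -1 = 0 by norm_num] at this
      unfold qq; rw [← this]; ring
    rw [e4] at e
    norm_num at e
    rw [h.z0 hF (HQ0 2 1) (by norm_num) (by omega) lt2', C, Ω, h.coc.skew] at e
    rw [qq_s] at P1 ⊢
    linear_combination (-1/8 : K) * (e + 2 * P1)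
  have e := h.coc.inv (S.Y 2) (S.qq (-1) 1 0) (S.qq (-1) 0 1)
  rw [H_brY hT 2 (HQ _ _ _), H_brY hT 2 (HQ _ _ _), H_br hT (HQ (-1) 1 0) (HQ (-1) 0 1), Q,
    qq_Y hT 2 (-1) 1 _ _ (by norm_num), qq_Y hT 2 (-1) 1 _ _ (by norm_num),
    qq_Y hT (-1) (-1) (-2) _ _ (by norm_num)] at e
  have e6 : S.qq (-2) 0 0 = S.Y (-2) := by simp [qq]
  norm_num [e6] at e
  rw [F] at P1 P2
  rw [e]
  linear_combination (4 : K) * P1 + 4 * P2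

/-- an exceptional monomial of weight and charge zero is one -/
theorem exc_one (hF : Flow S) {α : ℕ → K} {i : ℕ → ℕ} (hM : S.M α i) (a0 : α 0 = 0)
    (hw : S.wt α i = 0) (hx : ∀ q, 1 ≤ q → q ≤ S.n → Exc S q α i) : S.mon α i = 1 := by
  have hG : ∀ q, 1 ≤ q → q ≤ S.n → ¬ S.G q ∧ ¬ S.G (q + S.n) ∧ i q = 0 ∧ i (q + S.n) = 0 := by
    intro q h1 h2
    rcases hx q h1 h2 with ⟨g, gb, _, _, e1, e2⟩ | h
    · exfalso
      obtain ⟨N, hN⟩ := wt_exc' h1 h2 fun q h3 h4 _ => hx q h3 h4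
      rw [hw] at hN
      simp only [aa, if_pos g, if_pos gb, e1, e2] at hN
      have : ((2 + 2 * N : ℕ) : K) = 0 := by push_cast; linear_combination hN
      rw [Nat.cast_eq_zero] at this; omega
    · exact h
  have hG' : ∀ q, 1 ≤ q → q ≤ 2 * S.n → ¬ S.G q ∧ i q = 0 := by
    intro q h1 h2
    by_cases h : q ≤ S.n
    · have := hG q h1 h; exact ⟨this.1, this.2.2.1⟩
    · have := hG (q - S.n) (by omega) (by omega)
      rw [Nat.sub_add_cancel (by omega)] at this; exact ⟨this.2.1, this.2.2.2⟩
  have ha : α = 0 := by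
    funext q
    by_cases hq : q = 0
    · rw [hq]; exact a0
    · exact hM.z0 hq fun g => (hG' q (S.G_le q g).1 (S.G_le q g).2).1 g
  have hi : i = 0 := by
    funext q
    by_cases hq : q = 0
    · rw [hq]; exact hM.2 0 hF.hT
    · by_cases h2 : q ≤ 2 * S.n
      · exact (hG' q (by omega) h2).2
      · exact hM.2 q fun t => h2 (S.T_le q t)
  rw [ha, hi, mon_one]

theorem Nrm.radY2 (hF : Flow S) (h : Nrm S ψ) : Rad ψ (S.Y 2) := by
  have hT := hF.hT
  refine radY_of hF h 2 fun α i hM a0 => ?_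
  by_contra hne
  have hx := h.phi hF 2 hM a0 hne
  have hH := H_c (mon_H hM) a0 rfl
  by_cases hw : S.wt α i = 0
  · rw [exc_one hF hM a0 hw hx, mul_one] at hne
    exact hne (h.E2 hF)
  · have e := (h.radYm hF).invY h.coc hT (H_Y hT 2) (H_mul (H_Y hT (-1)) hH)
    rw [Y_add hT, show (-1 : ℤ) + 2 = 1 by norm_num, h.radY1 hF, Y_Y hT (-1) (-1) (-2) (by norm_num)] at e
    have e' : S.wt α i * ψ (S.Y 2) (S.Y (-2) * S.mon α i) = 0 := by
      push_cast at e; linear_combination -e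
    exact hne ((mul_eq_zero.1 e').resolve_left hw)

theorem Nrm.radYm2 (hF : Flow S) (h : Nrm S ψ) : Rad ψ (S.Y (-2)) := by
  have hT := hF.hT
  refine radY_of hF h (-2) fun α i hM a0 => ?_
  by_contra hne
  have hx := h.phi hF (-2) hM a0 hne
  have hH := H_c (mon_H hM) a0 rfl
  rw [neg_neg] at hne
  by_cases hw : S.wt α i = 0
  · rw [exc_one hF hM a0 hw hx, mul_one, h.coc.skew, h.E2 hF] at hne
    exact hne neg_zero
  · have e := (h.radY1 hF).invY h.coc hT (H_Y hT (-2)) (H_mul (H_Y hT 1) hH)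
    rw [Y_add hT, show (1 : ℤ) + -2 = -1 by norm_num, h.radYm hF, Y_Y hT 1 1 2 (by norm_num)] at e
    have e' : S.wt α i * ψ (S.Y (-2)) (S.Y 2 * S.mon α i) = 0 := by
      push_cast at e; linear_combination e
    exact hne ((mul_eq_zero.1 e').resolve_left hw)

/-- vanishing away from few weights -/
theorem Nrm.van (hF : Flow S) (h : Nrm S ψ) {γ γ' m n : K} {u w : R} (hu : u ∈ S.H γ m)
    (hw : w ∈ S.H γ' n) (h6 : m + n ≠ 6) (h2 : ¬ (m = 2 ∧ n = 2)) (h4 : ¬ (m = 4 ∧ n = 4)) :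
    ψ u w = 0 := by
  have hT := hF.hT
  by_cases e : γ + γ' = 0
  swap
  · exact (h.rad1 hF).ort h.coc hT hu hw e
  by_cases hmn : m = n
  swap
  · have := h.CR hF hu hw e
    refine (mul_eq_zero.1 this).resolve_left (mul_ne_zero (sub_ne_zero.2 hmn) ?_)
    intro h'; apply h6; linear_combination -h'
  subst hmn
  obtain rfl : γ' = -γ := by linear_combination e
  have a1 := (h.radYm2 hF).invY h.coc hT (H_mul (H_Y hT 2) hu) hw
  have a2 := (h.radY1 hF).invY h.coc hT (H_mul (H_Y hT 1) hu) (H_mul (H_Y hT (-2)) hw)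
  have a3 := (h.radY1 hF).invY h.coc hT hu (H_mul (H_Y hT (-1)) hw)
  rw [Y_cancel hT (-2) 2 (by norm_num)] at a1
  rw [Y_Y hT 1 1 2 (by norm_num), Y_Y hT 1 (-2) (-1) (by norm_num)] at a2
  rw [Y_cancel hT 1 (-1) (by norm_num)] at a3
  push_cast at a1 a2 a3
  have key : (m - 2) * (m - 3) * (m - 4) * ψ u w = 0 := by
    linear_combination (-1/4 : K) * ((2 * (1 + γ) + (m - 2)) * (2 * γ + (m - 2)) * a1
      - (-2 * γ - 2 * (m - 2)) * (2 * γ + (m-2)) * a2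
      + (-2 * γ - 2 * (m - 2)) * (2 * (-γ - 2) + (m - 2)) * a3)
  refine (mul_eq_zero.1 key).resolve_left (mul_ne_zero (mul_ne_zero ?_ ?_) ?_)
  · intro h'; have : m = 2 := by linear_combination h'
    exact h2 ⟨this, this⟩
  · intro h'; apply h6; linear_combination 2 * h'
  · intro h'; have : m = 4 := by linear_combination h'
    exact h4 ⟨this, this⟩

theorem Nrm.radz (hF : Flow S) (h : Nrm S ψ) {p : ℕ} (h1 : 1 ≤ p) (h2 : p ≤ 2 * S.n) :
    Rad ψ (S.z p) := by
  refine rad_of (S := S) fun α i hM => ?_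
  by_cases hw : S.wt α i = 5
  · by_cases a0 : α 0 = 0
    · exact h.z0 hF (H_c (mon_H hM) a0 rfl) (by rw [hw]; norm_num) h1 h2
    · exact (h.rad1 hF).ort h.coc hF.hT (H_z h1 h2) (mon_H hM) (by simpa using a0)
  · refine h.van hF (H_z h1 h2) (mon_H hM) ?_ ?_ ?_
    · intro h'; apply hw; linear_combination h'
    · norm_num
    · norm_num
end CSetup
end CT

set_option linter.all false
namespace CT
namespace CSetup
variable {K R : Type*} [Field K] [CommRing R] [Algebra K R] [CharZero K]
variable {S : CSetup K R} {ψ : R →ₗ[K] R →ₗ[K] K}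

theorem Nrm.zinv (hF : Flow S) (h : Nrm S ψ) {γ m n : K} {u w : R} (hu : u ∈ S.H γ m)
    (hw : w ∈ S.H (-γ) n) {r : ℕ} (h1 : 1 ≤ r) (h2 : r ≤ 2 * S.n) :
    S.sg (S.bp r) * ψ (S.δ r u) w + γ * ψ (S.z (S.bp r) * u) w
      + S.sg (S.bp r) * ψ u (S.δ r w) - γ * ψ u (S.z (S.bp r) * w) = 0 := by
  have hb := bp_r (S := S) h1 h2
  have e := (h.radz hF hb.1 hb.2.1).inv h.coc u w
  rw [H_brz hF.hT hb.1 hb.2.1 hu, H_brz hF.hT hb.1 hb.2.1 hw, bp_bp h1 h2] at e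
  simp only [map_add, map_smul, LinearMap.add_apply, LinearMap.smul_apply, smul_eq_mul] at e
  linear_combination e

theorem Nrm.v44 (hF : Flow S) (h : Nrm S ψ) {γ : K} {u w : R} (hu : u ∈ S.H γ 4)
    (hw : w ∈ S.H (-γ) 4) : ψ u w = 0 := by
  refine H_ind (ψ.flip w) (fun α i hM a0 hwt => ?_) u hu
  rw [LinearMap.flip_apply]
  obtain ⟨r, h1, h2, hr⟩ := mon_ex (S := S) 4 (by norm_num) (by rw [hwt]; norm_num)
  have hb := bp_r (S := S) h1 h2
  have hU := H_c (mon_H hM) a0 hwt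
  have hz := H_mul (H_z h1 h2) hU
  have hz' := H_c hz (zero_add γ) rfl
  have e := h.zinv hF hz' hw h1 h2
  rw [hF.δz h1 h2 hM, h.van hF (H_mul (H_z hb.1 hb.2.1) hz) hw (by norm_num) (by norm_num) (by norm_num),
    h.van hF hz (H_δ hw h1 h2) (by norm_num) (by norm_num) (by norm_num),
    h.van hF hz (H_mul (H_z hb.1 hb.2.1) hw) (by norm_num) (by norm_num) (by norm_num)] at e
  simp only [map_smul, LinearMap.smul_apply, smul_eq_mul, mul_zero, add_zero, sub_zero] at e
  exact (mul_eq_zero.1 ((mul_eq_zero.1 e).resolve_left (sg_ne _))).resolve_left hr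

theorem Nrm.van' (hF : Flow S) (h : Nrm S ψ) {γ γ' m n : K} {u w : R} (hu : u ∈ S.H γ m)
    (hw : w ∈ S.H γ' n) (h6 : m + n ≠ 6) (h2 : ¬ (m = 2 ∧ n = 2)) : ψ u w = 0 := by
  by_cases h4 : m = 4 ∧ n = 4
  · obtain ⟨rfl, rfl⟩ := h4
    by_cases e : γ + γ' = 0
    · exact h.v44 hF hu (H_c hw (by linear_combination e) rfl)
    · exact (h.rad1 hF).ort h.coc hF.hT hu hw e
  · exact h.van hF hu hw h6 h2 h4

theorem Nrm.Drule (hF : Flow S) (h : Nrm S ψ) {γ m n : K} {u w : R} (hu : u ∈ S.H γ m)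
    (hw : w ∈ S.H (-γ) n) (e7 : m + n = 7) {r : ℕ} (h1 : 1 ≤ r) (h2 : r ≤ 2 * S.n) :
    ψ (S.δ r u) w + ψ u (S.δ r w) = 0 := by
  have hb := bp_r (S := S) h1 h2
  have e := h.zinv hF hu hw h1 h2
  have n2 : (8 : K) ≠ 6 := by norm_num
  have n4 : (8 : K) ≠ 4 := by norm_num
  rw [h.van' hF (H_mul (H_z hb.1 hb.2.1) hu) hw (fun h' => n2 (by linear_combination h' - e7))
      (fun h' => n4 (by linear_combination h'.1 + h'.2 - e7)),
    h.van' hF hu (H_mul (H_z hb.1 hb.2.1) hw) (fun h' => n2 (by linear_combination h' - e7))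
      (fun h' => n4 (by linear_combination h'.1 + h'.2 - e7))] at e
  have e' : S.sg (S.bp r) * (ψ (S.δ r u) w + ψ u (S.δ r w)) = 0 := by linear_combination e
  exact (mul_eq_zero.1 e').resolve_left (sg_ne _)

theorem Nrm.Zrule (hF : Flow S) (h : Nrm S ψ) {γ m n : K} {u w : R} (hγ : γ ≠ 0) (hu : u ∈ S.H γ m)
    (hw : w ∈ S.H (-γ) n) (e5 : m + n = 5) (n2 : n ≠ 2) (n3 : n ≠ 3) {r : ℕ} (h1 : 1 ≤ r)
    (h2 : r ≤ 2 * S.n) : ψ (S.z r * u) w = ψ u (S.z r * w) := by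
  have hb := bp_r (S := S) h1 h2
  have e := h.zinv hF hu hw hb.1 hb.2.1
  rw [bp_bp h1 h2] at e
  have n6 : (4 : K) ≠ 6 := by norm_num
  rw [h.van' hF (H_δ hu hb.1 hb.2.1) hw (fun h' => n6 (by linear_combination h' - e5))
      (fun h' => n2 h'.2),
    h.van' hF hu (H_δ hw hb.1 hb.2.1) (fun h' => n6 (by linear_combination h' - e5))
      (fun h' => n3 (by linear_combination h'.2))] at e
  have e' : γ * (ψ (S.z r * u) w - ψ u (S.z r * w)) = 0 := by linear_combination e
  exact sub_eq_zero.1 ((mul_eq_zero.1 e').resolve_left hγ)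

theorem Nrm.t6a (hF : Flow S) (h : Nrm S ψ) {γ m n : K} {u w : R} (hγ : γ ≠ 0) (hu : u ∈ S.H γ m)
    (hw : w ∈ S.H (-γ) n) (e6 : m + n = 6) (n3 : n ≠ 3) (n4 : n ≠ 4) : ψ u w = 0 := by
  refine H_ind (ψ.flip w) (fun α i hM a0 hwt => ?_) u hu
  rw [LinearMap.flip_apply]
  refine H_ind (ψ (S.mon α i)) (fun β j hN b0 hwt' => ?_) w hw
  have hU := H_c (mon_H hM) a0 hwt
  have hW := H_c (mon_H hN) b0 hwt'
  obtain ⟨r, h1, h2, hr⟩ := aa_ex (S := S) (nat_ne (K := K) 6 (by norm_num))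
    (fun p => S.aa α i p + S.aa β j p)
    (by rw [Finset.sum_add_distrib, wt_aa, wt_aa, hwt, hwt', e6]; norm_num)
  have a := h.Drule hF (H_c (H_mul (H_z h1 h2) hU) (zero_add γ) rfl) hW
    (by linear_combination e6) h1 h2
  have b := h.Zrule hF hγ hU (H_δ hW h1 h2) (by linear_combination e6)
    (fun h' => n3 (by linear_combination h')) (fun h' => n4 (by linear_combination h')) h1 h2
  rw [b, hF.δz h1 h2 hM, hF.zδ h1 h2 hN] at a
  simp only [map_smul, LinearMap.smul_apply, smul_eq_mul] at a
  have e' : (S.aa α i r + S.aa β j r + 1) * ψ (S.mon α i) (S.mon β j) = 0 := by linear_combination a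
  exact (mul_eq_zero.1 e').resolve_left hr

theorem Nrm.t6b (hF : Flow S) (h : Nrm S ψ) {γ m n : K} {u w : R} (hγ : γ ≠ 0) (hu : u ∈ S.H γ m)
    (hw : w ∈ S.H (-γ) n) (e6 : m + n = 6) (n3 : n ≠ 3) : ψ u w = 0 := by
  by_cases n4 : n = 4
  · have hm : m = 2 := by linear_combination e6 - n4
    have hu' : u ∈ S.H (-(-γ)) m := H_c hu (neg_neg γ).symm rfl
    have m3 : m ≠ 3 := by rw [hm]; norm_num
    have m4 : m ≠ 4 := by rw [hm]; norm_num
    have e6' : n + m = 6 := by rw [add_comm, e6]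
    have hx : ψ w u = 0 := h.t6a hF (γ := -γ) (m := n) (n := m) (neg_ne_zero.2 hγ) hw hu' e6' m3 m4
    rw [h.coc.skew, hx, neg_zero]
  · exact h.t6a hF hγ hu hw e6 n3 n4

theorem Nrm.t6c (hF : Flow S) (h : Nrm S ψ) {γ m n : K} {u w : R} (hγ : γ ≠ 0) (hu : u ∈ S.H γ m)
    (hw : w ∈ S.H (-γ) n) (e6 : m + n = 6) : ψ u w = 0 := by
  by_cases n3 : n = 3
  swap
  · exact h.t6b hF hγ hu hw e6 n3
  have hm : m = 3 := by linear_combination e6 - n3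
  refine H_ind (ψ.flip w) (fun α i hM a0 hwt => ?_) u hu
  rw [LinearMap.flip_apply]
  obtain ⟨r, h1, h2, hr⟩ := mon_ex (S := S) 3 (by norm_num) (by rw [hwt, hm]; norm_num)
  have hz := H_c (H_mul (H_z h1 h2) (H_c (mon_H hM) a0 hwt)) (zero_add γ) rfl
  have a := h.Drule hF hz hw (by linear_combination e6) h1 h2
  rw [h.t6b hF hγ hz (H_δ hw h1 h2) (by linear_combination e6) (by rw [n3]; norm_num),
    hF.δz h1 h2 hM] at a
  simp only [map_smul, LinearMap.smul_apply, smul_eq_mul, add_zero] at a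
  exact (mul_eq_zero.1 a).resolve_left hr

theorem Nrm.t6d (hF : Flow S) (h : Nrm S ψ) {m n : K} {u w : R} (hu : u ∈ S.H 0 m)
    (hw : w ∈ S.H 0 n) (e6 : m + n = 6) (n4 : n ≠ 4) : ψ u w = 0 := by
  have e := h.shift hF hu hw
  have hT := hF.hT
  rw [h.t6c hF (γ := 1) (m := m) (n := n) one_ne_zero (H_c (H_mul (H_Y hT 1) hu) (by norm_num) (by ring))
    (H_c (H_mul (H_Y hT (-1)) hw) (by norm_num) (by ring)) e6, mul_zero, zero_add] at e
  exact (mul_eq_zero.1 e).resolve_left (sub_ne_zero.2 n4)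

theorem Nrm.t6 (hF : Flow S) (h : Nrm S ψ) {γ m n : K} {u w : R} (hu : u ∈ S.H γ m)
    (hw : w ∈ S.H (-γ) n) (e6 : m + n = 6) : ψ u w = 0 := by
  by_cases hγ : γ = 0
  · subst hγ
    rw [neg_zero] at hw
    by_cases n4 : n = 4
    · have hm : m = 2 := by linear_combination e6 - n4
      rw [h.coc.skew, h.t6d hF hw hu (by rw [add_comm, e6]) (by rw [hm]; norm_num), neg_zero]
    · exact h.t6d hF hu hw e6 n4
  · exact h.t6c hF hγ hu hw e6

theorem Nrm.v22 (hF : Flow S) (h : Nrm S ψ) {γ : K} {u w : R} (hu : u ∈ S.H γ 2)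
    (hw : w ∈ S.H (-γ) 2) : ψ u w = 0 := by
  refine H_ind (ψ.flip w) (fun α i hM a0 hwt => ?_) u hu
  rw [LinearMap.flip_apply]
  obtain ⟨r, h1, h2, hr⟩ := mon_ex (S := S) 2 (by norm_num) (by rw [hwt]; norm_num)
  have hb := bp_r (S := S) h1 h2
  have hU := H_c (mon_H hM) a0 hwt
  have hz := H_c (H_mul (H_z h1 h2) hU) (zero_add γ) rfl
  have e := h.zinv hF hz hw h1 h2
  rw [hF.δz h1 h2 hM,
    h.t6 hF (H_c (H_mul (H_z hb.1 hb.2.1) hz) (zero_add γ) rfl) hw (by norm_num),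
    h.van hF hz (H_δ hw h1 h2) (by norm_num) (by norm_num) (by norm_num),
    h.t6 hF hz (H_c (H_mul (H_z hb.1 hb.2.1) hw) (zero_add _) rfl) (by norm_num)] at e
  simp only [map_smul, LinearMap.smul_apply, smul_eq_mul, mul_zero, add_zero, sub_zero] at e
  exact (mul_eq_zero.1 ((mul_eq_zero.1 e).resolve_left (sg_ne _))).resolve_left hr

theorem Nrm.zero (hF : Flow S) (h : Nrm S ψ) (u v : R) : ψ u v = 0 := by
  have : ψ = 0 := by
    refine lin_ext (S := S) fun α i hM => lin_ext (S := S) fun β j hN => ?_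
    simp only [LinearMap.zero_apply]
    have hU := mon_H hM
    have hW := mon_H hN
    by_cases e : α 0 + β 0 = 0
    swap
    · exact (h.rad1 hF).ort h.coc hF.hT hU hW e
    have hW' := H_c hW (show β 0 = - α 0 by linear_combination e) rfl
    by_cases e6 : S.wt α i + S.wt β j = 6
    · exact h.t6 hF hU hW' e6
    by_cases e2 : S.wt α i = 2 ∧ S.wt β j = 2
    · exact h.v22 hF (H_c hU rfl e2.1) (H_c hW' rfl e2.2)
    · exact h.van' hF hU hW e6 e2
  rw [this]; rfl

theorem case_flow (hF : Flow S) (hψ : Coc S ψ) : IsCob S ψ := by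
  obtain ⟨f, hf⟩ := hF.normalize hψ
  refine ⟨f, fun u v => ?_⟩
  have := hf.zero hF u v
  rw [LinearMap.sub_apply, LinearMap.sub_apply, LinearMap.compr₂_apply, brL_apply] at this
  exact sub_eq_zero.1 this

theorem main (hψ : Coc S ψ) : IsCob S ψ := by
  by_cases h3 : ∃ p, 1 ≤ p ∧ p ≤ S.n ∧ S.G p ∧ S.T p ∧ S.G (p + S.n)
  · obtain ⟨p, h1, h2, g, t, gb⟩ := h3
    have := S.ty p h1 h2
    exact case_3 h1 h2 g gb t (by tauto) hψ
  have hn3 : ∀ p, 1 ≤ p → p ≤ S.n → ¬ (S.G p ∧ S.T p ∧ S.G (p + S.n)) :=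
    fun p h1 h2 h => h3 ⟨p, h1, h2, h⟩
  by_cases hT : S.T 0
  · exact case_T0 hT hn3 hψ
  by_cases c2 : ∃ p, 1 ≤ p ∧ p ≤ S.n ∧ S.G p ∧ S.G (p + S.n) ∧ ¬ S.T p ∧ S.T (p + S.n)
  · obtain ⟨p, h1, h2, g, gb, t, tb⟩ := c2
    exact case_2 hT hn3 h1 h2 g gb t tb hψ
  by_cases c4 : ∃ p, 1 ≤ p ∧ p ≤ S.n ∧ S.G p ∧ ¬ S.G (p + S.n) ∧ S.T (p + S.n)
  · obtain ⟨p, h1, h2, g, gb, tb⟩ := c4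
    exact case_45 hT hn3 h1 h2 g gb tb hψ
  refine case_flow ⟨hT, fun p h1 h2 => ?_⟩ hψ
  have a := S.ty p h1 h2
  have b := hn3 p h1 h2
  have c : ¬ (S.G p ∧ S.G (p + S.n) ∧ ¬ S.T p ∧ S.T (p + S.n)) := fun h => c2 ⟨p, h1, h2, h⟩
  have d : ¬ (S.G p ∧ ¬ S.G (p + S.n) ∧ S.T (p + S.n)) := fun h => c4 ⟨p, h1, h2, h⟩
  tauto
end CSetup
end CT

set_option linter.all false
namespace CT

theorem iot_mono (ℓ : ℕ → ℕ) {i j : ℕ} (h : i ≤ j) : iot ℓ i ≤ iot ℓ j :=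
  Finset.sum_le_sum_of_subset (Finset.Icc_subset_Icc le_rfl h)

theorem iot_zero (ℓ : ℕ → ℕ) : iot ℓ 0 = 0 := by simp [iot]

theorem mem_iSet (ℓ : ℕ → ℕ) (i j p : ℕ) :
    p ∈ iSet ℓ i j ↔ iot ℓ (i - 1) + 1 ≤ p ∧ p ≤ iot ℓ j := by
  rw [iSet, Finset.mem_Icc]

theorem mem_bSet (ℓ : ℕ → ℕ) (i j p : ℕ) (hj : j ≤ 6) :
    p ∈ barSet ℓ (iSet ℓ i j) ↔ iot ℓ (i - 1) + 1 + iot ℓ 6 ≤ p ∧ p ≤ iot ℓ j + iot ℓ 6 := by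
  have h6 := iot_mono ℓ hj
  simp only [barSet, Finset.mem_image, mem_iSet]
  constructor
  · rintro ⟨q, ⟨h1, h2⟩, rfl⟩
    rw [bar, if_pos (by omega)]; omega
  · rintro ⟨h1, h2⟩
    refine ⟨p - iot ℓ 6, by omega, ?_⟩
    rw [bar, if_pos (by omega)]; omega

/-- support condition for torus indices -/
def Gp (ℓ : ℕ → ℕ) (p : ℕ) : Prop := p ∈ jSet ℓ 1 3 ∪ iSet ℓ 4 5

/-- support condition for polynomial indices -/
def Tp (ℓ : ℕ → ℕ) (j0 : Bool) (p : ℕ) : Prop :=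
  (p = 0 ∧ j0 = true) ∨ (1 ≤ p ∧ p ≤ 2 * iot ℓ 6 ∧
    p ∉ iSet ℓ 1 2 ∪ iSet ℓ 4 4 ∪ barSet ℓ (iSet ℓ 1 1))

theorem mem_jIdx (ℓ : ℕ → ℕ) (j0 : Bool) (i : ℕ → ℕ) :
    i ∈ jIdx ℓ j0 ↔ ∀ p, ¬ Tp ℓ j0 p → i p = 0 := by
  constructor
  · rintro ⟨h1, h2⟩ p hp
    by_cases h0 : p = 0
    · subst h0
      refine h1 ?_
      by_contra hj
      exact hp (Or.inl ⟨rfl, by simpa using hj⟩)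
    · by_contra hi
      refine hp (Or.inr ⟨by omega, ?_, fun hm => hi (h2 p (by omega) (Or.inl hm))⟩)
      by_contra hl
      exact hi (h2 p (by omega) (Or.inr (by omega)))
  · intro h
    refine ⟨fun hj => h 0 ?_, fun p h1 h2 => h p ?_⟩
    · rintro (⟨_, h⟩ | h)
      · rw [hj] at h; exact absurd h (by simp)
      · omega
    · rintro (⟨h, _⟩ | ⟨_, h3, h4⟩)
      · omega
      · rcases h2 with h2 | h2
        · exact h4 h2
        · omega

theorem Gp_iff (ℓ : ℕ → ℕ) (p : ℕ) : Gp ℓ p ↔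
    (1 ≤ p ∧ p ≤ iot ℓ 5) ∨ (1 + iot ℓ 6 ≤ p ∧ p ≤ iot ℓ 3 + iot ℓ 6) := by
  have h35 := iot_mono ℓ (show 3 ≤ 5 by norm_num)
  rw [Gp, jSet, Finset.mem_union, Finset.mem_union, mem_iSet, mem_bSet _ _ _ _ (by norm_num),
    mem_iSet]
  simp only [show 1 - 1 = 0 from rfl, show 4 - 1 = 3 from rfl, iot_zero]
  omega

theorem nG_iff (ℓ : ℕ → ℕ) (p : ℕ) : p ∈ iSet ℓ 6 6 ∪ barSet ℓ (iSet ℓ 4 6) ↔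
    (1 ≤ p ∧ p ≤ 2 * iot ℓ 6 ∧ ¬ Gp ℓ p) := by
  have h35 := iot_mono ℓ (show 3 ≤ 5 by norm_num)
  have h56 := iot_mono ℓ (show 5 ≤ 6 by norm_num)
  rw [Gp_iff, Finset.mem_union, mem_iSet, mem_bSet _ _ _ _ (by norm_num)]
  simp only [show 6 - 1 = 5 from rfl, show 4 - 1 = 3 from rfl]
  omega

theorem Tp_iff (ℓ : ℕ → ℕ) (j0 : Bool) (p : ℕ) : Tp ℓ j0 p ↔
    (p = 0 ∧ j0 = true) ∨ (1 ≤ p ∧ p ≤ 2 * iot ℓ 6 ∧ ¬ (p ≤ iot ℓ 2) ∧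
      ¬ (iot ℓ 3 + 1 ≤ p ∧ p ≤ iot ℓ 4) ∧ ¬ (1 + iot ℓ 6 ≤ p ∧ p ≤ iot ℓ 1 + iot ℓ 6)) := by
  rw [Tp, Finset.mem_union, Finset.mem_union, mem_iSet, mem_bSet _ _ _ _ (by norm_num),
    mem_iSet]
  simp only [show 1 - 1 = 0 from rfl, show 4 - 1 = 3 from rfl, iot_zero]
  refine or_congr Iff.rfl ?_
  omega

section tr
variable {K R : Type*} [Field K] [CommRing R] [Algebra K R]
variable {ℓ : ℕ → ℕ} {Γ : AddSubgroup (ℕ → K)} {j0 : Bool}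

/-- compatibility of the concrete model with an abstract setup -/
structure Cmp (S : CSetup K R) (e : CA K ℓ Γ j0 ≃ₗ[K] R) : Prop where
  n : S.n = iot ℓ 6
  G : ∀ p, S.G p ↔ Gp ℓ p
  M : ∀ α i, S.M α i ↔ α ∈ Γ ∧ i ∈ jIdx ℓ j0
  X : ∀ α i, e (X K ℓ Γ j0 α i) = S.mon α i

variable {S : CSetup K R} {e : CA K ℓ Γ j0 ≃ₗ[K] R}

theorem Cmp.single (h : Cmp S e) (a) : e (Finsupp.single a 1) = S.mon a.1.1 a.2.1 := by
  rw [← h.X, _root_.X, dif_pos ⟨a.1.2, a.2.2⟩]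

theorem Cmp.M' (h : Cmp S e) (a : ↥Γ × ↥(jIdx ℓ j0)) : S.M a.1.1 a.2.1 :=
  (h.M _ _).2 ⟨a.1.2, a.2.2⟩

theorem Cmp.sum (h : Cmp S e) (u) : e u = u.sum fun a c => c • S.mon a.1.1 a.2.1 := by
  conv_lhs => rw [← Finsupp.sum_single u]
  rw [map_finsuppSum]
  refine Finsupp.sum_congr fun a _ => ?_
  rw [← h.single, ← map_smul, Finsupp.smul_single, smul_eq_mul, mul_one]

theorem Cmp.mul (h : Cmp S e) (u v) : e (mulA K ℓ Γ j0 u v) = e u * e v := by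
  rw [mulA, map_finsuppSum, h.sum u, Finsupp.sum_mul]
  refine Finsupp.sum_congr fun a _ => ?_
  rw [map_finsuppSum, h.sum v, Finsupp.mul_sum]
  refine Finsupp.sum_congr fun b _ => ?_
  rw [map_smul, h.X, ← CSetup.mon_mul (h.M' a) (h.M' b), smul_mul_smul_comm]

theorem Cmp.st (h : Cmp S e) (p u) : e (pstar K ℓ Γ j0 p u) = S.st p (e u) := by
  rw [pstar, map_finsuppSum, h.sum u, map_finsuppSum]
  refine Finsupp.sum_congr fun a _ => ?_
  rw [map_smul, h.single, Derivation.map_smul, CSetup.st_mon p (h.M' a), mul_smul]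

theorem Cmp.dt (h : Cmp S e) (p u) : e (pt K ℓ Γ j0 p u) = S.dt p (e u) := by
  rw [pt, map_finsuppSum, h.sum u, map_finsuppSum]
  refine Finsupp.sum_congr fun a _ => ?_
  rw [map_smul, h.X, Derivation.map_smul, CSetup.dt_mon p (h.M' a), mul_smul]

theorem Cmp.d (h : Cmp S e) (p u) : e (dd K ℓ Γ j0 p u) = S.d p (e u) := by
  rw [dd, map_add, h.st, h.dt, CSetup.d_apply]

theorem der_sum (s : Finset ℕ) (D : ℕ → Derivation K R R) (u : R) :
    (∑ p ∈ s, D p) u = ∑ p ∈ s, D p u := by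
  induction s using Finset.induction_on with
  | empty => simp
  | insert a s ha ih => simp [Finset.sum_insert ha, ih]

theorem Cmp.E (h : Cmp S e) (u) : e (Dop K ℓ Γ j0 u) = S.E (e u) := by
  classical
  have hE : S.E (e u) = ∑ p ∈ Finset.Icc 1 (2 * S.n),
      (if S.G p then S.st p (e u) else S.z p * S.dt p (e u)) := by
    rw [CSetup.E, der_sum]
    refine Finset.sum_congr rfl fun p _ => ?_
    split_ifs <;> rfl
  have h35 := iot_mono ℓ (show 3 ≤ 5 by norm_num)
  have h56 := iot_mono ℓ (show 5 ≤ 6 by norm_num)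
  have e1 : (Finset.Icc 1 (2 * S.n)).filter (fun p => S.G p) = jSet ℓ 1 3 ∪ iSet ℓ 4 5 := by
    ext p
    rw [Finset.mem_filter, Finset.mem_Icc, h.G, h.n]
    change _ ↔ Gp ℓ p
    rw [Gp_iff]; omega
  have e2 : (Finset.Icc 1 (2 * S.n)).filter (fun p => ¬ S.G p) =
      iSet ℓ 6 6 ∪ barSet ℓ (iSet ℓ 4 6) := by
    ext p
    rw [Finset.mem_filter, Finset.mem_Icc, h.G, h.n, nG_iff, and_assoc]
  rw [hE, Finset.sum_ite, e1, e2, Dop, map_add, map_sum, map_sum]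
  congr 1
  · exact Finset.sum_congr rfl fun p _ => h.st p u
  · refine Finset.sum_congr rfl fun p hp => ?_
    rw [h.mul, h.X, h.dt, CSetup.z, if_neg]
    rw [h.G]; exact ((nG_iff ℓ p).1 hp).2.2

theorem Cmp.sgm (h : Cmp S e) {p : ℕ} (h1 : 1 ≤ p) (h2 : p ≤ iot ℓ 6) :
    e (_root_.X K ℓ Γ j0 (_root_.sgm K ℓ p) 0) = S.zi p * S.zi (p + S.n) := by
  classical
  have h35 := iot_mono ℓ (show 3 ≤ 5 by norm_num)
  have h56 := iot_mono ℓ (show 5 ≤ 6 by norm_num)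
  rw [h.X, _root_.sgm]
  simp only [if_pos h2, mem_iSet, show 1 - 1 = 0 from rfl, show 4 - 1 = 3 from rfl, iot_zero]
  have g1 := (h.G p).trans (Gp_iff ℓ p)
  have g2 := (h.G (p + S.n)).trans (Gp_iff ℓ (p + S.n))
  rw [h.n] at g2 ⊢
  split_ifs with a b
  · have q1 : S.G p := g1.2 (by omega)
    have q2 : S.G (p + iot ℓ 6) := g2.2 (by omega)
    rw [mul_comm, CSetup.zi, if_pos q2, CSetup.zi, if_pos q1,
      CSetup.mon_mul (CSetup.M_nG q2) (CSetup.M_nG q1), add_zero]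
    congr 1; abel
  · have q1 : S.G p := g1.2 (by omega)
    have q2 : ¬ S.G (p + iot ℓ 6) := fun q => by have := g2.1 q; omega
    rw [CSetup.zi_nG q2, mul_one, CSetup.zi, if_pos q1]
  · have q1 : ¬ S.G p := fun q => by have := g1.1 q; omega
    have q2 : ¬ S.G (p + iot ℓ 6) := fun q => by have := g2.1 q; omega
    rw [CSetup.zi_nG q2, CSetup.zi_nG q1, mul_one, CSetup.mon_one]

theorem Cmp.br (h : Cmp S e) (u v) : e (brk K ℓ Γ j0 u v) = S.br (e u) (e v) := by
  have e1 : iSet ℓ 1 6 = Finset.Icc 1 S.n := by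
    rw [h.n, iSet, show 1 - 1 = 0 from rfl, iot_zero]
  have e2 : ∀ w, (2 : R) * w = (2 : K) • w := fun w => by rw [two_mul, two_smul]
  rw [brk, CSetup.br, CSetup.P, map_sub, map_add, map_sum, h.mul, h.mul, h.d, h.d, map_sub, map_sub,
    map_smul, map_smul, h.E, h.E, e2, e2, e1]
  congr 2
  refine Finset.sum_congr rfl fun p hp => ?_
  rw [Finset.mem_Icc, h.n] at hp
  have hb : bar ℓ p = p + S.n := by rw [bar, if_pos hp.2, h.n]
  rw [h.mul, h.sgm hp.1 hp.2, map_sub, h.mul, h.mul, h.d, h.d, h.d, h.d, hb,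
    CSetup.δ_apply, CSetup.δ_apply, CSetup.δ_apply, CSetup.δ_apply]
  ring

theorem Cmp.final [CharZero K] (h : Cmp S e) (ψ : CA K ℓ Γ j0 →ₗ[K] CA K ℓ Γ j0 →ₗ[K] K)
    (hskew : ∀ u v : CA K ℓ Γ j0, ψ u v = -ψ v u)
    (hjac : ∀ u v w : CA K ℓ Γ j0,
      ψ (brk K ℓ Γ j0 u v) w + ψ (brk K ℓ Γ j0 v w) u + ψ (brk K ℓ Γ j0 w u) v = 0) :
    ∃ f : CA K ℓ Γ j0 →ₗ[K] K, ∀ u v : CA K ℓ Γ j0, ψ u v = f (brk K ℓ Γ j0 u v) := by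
  let ψ' : R →ₗ[K] R →ₗ[K] K := ψ.compl₁₂ e.symm.toLinearMap e.symm.toLinearMap
  have ha : ∀ u v, ψ' u v = ψ (e.symm u) (e.symm v) := fun u v => rfl
  have hb : ∀ u v, e.symm (S.br u v) = brk K ℓ Γ j0 (e.symm u) (e.symm v) := fun u v => by
    rw [LinearEquiv.symm_apply_eq, h.br, e.apply_symm_apply, e.apply_symm_apply]
  have hc : CSetup.Coc S ψ' := ⟨fun u v => by rw [ha, ha, hskew],
    fun u v w => by rw [ha, ha, ha, hb, hb, hb, hjac]⟩
  obtain ⟨f, hf⟩ := CSetup.main hc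
  refine ⟨f ∘ₗ e.toLinearMap, fun u v => ?_⟩
  have := hf (e u) (e v)
  rw [ha, e.symm_apply_apply, e.symm_apply_apply, ← h.br] at this
  exact this

end tr

/-- exponents as a submonoid -/
def JS (T : ℕ → Prop) : AddSubmonoid (ℕ → ℕ) where
  carrier := {i | ∀ p, ¬ T p → i p = 0}
  zero_mem' := fun _ _ => rfl
  add_mem' := fun {a b} ha hb p hp => by
    rw [Pi.add_apply, ha p hp, hb p hp]

/-- the index equivalence -/
def JSe {K : Type*} [Field K] (Γ : AddSubgroup (ℕ → K)) (T : ℕ → Prop) :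
    (↥Γ × ↥(JS T)) ≃ (↥Γ × {i : ℕ → ℕ // ∀ p, ¬ T p → i p = 0}) :=
  Equiv.prodCongr (Equiv.refl _) (Equiv.subtypeEquivRight fun _ => Iff.rfl)

/-- the concrete setup -/
def cset {K : Type*} [Field K] (ℓ : ℕ → ℕ) (Γ : AddSubgroup (ℕ → K)) (j0 : Bool)
    (hℓ : 0 < iot ℓ 6)
    (hΓ1 : ∀ p ∈ jSet ℓ 1 3 ∪ iSet ℓ 4 5, (Pi.single p (1 : K) : ℕ → K) ∈ Γ)
    (hΓ2 : ∀ α ∈ Γ, ∀ p ∈ iSet ℓ 6 6 ∪ barSet ℓ (iSet ℓ 4 6), α p = 0)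
    (hΓ3 : ∀ α ∈ Γ, ∀ p, 2 * iot ℓ 6 < p → α p = 0)
    (hΓ0 : (∃ α ∈ Γ, α 0 ≠ 0) → (Pi.single 0 (1 : K) : ℕ → K) ∈ Γ)
    (hJ0 : j0 = false → ∃ α ∈ Γ, α 0 ≠ 0) :
    CSetup K (AddMonoidAlgebra K (↥Γ × ↥(JS (Tp ℓ j0)))) where
  n := iot ℓ 6
  G := Gp ℓ
  T := Tp ℓ j0
  Gm := Γ
  b := (AddMonoidAlgebra.basis (↥Γ × ↥(JS (Tp ℓ j0))) K).reindex (JSe Γ (Tp ℓ j0))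
  b_one := by
    rw [Module.Basis.reindex_apply, AddMonoidAlgebra.basis_apply]; rfl
  b_mul := fun x y => by
    simp only [Module.Basis.reindex_apply, AddMonoidAlgebra.basis_apply]
    rw [AddMonoidAlgebra.single_mul_single, one_mul]; rfl
  hn := hℓ
  G_le := fun p hp => by
    have h35 := iot_mono ℓ (show 3 ≤ 5 by norm_num)
    have h56 := iot_mono ℓ (show 5 ≤ 6 by norm_num)
    rw [Gp_iff] at hp; omega
  T_le := fun p hp => by rw [Tp_iff] at hp; omega
  G_mem := hΓ1
  G_zero := fun α hα p hp hG => by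
    by_cases hl : p ≤ 2 * iot ℓ 6
    · exact hΓ2 α hα p ((nG_iff ℓ p).2 ⟨by omega, hl, hG⟩)
    · exact hΓ3 α hα p (by omega)
  h0 := by
    cases j0 with
    | true => exact Or.inl (Or.inl ⟨rfl, rfl⟩)
    | false => exact Or.inr (hΓ0 (hJ0 rfl))
  ty := fun p h1 h2 => by
    have m1 := iot_mono ℓ (show 1 ≤ 2 by norm_num)
    have m2 := iot_mono ℓ (show 2 ≤ 3 by norm_num)
    have m3 := iot_mono ℓ (show 3 ≤ 4 by norm_num)
    have m4 := iot_mono ℓ (show 4 ≤ 5 by norm_num)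
    have m5 := iot_mono ℓ (show 5 ≤ 6 by norm_num)
    simp only [Gp_iff, Tp_iff]
    have hp0 : ¬ (p = 0 ∧ j0 = true) := fun h => by omega
    have hp1 : ¬ (p + iot ℓ 6 = 0 ∧ j0 = true) := fun h => by omega
    simp only [hp0, hp1, false_or]
    rcases lt_or_ge (iot ℓ 1) p with c1 | c1
    swap
    · exact Or.inl (by omega)
    rcases lt_or_ge (iot ℓ 2) p with c2 | c2
    swap
    · exact Or.inr (Or.inl (by omega))
    rcases lt_or_ge (iot ℓ 3) p with c3 | c3
    swap
    · exact Or.inr (Or.inr (Or.inl (by omega)))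
    rcases lt_or_ge (iot ℓ 5) p with c5 | c5
    swap
    · exact Or.inr (Or.inr (Or.inr (Or.inl (by omega))))
    exact Or.inr (Or.inr (Or.inr (Or.inr (by omega))))

end CT

/-- **Theorem 4.6.** For every contact Lie algebra `𝒦 = 𝒦(ℓ⃗,σ,Γ,𝒥)` in
normalized form, `H²(𝒦,F) = 0`: every 2-cocycle `ψ` on `𝒦` is a 2-coboundary, i.e.
`ψ(u,v) = f([u,v])` for some linear `f : 𝒦 → F`. -/
theorem H2_contact_trivial
    {F : Type*} [Field F] [CharZero F] (ℓ : ℕ → ℕ) (Γ : AddSubgroup (ℕ → F)) (j0 : Bool)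
    (hℓ : 0 < iot ℓ 6)
    (hΓ1 : ∀ p ∈ jSet ℓ 1 3 ∪ iSet ℓ 4 5, (Pi.single p (1 : F) : ℕ → F) ∈ Γ)
    (hΓ2 : ∀ α ∈ Γ, ∀ p ∈ iSet ℓ 6 6 ∪ barSet ℓ (iSet ℓ 4 6), α p = 0)
    (hΓ3 : ∀ α ∈ Γ, ∀ p, 2 * iot ℓ 6 < p → α p = 0)
    (hΓ0 : (∃ α ∈ Γ, α 0 ≠ 0) → (Pi.single 0 (1 : F) : ℕ → F) ∈ Γ)
    (hJ0 : j0 = false → ∃ α ∈ Γ, α 0 ≠ 0)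
    (ψ : CA F ℓ Γ j0 →ₗ[F] CA F ℓ Γ j0 →ₗ[F] F)
    (hskew : ∀ u v : CA F ℓ Γ j0, ψ u v = -ψ v u)
    (hjac : ∀ u v w : CA F ℓ Γ j0,
      ψ (brk F ℓ Γ j0 u v) w + ψ (brk F ℓ Γ j0 v w) u + ψ (brk F ℓ Γ j0 w u) v = 0) :
    ∃ f : CA F ℓ Γ j0 →ₗ[F] F, ∀ u v : CA F ℓ Γ j0, ψ u v = f (brk F ℓ Γ j0 u v) := by
  let S := CT.cset ℓ Γ j0 hℓ hΓ1 hΓ2 hΓ3 hΓ0 hJ0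
  let q : (↥Γ × ↥(jIdx ℓ j0)) ≃ (↥Γ × {i : ℕ → ℕ // ∀ p, ¬ CT.Tp ℓ j0 p → i p = 0}) :=
    Equiv.prodCongr (Equiv.refl _) (Equiv.subtypeEquivRight fun i => CT.mem_jIdx ℓ j0 i)
  let e : CA F ℓ Γ j0 ≃ₗ[F] AddMonoidAlgebra F (↥Γ × ↥(CT.JS (CT.Tp ℓ j0))) :=
    (Finsupp.domLCongr q).trans S.b.repr.symm
  have hM : ∀ α i, S.M α i ↔ α ∈ Γ ∧ i ∈ jIdx ℓ j0 := fun α i =>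
    and_congr Iff.rfl (CT.mem_jIdx ℓ j0 i).symm
  have h : CT.Cmp S e := by
    refine ⟨rfl, fun _ => Iff.rfl, hM, fun α i => ?_⟩
    by_cases hm : S.M α i
    · rw [X, dif_pos ((hM α i).1 hm), CT.CSetup.mon_eq hm]
      change S.b.repr.symm (Finsupp.domLCongr q _) = _
      rw [Finsupp.domLCongr_single]
      exact S.b.repr_symm_single_one _
    · rw [X, dif_neg (fun h' => hm ((hM α i).2 h')), map_zero]
      rw [CT.CSetup.mon, dif_neg hm]
  exact h.final ψ hskew hjac

end
end

section
/- (Equations (4.15)–(4.16)) Let φ be a 2-cocycle on 𝒦 such that φ(1,x^α)=0 for all α∈Γ and φ(x^{−σ_p},x^α)=0 for all α∈Γ and all p∈I₁. Then: (i) φ(x^α,x^β)=0 whenever α₀+β₀≠0; and (ii) φ(x^α,x^β)=0 whenever α_p+β_p≠α_{p̄}+β_{p̄} for some p∈I₁. -/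
noncomputable section

/-- `σ_p = −1_{[p]} − 1_{[p̄]}` (with `p̄ = p + ℓ₁`). -/
def sg (F : Type*) [Field F] (n : ℕ) (p : ℕ) : ℕ → F :=
  -Pi.single p (1 : F) - Pi.single (p + n) (1 : F)

/-- `σ = Σ_{p∈I₁} σ_p`. -/
def sgT (F : Type*) [Field F] (n : ℕ) : ℕ → F := ∑ p ∈ Finset.Icc 1 n, sg F n p

/-- `θ(α) = Σ_{p∈J₁} α_p`. -/
def th (F : Type*) [Field F] (n : ℕ) (α : ℕ → F) : F := ∑ p ∈ Finset.Icc 1 (2 * n), α p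

/-- The contact Lie algebra `𝒦` (case `ℓ⃗ = (ℓ₁,0,0,0,0,0)`, `𝒥₀ = {0}`):
the free `F`-module with basis `{x^α : α ∈ Γ}`. -/
abbrev KA (F : Type*) [Field F] (Γ : AddSubgroup (ℕ → F)) : Type _ := ↥Γ →₀ F

/-- The basis monomial `x^α` (interpreted as `0` when `α ∉ Γ`). -/
def X2 (F : Type*) [Field F] (Γ : AddSubgroup (ℕ → F)) (α : ℕ → F) : KA F Γ :=
  @dite _ (α ∈ Γ) (Classical.dec _) (fun h => Finsupp.single ⟨α, h⟩ 1) (fun _ => 0)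

/-- The bracket on basis elements:
`[x^α,x^β] = Σ_{p∈I₁}(α_pβ_{p̄}−α_{p̄}β_p)x^{α+β+σ_p} + ((2−θ(α))β₀−α₀(2−θ(β)))x^{α+β}`. -/
def brkB (F : Type*) [Field F] (n : ℕ) (Γ : AddSubgroup (ℕ → F)) (a b : ↥Γ) : KA F Γ :=
  (∑ p ∈ Finset.Icc 1 n,
    (a.1 p * b.1 (p + n) - a.1 (p + n) * b.1 p) • X2 F Γ (a.1 + b.1 + sg F n p)) +
    ((2 - th F n a.1) * b.1 0 - a.1 0 * (2 - th F n b.1)) • X2 F Γ (a.1 + b.1)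

/-- The contact Lie bracket on `𝒦`, extended bilinearly from the basis. -/
def brk2 (F : Type*) [Field F] (n : ℕ) (Γ : AddSubgroup (ℕ → F)) (u v : KA F Γ) : KA F Γ :=
  u.sum fun a ca => v.sum fun b cb => (ca * cb) • brkB F n Γ a b

/-- `p = p_α`: `p` is the least index in `I₁` with `(α_p, α_{p̄}) ≠ (−1,−1)`. -/
def isPmin (F : Type*) [Field F] (n : ℕ) (α : ℕ → F) (p : ℕ) : Prop :=
  p ∈ Finset.Icc 1 n ∧ (α p ≠ -1 ∨ α (p + n) ≠ -1) ∧
    ∀ q ∈ Finset.Icc 1 n, q < p → (α q = -1 ∧ α (q + n) = -1)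

theorem X2_mem {F : Type*} [Field F] (Γ : AddSubgroup (ℕ → F)) {α : ℕ → F} (h : α ∈ Γ) :
    X2 F Γ α = Finsupp.single ⟨α, h⟩ 1 := by
  simp [X2, h]

theorem brk2_X2 {F : Type*} [Field F] (n : ℕ) (Γ : AddSubgroup (ℕ → F)) {α β : ℕ → F}
    (ha : α ∈ Γ) (hb : β ∈ Γ) :
    brk2 F n Γ (X2 F Γ α) (X2 F Γ β) = brkB F n Γ ⟨α, ha⟩ ⟨β, hb⟩ := by
  rw [X2_mem Γ ha, X2_mem Γ hb, brk2]
  simp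

theorem brkB_skew {F : Type*} [Field F] (n : ℕ) (Γ : AddSubgroup (ℕ → F)) (a b : ↥Γ) :
    brkB F n Γ b a = - brkB F n Γ a b := by
  unfold brkB
  rw [neg_add, ← Finset.sum_neg_distrib, add_comm b.1 a.1]
  congr 1
  · refine Finset.sum_congr rfl fun p _ => ?_
    rw [← neg_smul]; congr 1; ring
  · rw [← neg_smul]; congr 1; ring

/-- If `x^c` acts diagonally with weight `k` and `φ(x^c, ·) = 0`, then `φ` preserves weight. -/
theorem weight_vanish {F : Type*} [Field F] (n : ℕ) (Γ : AddSubgroup (ℕ → F))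
    (φ : KA F Γ →ₗ[F] KA F Γ →ₗ[F] F)
    (hskew : ∀ u v : KA F Γ, φ u v = -φ v u)
    (hjac : ∀ u v w : KA F Γ,
      φ (brk2 F n Γ u v) w + φ (brk2 F n Γ v w) u + φ (brk2 F n Γ w u) v = 0)
    (c : ℕ → F) (hc : c ∈ Γ) (h1 : ∀ α ∈ Γ, φ (X2 F Γ c) (X2 F Γ α) = 0)
    (k : (ℕ → F) → F)
    (hk : ∀ α (h : α ∈ Γ), brkB F n Γ ⟨c, hc⟩ ⟨α, h⟩ = k α • X2 F Γ α)
    (α : ℕ → F) (ha : α ∈ Γ) (β : ℕ → F) (hb : β ∈ Γ) (hne : k α + k β ≠ 0) :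
    φ (X2 F Γ α) (X2 F Γ β) = 0 := by
  have h0 : φ (X2 F Γ c) = 0 := by
    refine Finsupp.lhom_ext' fun a => LinearMap.ext_ring ?_
    have := h1 a.1 a.2
    rw [X2_mem Γ a.2] at this
    simpa using this
  have hj := hjac (X2 F Γ c) (X2 F Γ α) (X2 F Γ β)
  rw [hskew (brk2 F n Γ (X2 F Γ α) (X2 F Γ β)), h0, brk2_X2 n Γ hc ha, brk2_X2 n Γ hb hc,
    brkB_skew n Γ ⟨c, hc⟩ ⟨β, hb⟩, hk, hk] at hj
  simp only [map_smul, map_neg, LinearMap.smul_apply, LinearMap.neg_apply, LinearMap.zero_apply,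
    smul_eq_mul] at hj
  rw [hskew (X2 F Γ β)] at hj
  have : (k α + k β) * φ (X2 F Γ α) (X2 F Γ β) = 0 := by linear_combination hj
  exact (mul_eq_zero.mp this).resolve_left hne

/-- **equations (4.15)–(4.16).** If a 2-cocycle `φ` on `𝒦` satisfies
`φ(1,x^α) = 0` and `φ(x^{−σ_p},x^α) = 0` for all `α ∈ Γ`, `p ∈ I₁`, then
(i) `φ(x^α,x^β) = 0` whenever `α₀ + β₀ ≠ 0`, and
(ii) `φ(x^α,x^β) = 0` whenever `α_p + β_p ≠ α_{p̄} + β_{p̄}` for some `p ∈ I₁`. -/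
theorem cocycle_vanishing_conditions
    {F : Type*} [Field F] [CharZero F] (n : ℕ) (Γ : AddSubgroup (ℕ → F))
    (hn : 1 ≤ n)
    (hΓ1 : ∀ p ≤ 2 * n, (Pi.single p (1 : F) : ℕ → F) ∈ Γ)
    (hΓ0 : ∃ α ∈ Γ, α 0 ≠ 0)
    (hΓs : ∀ α ∈ Γ, ∀ p, 2 * n < p → α p = 0)
    (φ : KA F Γ →ₗ[F] KA F Γ →ₗ[F] F)
    (hskew : ∀ u v : KA F Γ, φ u v = -φ v u)
    (hjac : ∀ u v w : KA F Γ,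
      φ (brk2 F n Γ u v) w + φ (brk2 F n Γ v w) u + φ (brk2 F n Γ w u) v = 0)
    (h1 : ∀ α ∈ Γ, φ (X2 F Γ 0) (X2 F Γ α) = 0)
    (h2 : ∀ p ∈ Finset.Icc 1 n, ∀ α ∈ Γ, φ (X2 F Γ (-sg F n p)) (X2 F Γ α) = 0) :
    (∀ α ∈ Γ, ∀ β ∈ Γ, α 0 + β 0 ≠ 0 → φ (X2 F Γ α) (X2 F Γ β) = 0) ∧
    (∀ α ∈ Γ, ∀ β ∈ Γ, ∀ p ∈ Finset.Icc 1 n,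
      α p + β p ≠ α (p + n) + β (p + n) → φ (X2 F Γ α) (X2 F Γ β) = 0) := by
  constructor
  · intro α ha β hb hne
    refine weight_vanish n Γ φ hskew hjac 0 Γ.zero_mem h1 (fun α => 2 * α 0) ?_ α ha β hb ?_
    · intro α h
      simp [brkB, th]
    · rw [← mul_add]
      exact mul_ne_zero two_ne_zero hne
  · intro α ha β hb p hp hne
    have hp' := Finset.mem_Icc.mp hp
    have hc : -sg F n p ∈ Γ := by
      refine Γ.neg_mem (Γ.sub_mem (Γ.neg_mem (hΓ1 _ ?_)) (hΓ1 _ ?_)) <;> omega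
    refine weight_vanish n Γ φ hskew hjac _ hc (h2 p hp) (fun α => α (p + n) - α p) ?_
      α ha β hb ?_
    · intro α h
      have hv : ∀ q, (-sg F n p) q = (if q = p then 1 else 0) + (if q = p + n then 1 else 0) := by
        intro q
        simp [sg, Pi.single_apply]
        ring
      have hth : th F n (-sg F n p) = 2 := by
        unfold th
        simp only [hv]
        rw [Finset.sum_add_distrib, Finset.sum_ite_eq', Finset.sum_ite_eq',
          if_pos (Finset.mem_Icc.mpr (by omega)), if_pos (Finset.mem_Icc.mpr (by omega))]
        norm_num
      have h00 : (-sg F n p) 0 = 0 := by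
        rw [hv, if_neg (by omega), if_neg (by omega), add_zero]
      unfold brkB
      simp only [hth, h00]
      rw [Finset.sum_eq_single p]
      · have e : -sg F n p + α + sg F n p = α := by abel
        rw [e, hv, hv, if_pos rfl, if_neg (by omega), if_neg (by omega), if_pos rfl]
        simp
      · intro q hq hqp
        have hq' := Finset.mem_Icc.mp hq
        rw [hv, hv, if_neg hqp, if_neg (by omega), if_neg (by omega), if_neg (by omega)]
        simp
      · intro hh
        exact absurd hp hh
    · intro h
      apply hne
      linear_combination -h

end
end
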